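/- For every integer n ≥ 2 and every ε > 0 there exists a constant C > 0 depending only on n and ε such that: for every real-split central division ℚ-algebra A of degree n and every pair of orders 𝒪 ⊆ 𝒪ₘ in A, writing N := [𝒪ₘ : 𝒪] for the (finite) index of 𝒪 in 𝒪ₘ as additive groups, the index of the norm-one unit groups satisfies C⁻¹ · N^{1-ε} ≤ [𝒪ₘ¹ : 𝒪¹] ≤ C · N^{1+ε}. -/

import Mathlib

open Matrix

/-- An order in a `ℚ`-algebra: a subring which is finitely generated as a `ℤ`-module and
contains a `ℚ`-basis of the algebra. -/
def IsOrder (A : Type*) [Ring A] [Algebra ℚ A] (O : Subring A) : Prop :=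
  O.toAddSubgroup.FG ∧ Submodule.span ℚ (O : Set A) = ⊤

/-- The index `[𝒪ₘ¹ : 𝒪¹]` of the norm-one unit groups, realised as the number of right
cosets: the cardinality of the quotient of the set of norm-one elements of `𝒪ₘ` by the
relation of differing by right multiplication by a norm-one element of `𝒪`.  (Since `𝒪¹`
is a group under multiplication, this relation is an equivalence relation and the quotient
is the coset space `𝒪ₘ¹/𝒪¹`.) -/
noncomputable def normOneUnitIndex {n : ℕ} {A : Type*} [DivisionRing A] [CharZero A]
    (ι : A →ₐ[ℚ] Matrix (Fin n) (Fin n) ℝ) (O Om : Subring A) : ℕ :=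
  Nat.card (Quot (fun (x y : {x : A // x ∈ Om ∧ (ι x).det = 1}) =>
    ∃ γ : A, γ ∈ O ∧ (ι γ).det = 1 ∧ (x : A) = (y : A) * γ))

namespace SA

lemma exists_int_basis {A : Type} [DivisionRing A] [CharZero A] {d : ℕ} (hd : Module.finrank ℚ A = d)
    (hd0 : 0 < d) (O : Subring A) (hO : O.toAddSubgroup.FG) (hs : Submodule.span ℚ (O : Set A) = ⊤) :
    ∃ e : Module.Basis (Fin d) ℚ A, ∀ x, x ∈ O ↔ ∀ i, ∃ z : ℤ, e.repr x i = z := by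
  have hfin : Module.Finite ℚ A := Module.finite_of_finrank_pos (by omega)
  let M : Submodule ℤ A := AddSubgroup.toIntSubmodule O.toAddSubgroup
  have hM : ∀ x, x ∈ M ↔ x ∈ O := fun x => Iff.rfl
  have hfg : M.FG := by
    rw [Submodule.fg_iff_addSubgroup_fg]
    exact hO
  have : Submodule.IsLattice ℚ M := ⟨hfg, by exact hs⟩
  have : Module.Finite ℤ M := Module.Finite.iff_fg.mpr hfg
  have : Module.Free ℤ M := Submodule.IsLattice.free ℚ M
  have hr : Module.finrank ℤ M = d := by
    rw [← hd]
    have := Submodule.IsLattice.rank' (K := ℚ) M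
    unfold Module.finrank; rw [this]
  let b0 : Module.Basis (Fin d) ℤ M := Module.finBasisOfFinrankEq ℤ M hr
  let e := b0.extendOfIsLattice ℚ
  have he : ∀ i, e i = b0 i := fun i => Module.Basis.extendOfIsLattice_apply ℚ b0 i
  refine ⟨e, fun x => ⟨fun hx i => ?_, fun h => ?_⟩⟩
  · replace hx : x ∈ M := hx
    refine ⟨b0.repr ⟨x, hx⟩ i, ?_⟩
    have h1 := b0.sum_repr ⟨x, hx⟩
    have h2 : x = ∑ i, ((b0.repr ⟨x, hx⟩ i : ℤ) : ℚ) • e i := by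
      have := congrArg (Subtype.val) h1
      simp only [AddSubmonoidClass.coe_finsetSum] at this
      refine this.symm.trans ?_
      refine Finset.sum_congr rfl fun i _ => ?_
      rw [he]
      simp [Int.cast_smul_eq_zsmul]
    conv_lhs => rw [h2]
    rw [e.repr_sum_self]
  · choose z hz using h
    rw [← e.sum_repr x]
    refine sum_mem fun i _ => ?_
    rw [hz, Int.cast_smul_eq_zsmul]
    refine zsmul_mem ?_ _
    rw [he]
    exact (b0 i).2

lemma indep_aux {A : Type} [DivisionRing A] [CharZero A] (hc : Subalgebra.center ℚ A = ⊥)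
    {n : ℕ} (hn : 0 < n) {F : Type} [Field F] [CharZero F] (j : A →ₐ[ℚ] Matrix (Fin n) (Fin n) F)
    {κ : Type} [DecidableEq κ] (f : κ → F) (hf : LinearIndependent ℚ f) (s : Finset κ) :
    ∀ a : κ → A, ∑ k ∈ s, f k • j (a k) = 0 → ∀ k ∈ s, a k = 0 := by
  induction s using Finset.induction_on with
  | empty => simp
  | insert k0 s hk0 ih =>
    intro a ha
    by_cases h0 : a k0 = 0
    · rw [Finset.sum_insert hk0, h0, map_zero, smul_zero, zero_add] at ha
      intro k hk
      rcases Finset.mem_insert.1 hk with rfl | hk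
      · exact h0
      · exact ih a ha k hk
    exfalso
    let b : κ → A := fun k => (a k0)⁻¹ * a k
    have hb0 : b k0 = 1 := inv_mul_cancel₀ h0
    have hb : ∑ k ∈ insert k0 s, f k • j (b k) = 0 := by
      have := congrArg (fun X => j (a k0)⁻¹ * X) ha
      simp only [Finset.mul_sum, mul_zero, mul_smul_comm, ← map_mul] at this
      exact this
    have hcen : ∀ k ∈ s, ∃ q : ℚ, b k = algebraMap ℚ A q := by
      intro k hk
      have : b k ∈ Subalgebra.center ℚ A := by
        rw [Subalgebra.mem_center_iff]
        intro y
        have h1 := congrArg (fun X => j y * X) hb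
        have h2 := congrArg (fun X => X * j y) hb
        simp only [Finset.mul_sum, Finset.sum_mul, mul_zero, zero_mul, mul_smul_comm, smul_mul_assoc, ← map_mul] at h1 h2
        have h3 : ∑ k ∈ s, f k • j (y * b k - b k * y) = 0 := by
          rw [Finset.sum_insert hk0, hb0] at h1 h2
          simp only [map_sub, smul_sub, Finset.sum_sub_distrib]
          rw [mul_one] at h1
          rw [one_mul] at h2
          rw [eq_neg_of_add_eq_zero_right h1, eq_neg_of_add_eq_zero_right h2, sub_self]
        exact sub_eq_zero.1 (ih _ h3 k hk)
      rw [hc, Algebra.mem_bot] at this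
      obtain ⟨q, hq⟩ := this
      exact ⟨q, hq.symm⟩
    have hcen' : ∀ k ∈ insert k0 s, ∃ q : ℚ, b k = algebraMap ℚ A q := by
      intro k hk
      rcases Finset.mem_insert.1 hk with rfl | hk
      · exact ⟨1, by rw [hb0, map_one]⟩
      · exact hcen k hk
    choose! q hq using hcen'
    have hz : ∑ k ∈ insert k0 s, q k • f k = 0 := by
      have h1 := congrFun (congrFun hb ⟨0, hn⟩) ⟨0, hn⟩
      rw [Matrix.sum_apply] at h1
      rw [Matrix.zero_apply] at h1
      rw [← h1]
      refine Finset.sum_congr rfl fun k hk => ?_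
      rw [hq k hk, AlgHom.commutes, Matrix.smul_apply, Matrix.algebraMap_matrix_apply, if_pos rfl,
        Algebra.smul_def, smul_eq_mul, mul_comm]
    have := linearIndependent_iff'.1 hf _ _ hz k0 (Finset.mem_insert_self _ _)
    have h2 := hq k0 (Finset.mem_insert_self _ _)
    rw [hb0, this, map_zero] at h2
    exact one_ne_zero h2

lemma indep {A : Type} [DivisionRing A] [CharZero A] (hc : Subalgebra.center ℚ A = ⊥)
    {n : ℕ} (hn : 0 < n) {F : Type} [Field F] [CharZero F] (j : A →ₐ[ℚ] Matrix (Fin n) (Fin n) F)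
    {d : ℕ} (e : Module.Basis (Fin d) ℚ A) : LinearIndependent F (fun i => j (e i)) := by
  classical
  rw [Fintype.linearIndependent_iff]
  intro c hcz
  let f := Module.Basis.ofVectorSpace ℚ F
  let s : Finset _ := Finset.univ.biUnion (fun i => (f.repr (c i)).support)
  have hcs : ∀ i, c i = ∑ k ∈ s, f.repr (c i) k • f k := by
    intro i
    conv_lhs => rw [← f.linearCombination_repr (c i)]
    rw [Finsupp.linearCombination_apply]
    refine Finsupp.sum_of_support_subset _ ?_ _ (by simp)
    exact Finset.subset_biUnion_of_mem (fun i => (f.repr (c i)).support) (Finset.mem_univ i)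
  have key := indep_aux hc hn j f f.linearIndependent s (fun k => ∑ i, f.repr (c i) k • e i) ?_
  · intro i
    rw [hcs i]
    refine Finset.sum_eq_zero fun k hk => ?_
    have := Fintype.linearIndependent_iff.1 e.linearIndependent _ (key k hk) i
    rw [this, zero_smul]
  · rw [← hcz]
    simp only [map_sum, map_smul, Finset.smul_sum]
    rw [Finset.sum_comm]
    refine Finset.sum_congr rfl fun i _ => ?_
    conv_rhs => rw [hcs i]
    rw [Finset.sum_smul]
    refine Finset.sum_congr rfl fun k _ => ?_
    rw [smul_comm, smul_assoc]

lemma charpoly_kron {n : ℕ} {F : Type} [Field F] (X : Matrix (Fin n) (Fin n) F) :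
    (Matrix.kroneckerMap (· * ·) X (1 : Matrix (Fin n) (Fin n) F)).charpoly = X.charpoly ^ n := by
  have : (Matrix.kroneckerMap (· * ·) X (1 : Matrix (Fin n) (Fin n) F)).charmatrix =
      Matrix.kroneckerMap (· * ·) X.charmatrix (1 : Matrix (Fin n) (Fin n) (Polynomial F)) := by
    ext ⟨i, i'⟩ ⟨k, k'⟩
    simp only [Matrix.charmatrix_apply, Matrix.kroneckerMap_apply, Matrix.diagonal_apply, Matrix.one_apply, Prod.mk.injEq]
    by_cases h : i = k <;> by_cases h' : i' = k' <;> simp [h, h']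
  rw [Matrix.charpoly, this, Matrix.det_kronecker]
  simp [Matrix.charpoly]

lemma charpoly_mulLeft {n : ℕ} {F : Type} [Field F] (X : Matrix (Fin n) (Fin n) F) :
    (LinearMap.mulLeft F X).charpoly = X.charpoly ^ n := by
  rw [← charpoly_kron, ← LinearMap.charpoly_toMatrix _ (Matrix.stdBasis F (Fin n) (Fin n))]
  congr 1
  ext ⟨i, i'⟩ ⟨k, k'⟩
  rw [LinearMap.toMatrix_apply, Matrix.stdBasis_eq_single]
  simp [Matrix.kroneckerMap_apply, Matrix.one_apply, Matrix.stdBasis, Matrix.mul_apply, Matrix.single_apply]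
  by_cases h : i' = k' <;> simp [h, eq_comm]

lemma charpoly_pow {A : Type} [DivisionRing A] [CharZero A] (hc : Subalgebra.center ℚ A = ⊥)
    {n : ℕ} (hn : 0 < n) {F : Type} [Field F] [CharZero F] (j : A →ₐ[ℚ] Matrix (Fin n) (Fin n) F)
    (e : Module.Basis (Fin (n^2)) ℚ A) (x : A) :
    (j x).charpoly ^ n = (LinearMap.toMatrix e e (LinearMap.mulLeft ℚ x)).charpoly.map (algebraMap ℚ F) := by
  have hli := indep hc hn j e
  have : Nonempty (Fin (n^2)) := ⟨⟨0, by positivity⟩⟩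
  let b := basisOfLinearIndependentOfCardEqFinrank (b := fun i => j (e i)) hli
    (by simp [Module.finrank_matrix, pow_two])
  have hb : ∀ i, b i = j (e i) := fun i => by simp [b]
  rw [← charpoly_mulLeft, ← LinearMap.charpoly_toMatrix _ b, ← Matrix.charpoly_map]
  congr 1
  ext i k
  rw [LinearMap.toMatrix_apply, Matrix.map_apply, LinearMap.toMatrix_apply, hb]
  simp only [LinearMap.mulLeft_apply]
  rw [← map_mul]
  have h1 := e.sum_repr (x * e k)
  conv_lhs => rw [← h1]
  rw [map_sum]
  have h2 : ∀ i, j (e.repr (x * e k) i • e i) = (algebraMap ℚ F (e.repr (x * e k) i)) • b i := by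
    intro i
    rw [hb, map_smul, algebraMap_smul]
  simp only [h2]
  rw [b.repr_sum_self]

end SA

namespace SA
open Polynomial in
lemma descent {F F' : Type} [Field F] [Field F'] [CharZero F] [CharZero F'] {n : ℕ} (hn : 0 < n) :
    ∀ (N : ℕ) (c : ℚ[X]) (p : F[X]) (p' : F'[X]), c.natDegree ≤ N → c.Monic → p.Monic → p'.Monic →
      p ^ n = c.map (algebraMap ℚ F) → p' ^ n = c.map (algebraMap ℚ F') →
      ∃ q : ℚ[X], q.Monic ∧ q ^ n = c ∧ p = q.map (algebraMap ℚ F) ∧ p' = q.map (algebraMap ℚ F') := by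
  intro N
  induction N with
  | zero =>
    intro c p p' hN hc hp hp' h h'
    have hc1 : c = 1 := by
      rw [← hc.natDegree_eq_zero]; omega
    subst hc1
    rw [Polynomial.map_one] at h h'
    have e1 : p = 1 := by
      rw [← hp.natDegree_eq_zero]
      have := congrArg natDegree h
      rw [natDegree_pow, natDegree_one] at this
      rcases Nat.mul_eq_zero.1 this with h | h <;> omega
    have e2 : p' = 1 := by
      rw [← hp'.natDegree_eq_zero]
      have := congrArg natDegree h'
      rw [natDegree_pow, natDegree_one] at this
      rcases Nat.mul_eq_zero.1 this with h | h <;> omega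
    exact ⟨1, monic_one, by simp, by simp [e1], by simp [e2]⟩
  | succ N ih =>
    intro c p p' hN hc hp hp' h h'
    by_cases hu : IsUnit c
    · apply ih c p p' _ hc hp hp' h h'
      rw [natDegree_eq_zero_of_isUnit hu]; omega
    obtain ⟨π, hπm, hπi, hπ⟩ := Polynomial.exists_monic_irreducible_factor c hu
    have dv : ∀ {K : Type} [Field K] [CharZero K] (P : K[X]), P ^ n = c.map (algebraMap ℚ K) →
        π.map (algebraMap ℚ K) ∣ P := by
      intro K _ _ P hP
      have hs : Squarefree (π.map (algebraMap ℚ K)) :=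
        (Polynomial.Separable.map hπi.separable).squarefree
      rw [← hs.dvd_pow_iff_dvd (Nat.pos_iff_ne_zero.1 hn), hP]
      exact Polynomial.map_dvd _ hπ
    obtain ⟨p1, rfl⟩ := dv p h
    obtain ⟨p1', rfl⟩ := dv p' h'
    have hd : π ^ n ∣ c := by
      rw [← Polynomial.map_dvd_map' (algebraMap ℚ F), ← h, Polynomial.map_pow, mul_pow]
      exact dvd_mul_right _ _
    obtain ⟨c1, rfl⟩ := hd
    have hc1 : c1.Monic := (hπm.pow n).of_mul_monic_left hc
    have hp1 : p1.Monic := (hπm.map _).of_mul_monic_left hp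
    have hp1' : p1'.Monic := (hπm.map _).of_mul_monic_left hp'
    rw [Polynomial.map_mul, Polynomial.map_pow, mul_pow] at h h'
    have h1 := mul_left_cancel₀ (pow_ne_zero n (hπm.map _).ne_zero) h
    have h1' := mul_left_cancel₀ (pow_ne_zero n (hπm.map _).ne_zero) h'
    have hdeg : c1.natDegree ≤ N := by
      rw [(hπm.pow n).natDegree_mul hc1, natDegree_pow] at hN
      have := hπi.natDegree_pos
      have : 0 < n * π.natDegree := by positivity
      omega
    obtain ⟨q, hq, e0, e1, e2⟩ := ih c1 p1 p1' hdeg hc1 hp1 hp1' h1 h1'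
    exact ⟨π * q, hπm.mul hq, by rw [mul_pow, e0], by rw [e1, Polynomial.map_mul], by rw [e2, Polynomial.map_mul]⟩

/-- reduced characteristic polynomial -/
lemma exists_cp {A : Type} [DivisionRing A] [CharZero A] (hc : Subalgebra.center ℚ A = ⊥)
    {n : ℕ} (hn : 0 < n) (ι : A →ₐ[ℚ] Matrix (Fin n) (Fin n) ℝ)
    (e : Module.Basis (Fin (n^2)) ℚ A) (x : A) :
    ∃ q : Polynomial ℚ, q.Monic ∧ q ^ n = (LinearMap.toMatrix e e (LinearMap.mulLeft ℚ x)).charpoly ∧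
      (∀ (F : Type) [Field F] [CharZero F] (j : A →ₐ[ℚ] Matrix (Fin n) (Fin n) F),
        (j x).charpoly = q.map (algebraMap ℚ F)) := by
  let c := (LinearMap.toMatrix e e (LinearMap.mulLeft ℚ x)).charpoly
  have hcm : c.Monic := Matrix.charpoly_monic _
  obtain ⟨q, hq, e0, e1, e2⟩ := descent hn _ c (ι x).charpoly (ι x).charpoly le_rfl hcm (Matrix.charpoly_monic _)
    (Matrix.charpoly_monic _) (charpoly_pow hc hn ι e x) (charpoly_pow hc hn ι e x)
  refine ⟨q, hq, e0, ?_⟩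
  intro F _ _ j
  obtain ⟨q', hq', e0', e1', e2'⟩ := descent hn _ c (ι x).charpoly (j x).charpoly le_rfl hcm (Matrix.charpoly_monic _)
    (Matrix.charpoly_monic _) (charpoly_pow hc hn ι e x) (charpoly_pow hc hn j e x)
  rw [e2']
  have : q.map (algebraMap ℚ ℝ) = q'.map (algebraMap ℚ ℝ) := by rw [← e1, ← e1']
  rw [Polynomial.map_injective _ (algebraMap ℚ ℝ).injective this]

/-- The standing data. -/
structure Ctx (A : Type) [DivisionRing A] [CharZero A] (n : ℕ) where
  hn : 2 ≤ n
  hc : Subalgebra.center ℚ A = ⊥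
  ι : A →ₐ[ℚ] Matrix (Fin n) (Fin n) ℝ
  M : Subring A
  e : Module.Basis (Fin (n^2)) ℚ A
  he : ∀ x, x ∈ M ↔ ∀ i, ∃ z : ℤ, e.repr x i = z

namespace Ctx
variable {A : Type} [DivisionRing A] [CharZero A] {n : ℕ} (S : Ctx A n)
lemma n_pos (S : Ctx A n) : 0 < n := by have := S.hn; omega

noncomputable def cp (x : A) : Polynomial ℚ := (exists_cp S.hc S.n_pos S.ι S.e x).choose
lemma cp_monic (x : A) : (S.cp x).Monic := (exists_cp S.hc S.n_pos S.ι S.e x).choose_spec.1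
lemma cp_pow (x : A) : (S.cp x) ^ n = (LinearMap.toMatrix S.e S.e (LinearMap.mulLeft ℚ x)).charpoly :=
  (exists_cp S.hc S.n_pos S.ι S.e x).choose_spec.2.1
lemma cp_map (x : A) {F : Type} [Field F] [CharZero F] (j : A →ₐ[ℚ] Matrix (Fin n) (Fin n) F) :
    (j x).charpoly = (S.cp x).map (algebraMap ℚ F) :=
  (exists_cp S.hc S.n_pos S.ι S.e x).choose_spec.2.2 F j

noncomputable def nr0 (x : A) : ℚ := (-1) ^ n * (S.cp x).coeff 0

lemma det0 (x : A) {F : Type} [Field F] [CharZero F] (j : A →ₐ[ℚ] Matrix (Fin n) (Fin n) F) :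
    (j x).det = (S.nr0 x : F) := by
  rw [Matrix.det_eq_sign_charpoly_coeff, S.cp_map, nr0, Polynomial.coeff_map]
  simp

noncomputable def nr : A →* ℚ where
  toFun := S.nr0
  map_one' := by
    have := S.det0 1 S.ι
    rw [map_one, det_one] at this
    exact_mod_cast this.symm
  map_mul' x y := by
    have := S.det0 (x * y) S.ι
    rw [map_mul, det_mul, S.det0, S.det0] at this
    exact_mod_cast this.symm

lemma det (x : A) {F : Type} [Field F] [CharZero F] (j : A →ₐ[ℚ] Matrix (Fin n) (Fin n) F) :
    (j x).det = (S.nr x : F) := S.det0 x j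

lemma nr_ne_zero {x : A} (hx : x ≠ 0) : S.nr x ≠ 0 := by
  have : S.nr x * S.nr x⁻¹ = 1 := by rw [← map_mul, mul_inv_cancel₀ hx, map_one]
  exact left_ne_zero_of_mul_eq_one this

lemma nr_zero : S.nr 0 = 0 := by
  have h := S.det 0 S.ι
  have : Nonempty (Fin n) := ⟨⟨0, S.n_pos⟩⟩
  rw [map_zero, Matrix.det_zero] at h
  exact_mod_cast h.symm

/-- integer vector of an element of `M` -/
lemma exists_int {x : A} (hx : x ∈ S.M) : ∃ z : Fin (n^2) → ℤ, ∀ i, S.e.repr x i = z i := by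
  have := (S.he x).1 hx
  choose z hz using this
  exact ⟨z, hz⟩

lemma exists_mat {x : A} (hx : x ∈ S.M) : ∃ B : Matrix (Fin (n^2)) (Fin (n^2)) ℤ,
    LinearMap.toMatrix S.e S.e (LinearMap.mulLeft ℚ x) = B.map (Int.castRingHom ℚ) := by
  have he : ∀ i, S.e i ∈ S.M := by
    intro i
    rw [S.he]
    intro k
    by_cases h : i = k
    · exact ⟨1, by simp [h]⟩
    · exact ⟨0, by simp [h]⟩
  have : ∀ i k, ∃ z : ℤ, S.e.repr (x * S.e k) i = z := by
    intro i k
    exact (S.he _).1 (mul_mem hx (he k)) i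
  choose B hB using this
  refine ⟨Matrix.of B, ?_⟩
  ext i k
  rw [LinearMap.toMatrix_apply]
  simp [hB]

/-- integral polynomial -/
lemma cp_int {x : A} (hx : x ∈ S.M) : ∃ f : Polynomial ℤ, f.Monic ∧ f.natDegree = n ∧
    S.cp x = f.map (Int.castRingHom ℚ) := by
  obtain ⟨B, hB⟩ := S.exists_mat hx
  have h1 := S.cp_pow x
  rw [hB, Matrix.charpoly_map] at h1
  have hdvd : S.cp x ∣ B.charpoly.map (Int.castRingHom ℚ) := by
    rw [← h1]; exact dvd_pow_self _ (by have := S.n_pos; omega)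
  obtain ⟨f, hf⟩ := IsIntegrallyClosed.eq_map_mul_C_of_dvd (R := ℤ) ℚ (Matrix.charpoly_monic B) (g := S.cp x)
    (by simpa using hdvd)
  rw [(S.cp_monic x).leadingCoeff, Polynomial.C_1, mul_one] at hf
  have hm : f.Monic := by
    have := S.cp_monic x
    rw [← hf] at this
    exact Polynomial.monic_of_injective (algebraMap ℤ ℚ).injective_int this
  refine ⟨f, hm, ?_, by rw [← hf]; rfl⟩
  have h2 := S.cp_map x S.ι
  have h3 := congrArg Polynomial.natDegree h2
  rw [Matrix.charpoly_natDegree_eq_dim, Polynomial.natDegree_map, ← hf, Polynomial.natDegree_map_eq_of_injective (algebraMap ℤ ℚ).injective_int] at h3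
  simpa using h3.symm

lemma cp_root {x : A} : Polynomial.aeval x (S.cp x) = 0 := by
  have h2 := Matrix.aeval_self_charpoly (S.ι x)
  rw [S.cp_map x S.ι, Polynomial.aeval_map_algebraMap, Polynomial.aeval_algHom_apply] at h2
  have hinj : Function.Injective S.ι := by
    have : Nonempty (Fin n) := ⟨⟨0, S.n_pos⟩⟩
    exact S.ι.toRingHom.injective
  exact hinj (by rw [h2, map_zero])

lemma nr_int {x : A} (hx : x ∈ S.M) : ∃ z : ℤ, S.nr x = z := by
  obtain ⟨f, _, _, hf⟩ := S.cp_int hx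
  refine ⟨(-1)^n * f.coeff 0, ?_⟩
  change (-1) ^ n * (S.cp x).coeff 0 = _
  rw [hf, Polynomial.coeff_map]
  simp

lemma smul_mem_M {x : A} (hx : x ∈ S.M) (z : ℤ) : (z : ℚ) • x ∈ S.M := by
  rw [Int.cast_smul_eq_zsmul]
  exact zsmul_mem hx z

lemma nsmul_mem_M {x : A} (hx : x ∈ S.M) (z : ℕ) : (z : ℚ) • x ∈ S.M := by
  have := S.smul_mem_M hx (z : ℤ); simpa using this

/-- `nr(x) x⁻¹ ∈ M`. -/
lemma adj_mem {x : A} (hx : x ∈ S.M) : ∃ y ∈ S.M, x * y = (S.nr x : ℚ) • 1 ∧ y * x = (S.nr x : ℚ) • 1 := by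
  obtain ⟨f, hm, hdeg, hf⟩ := S.cp_int hx
  have hroot := S.cp_root (x := x)
  rw [hf] at hroot
  have h1 : Polynomial.aeval x f = 0 := by
    rw [← hroot, show Int.castRingHom ℚ = algebraMap ℤ ℚ from rfl, Polynomial.aeval_map_algebraMap]
  have h2 := Polynomial.divX_mul_X_add f
  set g := Polynomial.aeval x f.divX with hg
  have hgM : g ∈ S.M := by
    rw [hg, Polynomial.aeval_eq_sum_range]
    refine sum_mem fun i _ => zsmul_mem (pow_mem hx _) _
  have h3 : g * x = - ((f.coeff 0 : ℤ) : A) := by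
    have := congrArg (Polynomial.aeval x) h2
    rw [map_add, map_mul, Polynomial.aeval_X, h1, Polynomial.aeval_C] at this
    rw [eq_neg_iff_add_eq_zero, ← this, hg]
    simp
  have h3' : x * g = - ((f.coeff 0 : ℤ) : A) := by
    rw [← h3, hg]
    have := congrArg (Polynomial.aeval x) (mul_comm Polynomial.X f.divX)
    rwa [map_mul, map_mul, Polynomial.aeval_X] at this
  have hnr : S.nr x = (-1)^n * (f.coeff 0 : ℤ) := by
    change (-1) ^ n * (S.cp x).coeff 0 = _
    rw [hf, Polynomial.coeff_map]; simp
  have hs : (S.nr x) • (1:A) = (-1 : A)^n * ((f.coeff 0 : ℤ) : A) := by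
    rw [hnr, Algebra.smul_def]; simp
  refine ⟨(-1 : A)^n * (-g), mul_mem (pow_mem (neg_mem (one_mem _)) _) (neg_mem hgM), ?_, ?_⟩
  · have : Commute x ((-1 : A)^n) := (Commute.neg_one_right x).pow_right n
    rw [← mul_assoc, this.eq, mul_assoc, mul_neg, h3', neg_neg, hs]
  · rw [mul_assoc, neg_mul, h3, neg_neg, hs]

lemma inv_mem {x : A} (hx : x ∈ S.M) (h : S.nr x = 1) : x⁻¹ ∈ S.M := by
  obtain ⟨y, hy, h1, h2⟩ := S.adj_mem hx
  rw [h, one_smul] at h1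
  rwa [← eq_inv_of_mul_eq_one_right h1]

end Ctx
end SA

namespace SA

section Small
variable {p : ℕ} [hp : Fact p.Prime] {n : ℕ}

/-- all entries have norm at most `p^(-k)` -/
def Sm (k : ℤ) (X : Matrix (Fin n) (Fin n) ℚ_[p]) : Prop := ∀ i j, ‖X i j‖ ≤ (p : ℝ) ^ (-k)

lemma p_one_lt : (1 : ℝ) < p := by exact_mod_cast hp.out.one_lt
lemma p_pos : (0 : ℝ) < p := by exact_mod_cast hp.out.pos

lemma Sm.mono {k k' : ℤ} {X : Matrix (Fin n) (Fin n) ℚ_[p]} (h : Sm k X) (hk : k' ≤ k) : Sm k' X :=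
  fun i j => (h i j).trans (zpow_le_zpow_right₀ (p_one_lt (p := p)).le (by omega))

lemma Sm.zero (k : ℤ) : Sm k (0 : Matrix (Fin n) (Fin n) ℚ_[p]) := fun i j => by
  simp only [Matrix.zero_apply, norm_zero]; exact zpow_nonneg (p_pos (p := p)).le _

lemma Sm.add {k : ℤ} {X Y : Matrix (Fin n) (Fin n) ℚ_[p]} (h : Sm k X) (h' : Sm k Y) : Sm k (X + Y) :=
  fun i j => (Padic.nonarchimedean _ _).trans (max_le (h i j) (h' i j))

lemma Sm.neg {k : ℤ} {X : Matrix (Fin n) (Fin n) ℚ_[p]} (h : Sm k X) : Sm k (-X) :=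
  fun i j => by rw [Matrix.neg_apply, norm_neg]; exact h i j

lemma Sm.sub {k : ℤ} {X Y : Matrix (Fin n) (Fin n) ℚ_[p]} (h : Sm k X) (h' : Sm k Y) : Sm k (X - Y) := by
  rw [sub_eq_add_neg]; exact h.add h'.neg

lemma norm_sum_le' {κ : Type*} (s : Finset κ) (f : κ → ℚ_[p]) {C : ℝ} (hC : 0 ≤ C)
    (h : ∀ i ∈ s, ‖f i‖ ≤ C) : ‖∑ i ∈ s, f i‖ ≤ C :=
  IsUltrametricDist.norm_sum_le_of_forall_le_of_nonneg hC h

lemma Sm.sum {κ : Type*} {k : ℤ} (s : Finset κ) (f : κ → Matrix (Fin n) (Fin n) ℚ_[p])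
    (h : ∀ i ∈ s, Sm k (f i)) : Sm k (∑ i ∈ s, f i) := by
  intro a b
  rw [Matrix.sum_apply]
  exact norm_sum_le' _ _ (zpow_nonneg (p_pos (p := p)).le _) fun i hi => h i hi a b

lemma Sm.mul {a b : ℤ} {X Y : Matrix (Fin n) (Fin n) ℚ_[p]} (h : Sm a X) (h' : Sm b Y) : Sm (a + b) (X * Y) := by
  intro i j
  rw [Matrix.mul_apply]
  refine norm_sum_le' _ _ (zpow_nonneg (p_pos (p := p)).le _) fun k _ => ?_
  rw [norm_mul, neg_add, zpow_add₀ (p_pos (p := p)).ne']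
  exact mul_le_mul (h i k) (h' k j) (norm_nonneg _) (zpow_nonneg (p_pos (p := p)).le _)

lemma Sm.mul_left0 {b : ℤ} {X Y : Matrix (Fin n) (Fin n) ℚ_[p]} (h : Sm 0 X) (h' : Sm b Y) : Sm b (X * Y) := by
  simpa using h.mul h'
lemma Sm.mul_right0 {b : ℤ} {X Y : Matrix (Fin n) (Fin n) ℚ_[p]} (h : Sm b X) (h' : Sm 0 Y) : Sm b (X * Y) := by
  simpa using h.mul h'

lemma Sm.smul {a b : ℤ} {c : ℚ_[p]} {X : Matrix (Fin n) (Fin n) ℚ_[p]} (h : ‖c‖ ≤ (p : ℝ) ^ (-a)) (h' : Sm b X) :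
    Sm (a + b) (c • X) := by
  intro i j
  rw [Matrix.smul_apply, smul_eq_mul, norm_mul, neg_add, zpow_add₀ (p_pos (p := p)).ne']
  exact mul_le_mul h (h' i j) (norm_nonneg _) (zpow_nonneg (p_pos (p := p)).le _)

lemma norm_p_pow' (k : ℕ) : ‖(p : ℚ_[p]) ^ k‖ = (p : ℝ) ^ (-(k : ℤ)) := by
  rw [Padic.norm_p_pow]

lemma Sm.smul_pow {b : ℤ} {X : Matrix (Fin n) (Fin n) ℚ_[p]} (k : ℕ) (h' : Sm b X) :
    Sm (k + b) ((p : ℚ_[p]) ^ k • X) := Sm.smul (norm_p_pow' k).le h'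

lemma Sm.smul_zpow {b : ℤ} {X : Matrix (Fin n) (Fin n) ℚ_[p]} (k : ℤ) (h' : Sm b X) :
    Sm (k + b) ((p : ℚ_[p]) ^ k • X) := Sm.smul (Padic.norm_p_zpow k).le h'

lemma norm_nat_le (k : ℕ) : ‖(k : ℚ_[p])‖ ≤ 1 := by
  have := Padic.norm_int_le_one (p := p) (k : ℤ)
  simpa using this

lemma Sm.smul_nat {b : ℤ} {X : Matrix (Fin n) (Fin n) ℚ_[p]} (k : ℕ) (h' : Sm b X) :
    Sm b ((k : ℚ_[p]) • X) := by
  have := Sm.smul (a := 0) (by simpa using norm_nat_le k) h'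
  simpa using this

lemma Sm.smul_int {b : ℤ} {X : Matrix (Fin n) (Fin n) ℚ_[p]} (k : ℤ) (h' : Sm b X) :
    Sm b ((k : ℚ_[p]) • X) := by
  have := Sm.smul (a := 0) (by simpa using Padic.norm_int_le_one (p := p) k) h'
  simpa using this

lemma Sm.one : Sm 0 (1 : Matrix (Fin n) (Fin n) ℚ_[p]) := by
  intro i j
  rw [Matrix.one_apply]
  split_ifs <;> simp

lemma Sm.pow {X : Matrix (Fin n) (Fin n) ℚ_[p]} (h : Sm 0 X) (k : ℕ) : Sm 0 (X ^ k) := by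
  induction k with
  | zero => simpa using Sm.one
  | succ k ih => rw [pow_succ]; exact ih.mul_right0 h

lemma exists_scalar (c : ℚ_[p]) : ∃ k : ℕ, ‖c‖ ≤ (p : ℝ) ^ (k : ℤ) := by
  obtain ⟨k, hk⟩ := pow_unbounded_of_one_lt ‖c‖ (p_one_lt (p := p))
  exact ⟨k, by simpa using hk.le⟩

lemma Sm.exists_nat (X : Matrix (Fin n) (Fin n) ℚ_[p]) : ∃ k : ℕ, Sm (-(k : ℤ)) X := by
  choose f hf using fun i j => exists_scalar (X i j)
  refine ⟨∑ i, ∑ j, f i j, fun i j => (hf i j).trans ?_⟩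
  rw [neg_neg]
  refine zpow_le_zpow_right₀ (p_one_lt (p := p)).le ?_
  have h1 : f i j ≤ ∑ j, f i j := Finset.single_le_sum (f := fun j => f i j) (fun _ _ => Nat.zero_le _) (Finset.mem_univ j)
  have h2 : ∑ j, f i j ≤ ∑ i, ∑ j, f i j :=
    Finset.single_le_sum (f := fun i => ∑ j, f i j) (fun _ _ => Nat.zero_le _) (Finset.mem_univ i)
  exact_mod_cast h1.trans h2

lemma eq_zero_of_small {c : ℚ_[p]} (h : ∀ k : ℕ, ‖c‖ ≤ (p : ℝ) ^ (-(k : ℤ))) : c = 0 := by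
  by_contra h0
  obtain ⟨k, hk⟩ := exists_pow_lt_of_lt_one (norm_pos_iff.2 h0) (inv_lt_one_of_one_lt₀ (p_one_lt (p := p)))
  have := h k
  rw [_root_.zpow_neg, zpow_natCast, ← inv_pow] at this
  linarith

lemma exists_not_small {c : ℚ_[p]} (h0 : c ≠ 0) : ∃ k : ℕ, ¬ ‖c‖ ≤ (p : ℝ) ^ (-(k : ℤ)) := by
  by_contra! h; exact h0 (eq_zero_of_small h)

lemma Sm.exists_of_ne {X : Matrix (Fin n) (Fin n) ℚ_[p]} (h0 : X ≠ 0) : ∃ k : ℕ, ¬ Sm k X := by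
  by_contra! h
  apply h0
  ext i j
  exact eq_zero_of_small fun k => h k i j

/-- lifting an integral matrix -/
lemma Sm.lift {k : ℕ} {X : Matrix (Fin n) (Fin n) ℚ_[p]} (h : Sm k X) :
    ∃ Y : Matrix (Fin n) (Fin n) ℤ_[p], X = ((p : ℤ_[p]) ^ k • Y).map PadicInt.Coe.ringHom := by
  have : ∀ i j, ∃ y : ℤ_[p], X i j = (p : ℚ_[p]) ^ k * y := by
    intro i j
    have hpk : (p : ℚ_[p]) ^ k ≠ 0 := pow_ne_zero _ (by exact_mod_cast hp.out.ne_zero)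
    refine ⟨⟨X i j / (p : ℚ_[p]) ^ k, ?_⟩, ?_⟩
    · rw [norm_div, norm_p_pow', div_le_one (zpow_pos (p_pos (p := p)) _)]
      exact h i j
    · simp only; field_simp
  choose Y hY using this
  refine ⟨Matrix.of Y, ?_⟩
  ext i j
  rw [hY]
  simp only [Matrix.map_apply, Matrix.smul_apply, Matrix.of_apply, smul_eq_mul, map_mul, map_pow, map_natCast]
  rfl

lemma det_trace {k : ℕ} {X : Matrix (Fin n) (Fin n) ℚ_[p]} (h : Sm k X) :
    ‖(1 + X).det - 1 - X.trace‖ ≤ (p : ℝ) ^ (-(2 * k : ℤ)) := by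
  obtain ⟨Y, rfl⟩ := h.lift
  have h1 : (1 + ((p : ℤ_[p]) ^ k • Y).map PadicInt.Coe.ringHom).det =
      PadicInt.Coe.ringHom (1 + (p : ℤ_[p]) ^ k • Y).det := by
    rw [RingHom.map_det, RingHom.mapMatrix_apply, Matrix.map_add _ (map_add _), Matrix.map_one _ (map_zero _) (map_one _)]
  have h2 : (((p : ℤ_[p]) ^ k • Y).map PadicInt.Coe.ringHom).trace = PadicInt.Coe.ringHom (((p : ℤ_[p]) ^ k • Y).trace) := by
    simp [Matrix.trace, map_sum]
  rw [h1, h2, Matrix.det_one_add_smul, Matrix.trace_smul]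
  generalize Polynomial.eval ((p : ℤ_[p]) ^ k) _ = w
  have h3 : (PadicInt.Coe.ringHom (1 + Y.trace * (p : ℤ_[p]) ^ k + w * ((p : ℤ_[p]) ^ k) ^ 2) - 1 -
    PadicInt.Coe.ringHom ((p : ℤ_[p]) ^ k • Y.trace) : ℚ_[p]) = PadicInt.Coe.ringHom w * (p : ℚ_[p]) ^ (2 * k) := by
    simp only [map_add, map_mul, map_pow, map_one, smul_eq_mul, map_natCast]; ring
  rw [h3, norm_mul, norm_p_pow']
  have : ‖(PadicInt.Coe.ringHom w : ℚ_[p])‖ ≤ 1 := w.2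
  have h5 := zpow_pos (p_pos (p := p)) (-((2 * k : ℕ) : ℤ))
  calc _ ≤ 1 * (p : ℝ) ^ (-((2 * k : ℕ) : ℤ)) := by gcongr
    _ = _ := by push_cast; ring

lemma Sm.trace {k : ℤ} {X : Matrix (Fin n) (Fin n) ℚ_[p]} (h : Sm k X) : ‖X.trace‖ ≤ (p : ℝ) ^ (-k) :=
  norm_sum_le' _ _ (zpow_nonneg (p_pos (p := p)).le _) fun i _ => h i i

lemma det_close {k : ℕ} {X : Matrix (Fin n) (Fin n) ℚ_[p]} (h : Sm k X) :
    ‖(1 + X).det - 1‖ ≤ (p : ℝ) ^ (-(k : ℤ)) := by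
  have h1 := det_trace h
  have h2 := h.trace
  have : (1 + X).det - 1 = ((1 + X).det - 1 - X.trace) + X.trace := by ring
  rw [this]
  refine (Padic.nonarchimedean _ _).trans (max_le (h1.trans ?_) h2)
  exact zpow_le_zpow_right₀ (p_one_lt (p := p)).le (by omega)

lemma Sm.adjugate {X : Matrix (Fin n) (Fin n) ℚ_[p]} (h : Sm 0 X) : Sm 0 X.adjugate := by
  obtain ⟨Y, rfl⟩ := Sm.lift (k := 0) h
  rw [pow_zero, one_smul]
  have := RingHom.map_adjugate (PadicInt.Coe.ringHom (p := p)) Y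
  rw [RingHom.mapMatrix_apply, RingHom.mapMatrix_apply] at this
  rw [← this]
  intro i j
  rw [neg_zero, zpow_zero]
  exact (Y.adjugate i j).2

lemma Sm.inv {X : Matrix (Fin n) (Fin n) ℚ_[p]} {a : ℤ} (h : Sm 0 X) (hd : (p : ℝ) ^ (-a) ≤ ‖X.det‖) : Sm (-a) X⁻¹ := by
  rw [Matrix.inv_def, Ring.inverse_eq_inv']
  have := Sm.smul (a := -a) (c := X.det⁻¹) ?_ h.adjugate
  · simpa using this
  rw [norm_inv, neg_neg]
  have h0 := zpow_pos (p_pos (p := p)) (-a)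
  calc ‖X.det‖⁻¹ ≤ ((p : ℝ) ^ (-a))⁻¹ := by gcongr
    _ = _ := by rw [_root_.zpow_neg, inv_inv]

lemma Sm.inv_det_one {X : Matrix (Fin n) (Fin n) ℚ_[p]} (h : Sm 0 X) (hd : X.det = 1) : Sm 0 X⁻¹ := by
  have := Sm.inv (a := 0) h (by simp [hd])
  simpa using this

lemma Sm.inv_of_close {X : Matrix (Fin n) (Fin n) ℚ_[p]} (h : Sm 1 (X - 1)) : Sm 0 X⁻¹ ∧ X.det ≠ 0 := by
  have h1 := det_close (k := 1) (by simpa using h)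
  rw [add_sub_cancel] at h1
  have h2 : ‖X.det - 1‖ < 1 := by
    refine h1.trans_lt ?_
    have := p_one_lt (p := p)
    rw [_root_.zpow_neg]; apply inv_lt_one_of_one_lt₀; simpa using this
  have h3 : ‖X.det‖ = 1 := by
    have : X.det = (X.det - 1) + 1 := by ring
    rw [this, Padic.add_eq_max_of_ne (by rw [norm_one]; exact h2.ne), norm_one]
    exact max_eq_right h2.le
  have h0 : Sm 0 X := by
    have : X = (X - 1) + 1 := by abel
    rw [this]; exact (h.mono (by norm_num)).add Sm.one
  constructor
  · have := Sm.inv (a := 0) h0 (by simp [h3])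
    simpa using this
  · intro h; rw [h] at h3; simp at h3

end Small
end SA

namespace SA
namespace Ctx
variable {A : Type} [DivisionRing A] [CharZero A] {n : ℕ} (S : Ctx A n)

/-- `x ∈ m M[1/l]` -/
def Lm (l m : ℕ) (x : A) : Prop := ∃ s : ℕ, ∃ y ∈ S.M, ((l : ℚ) ^ s) • x = (m : ℚ) • y

variable {S} {l m m' : ℕ} {x y : A}

lemma Lm.of_mem (hx : x ∈ S.M) : S.Lm l 1 x := ⟨0, x, hx, by simp⟩

lemma Lm.zero : S.Lm l m (0 : A) := ⟨0, 0, zero_mem _, by simp⟩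

lemma Lm.neg (h : S.Lm l m x) : S.Lm l m (-x) := by
  obtain ⟨s, y, hy, h⟩ := h
  exact ⟨s, -y, neg_mem hy, by rw [smul_neg, h, smul_neg]⟩

lemma Lm.lift (h : S.Lm l m x) : ∃ s0 : ℕ, ∀ s ≥ s0, ∃ y ∈ S.M, ((l : ℚ) ^ s) • x = (m : ℚ) • y := by
  obtain ⟨s0, y, hy, h⟩ := h
  refine ⟨s0, fun s hs => ⟨((l ^ (s - s0) : ℕ) : ℚ) • y, S.nsmul_mem_M hy _, ?_⟩⟩
  rw [smul_comm, ← h, smul_smul]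
  congr 1
  push_cast
  rw [← pow_add]; congr 1; omega

lemma Lm.add (hx : S.Lm l m x) (hy : S.Lm l m y) : S.Lm l m (x + y) := by
  obtain ⟨s, hs⟩ := hx.lift
  obtain ⟨t, ht⟩ := hy.lift
  obtain ⟨a, ha, h1⟩ := hs (max s t) (le_max_left _ _)
  obtain ⟨b, hb, h2⟩ := ht (max s t) (le_max_right _ _)
  exact ⟨max s t, a + b, add_mem ha hb, by rw [smul_add, smul_add, h1, h2]⟩

lemma Lm.sub (hx : S.Lm l m x) (hy : S.Lm l m y) : S.Lm l m (x - y) := by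
  rw [sub_eq_add_neg]; exact hx.add hy.neg

lemma Lm.mul (hx : S.Lm l m x) (hy : S.Lm l m' y) : S.Lm l (m * m') (x * y) := by
  obtain ⟨s, a, ha, h1⟩ := hx
  obtain ⟨t, b, hb, h2⟩ := hy
  refine ⟨s + t, a * b, mul_mem ha hb, ?_⟩
  rw [pow_add, ← smul_mul_smul_comm, h1, h2, smul_mul_smul_comm]; push_cast; rfl

lemma Lm.mul_left (hx : S.Lm l 1 x) (hy : S.Lm l m y) : S.Lm l m (x * y) := by
  simpa using hx.mul hy
lemma Lm.mul_right (hx : S.Lm l m x) (hy : S.Lm l 1 y) : S.Lm l m (x * y) := by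
  simpa using hx.mul hy

lemma Lm.of_dvd (hx : S.Lm l m x) (h : m' ∣ m) : S.Lm l m' x := by
  obtain ⟨k, rfl⟩ := h
  obtain ⟨s, a, ha, h1⟩ := hx
  refine ⟨s, (k : ℚ) • a, S.nsmul_mem_M ha _, ?_⟩
  rw [h1, smul_smul]; push_cast; rfl

lemma Lm.to_one (hx : S.Lm l m x) : S.Lm l 1 x := hx.of_dvd (one_dvd _)

lemma Lm.one : S.Lm l 1 (1 : A) := Lm.of_mem (one_mem _)

lemma Lm.smul_nat (hx : S.Lm l m x) (k : ℕ) : S.Lm l (k * m) ((k : ℚ) • x) := by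
  obtain ⟨s, a, ha, h1⟩ := hx
  refine ⟨s, a, ha, ?_⟩
  rw [smul_comm, h1, smul_smul]; push_cast; rfl

lemma Lm.of_smul (_hl : l ≠ 0) (t : ℕ) (hx : S.Lm l m ((l : ℚ) ^ t • x)) : S.Lm l m x := by
  obtain ⟨s, a, ha, h1⟩ := hx
  exact ⟨s + t, a, ha, by rw [pow_add, ← smul_smul, h1]⟩

lemma Lm.mem_of_l_one (hx : S.Lm 1 1 x) : x ∈ S.M := by
  obtain ⟨s, a, ha, h1⟩ := hx
  simp at h1; rwa [h1]

/-- the inverse -/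
lemma Lm.inv (hl : l ≠ 0) (hx : S.Lm l 1 x) {ν : ℤ} (hν : S.nr x = ν) (hν0 : ν ≠ 0) :
    S.Lm l 1 ((ν : ℚ) • x⁻¹) := by
  obtain ⟨s, a, ha, h1⟩ := hx
  simp only [Nat.cast_one, one_smul] at h1
  have hlq : (l : ℚ) ≠ 0 := by exact_mod_cast hl
  have hx0 : x ≠ 0 := by
    rintro rfl
    rw [S.nr_zero] at hν
    exact hν0 (by exact_mod_cast hν.symm)
  obtain ⟨y, hy, h2, h3⟩ := S.adj_mem ha
  have hnr : S.nr a = (l : ℚ) ^ (s * n) * ν := by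
    have := S.det a S.ι
    rw [← h1, map_smul, ← Rat.cast_smul_eq_qsmul ℝ, Matrix.det_smul, S.det x S.ι, hν] at this
    rw [pow_mul]
    have h4 : ((S.nr ((l : ℚ) ^ s • x) : ℚ) : ℝ) = (((l : ℚ) ^ s) ^ n * ν : ℚ) := by
      rw [← this]; push_cast; simp
    rw [← h1]; exact_mod_cast h4
  have ha0 : a ≠ 0 := by
    rw [← h1]; exact smul_ne_zero (pow_ne_zero _ hlq) hx0
  have h5 : y = ((l : ℚ) ^ (s * n) * ν) • a⁻¹ := by
    rw [← hnr]
    calc y = a⁻¹ * (a * y) := by rw [← mul_assoc, inv_mul_cancel₀ ha0, one_mul]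
      _ = _ := by rw [h2, mul_smul_comm, mul_one]
  refine Lm.of_smul hl (s * n) ?_
  have h6 : x⁻¹ = (l : ℚ) ^ s • a⁻¹ := by
    refine inv_eq_of_mul_eq_one_right ?_
    rw [mul_smul_comm, ← smul_mul_assoc, h1, mul_inv_cancel₀ ha0]
  have h7 : (l : ℚ) ^ (s * n) • (ν : ℚ) • x⁻¹ = ((l ^ s : ℕ) : ℚ) • y := by
    rw [h6, h5]; simp only [smul_smul]; congr 1; push_cast; ring
  rw [h7]
  exact Lm.of_mem (S.nsmul_mem_M hy _)

variable (S l m) in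
/-- the congruence group -/
def Gam : Submonoid A where
  carrier := {h | S.nr h = 1 ∧ S.Lm l m (h - 1)}
  one_mem' := ⟨map_one _, by rw [sub_self]; exact Lm.zero⟩
  mul_mem' := by
    rintro a b ⟨ha, ha'⟩ ⟨hb, hb'⟩
    refine ⟨by rw [map_mul, ha, hb, one_mul], ?_⟩
    have h1 : S.Lm l 1 b := by
      have : b = (b - 1) + 1 := by abel
      rw [this]; exact hb'.to_one.add Lm.one
    have : a * b - 1 = (a - 1) * b + (b - 1) := by noncomm_ring
    rw [this]
    exact (ha'.mul_right h1).add hb'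

lemma mem_Gam : x ∈ S.Gam l m ↔ S.nr x = 1 ∧ S.Lm l m (x - 1) := Iff.rfl

lemma Gam_Lm (hx : x ∈ S.Gam l m) : S.Lm l 1 x := by
  have : x = (x - 1) + 1 := by abel
  rw [this]; exact hx.2.to_one.add Lm.one

lemma Gam_ne (hx : x ∈ S.Gam l m) : x ≠ 0 := by
  rintro rfl
  have := hx.1
  rw [S.nr_zero] at this; norm_num at this

lemma Gam_inv (hl : l ≠ 0) (hx : x ∈ S.Gam l m) : x⁻¹ ∈ S.Gam l m := by
  have hx0 := Gam_ne hx
  have h1 := Lm.inv hl (Gam_Lm hx) (ν := 1) (by simpa using hx.1) one_ne_zero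
  simp only [Int.cast_one, one_smul] at h1
  refine ⟨?_, ?_⟩
  · have : S.nr x⁻¹ * S.nr x = 1 := by rw [← map_mul, inv_mul_cancel₀ hx0, map_one]
    rwa [hx.1, mul_one] at this
  · have : x⁻¹ - 1 = x⁻¹ * (-(x - 1)) := by
      rw [neg_sub, mul_sub, mul_one, inv_mul_cancel₀ hx0]
    rw [this]
    exact h1.mul_left hx.2.neg

lemma Gam_mono (hx : x ∈ S.Gam l m) (h : m' ∣ m) : x ∈ S.Gam l m' := ⟨hx.1, hx.2.of_dvd h⟩

lemma Gam_one_mem (hx : x ∈ S.Gam 1 m) : x ∈ S.M := (Gam_Lm hx).mem_of_l_one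

lemma Gam_of_one (hx : x ∈ S.Gam 1 m) : x ∈ S.Gam l m := by
  refine ⟨hx.1, ?_⟩
  obtain ⟨s, a, ha, h1⟩ := hx.2
  exact ⟨0, a, ha, by simpa using h1⟩

/-- class lemma -/
lemma div_mem_Gam (hl : l ≠ 0) {a a' : A} (ha' : S.Lm l 1 a') {ν : ℤ} (h1 : S.nr a = ν)
    (h2 : S.nr a' = ν) (hν : ν ≠ 0) (h : S.Lm l (m * ν.natAbs) (a - a')) : a * a'⁻¹ ∈ S.Gam l m := by
  have ha0 : a' ≠ 0 := by
    rintro rfl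
    rw [S.nr_zero] at h2
    exact hν (by exact_mod_cast h2.symm)
  have hinv := ha'.inv hl h2 hν
  have hνq : (ν : ℚ) ≠ 0 := by exact_mod_cast hν
  refine ⟨?_, ?_⟩
  · have h3 : S.nr (a * a'⁻¹) * S.nr a' = S.nr a := by
      rw [← map_mul, mul_assoc, inv_mul_cancel₀ ha0, mul_one]
    rw [h1, h2] at h3
    exact mul_right_cancel₀ hνq (by rw [h3, one_mul])
  · have h4 : a * a'⁻¹ - 1 = (a - a') * a'⁻¹ := by rw [sub_mul, mul_inv_cancel₀ ha0]
    rw [h4]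
    obtain ⟨s, y, hy, h5⟩ := h
    have h6 : S.Lm l m (((l : ℚ) ^ s) • ((a - a') * a'⁻¹)) := by
      rw [← smul_mul_assoc, h5]
      have h7 : ((m * ν.natAbs : ℕ) : ℚ) • y * a'⁻¹ = (m : ℚ) • (((ν.sign : ℤ) : ℚ) • (y * ((ν : ℚ) • a'⁻¹))) := by
        rw [smul_mul_assoc, mul_smul_comm, smul_smul, smul_smul]
        congr 1
        have : (ν.natAbs : ℚ) = (ν.sign : ℚ) * ν := by
          have := Int.sign_mul_self_eq_abs ν
          rw [← Int.cast_mul, this, ← Int.natCast_natAbs]; rfl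
        push_cast; rw [this]; ring
      rw [h7]
      have h8 : S.Lm l 1 (((ν.sign : ℤ) : ℚ) • (y * ((ν : ℚ) • a'⁻¹))) := by
        rw [← smul_mul_assoc]
        exact (Lm.of_mem (S.smul_mem_M hy _)).mul_left hinv
      have := h8.smul_nat m
      simpa using this
    exact Lm.of_smul hl s h6

/-- common denominators -/
lemma exists_den (S : Ctx A n) (x : A) : ∃ D : ℕ, 0 < D ∧ (D : ℚ) • x ∈ S.M := by
  refine ⟨∏ i, (S.e.repr x i).den, Finset.prod_pos fun i _ => (S.e.repr x i).den_pos, ?_⟩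
  rw [S.he]
  intro i
  obtain ⟨c, hc⟩ := Finset.dvd_prod_of_mem (fun i => (S.e.repr x i).den) (Finset.mem_univ i)
  refine ⟨c * (S.e.repr x i).num, ?_⟩
  rw [hc, map_smul, Finsupp.smul_apply, smul_eq_mul]
  push_cast
  have := Rat.mul_den_eq_num (S.e.repr x i)
  rw [mul_comm ((S.e.repr x i).den : ℚ), mul_assoc, mul_comm ((S.e.repr x i).den : ℚ), this]

lemma exists_cl0 (S : Ctx A n) (k : ℕ) : ∃ (cl : A → (Fin (n^2) → ZMod k)),
    ∀ x y, x ∈ S.M → y ∈ S.M → cl x = cl y → ∃ w ∈ S.M, x - y = (k : ℚ) • w := by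
  classical
  have : ∀ x, ∃ c : Fin (n^2) → ZMod k, x ∈ S.M → ∃ z : Fin (n^2) → ℤ, ∀ i, S.e.repr x i = z i ∧ c i = z i := by
    intro x
    by_cases hx : x ∈ S.M
    · obtain ⟨z, hz⟩ := S.exists_int hx
      exact ⟨fun i => z i, fun _ => ⟨z, fun i => ⟨hz i, rfl⟩⟩⟩
    · exact ⟨0, fun h => absurd h hx⟩
  choose cl hcl using this
  refine ⟨cl, fun x y hx hy h => ?_⟩
  obtain ⟨z, hz⟩ := hcl x hx
  obtain ⟨z', hz'⟩ := hcl y hy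
  have h1 : ∀ i, ∃ t : ℤ, z i - z' i = k * t := by
    intro i
    have : ((z i - z' i : ℤ) : ZMod k) = 0 := by
      push_cast; rw [← (hz i).2, ← (hz' i).2, h, sub_self]
    exact (ZMod.intCast_zmod_eq_zero_iff_dvd _ _).1 this
  choose t ht using h1
  refine ⟨∑ i, (t i : ℚ) • S.e i, ?_, ?_⟩
  · rw [S.he]
    intro i
    exact ⟨t i, by rw [S.e.repr_sum_self]⟩
  · apply S.e.repr.injective
    ext i
    rw [map_sub, map_smul, Finsupp.sub_apply, Finsupp.smul_apply, S.e.repr_sum_self, (hz i).1, (hz' i).1, smul_eq_mul]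
    exact_mod_cast ht i

/-- finitely many classes modulo `k M[1/l]` -/
lemma exists_cl (S : Ctx A n) (l k : ℕ) (hk : k ≠ 0) : ∃ (T : Type) (_ : Finite T) (cl : A → T),
    ∀ x y, S.Lm l 1 x → S.Lm l 1 y → cl x = cl y → S.Lm l k (x - y) := by
  classical
  have : NeZero k := ⟨hk⟩
  obtain ⟨cl, hcl⟩ := S.exists_cl0 k
  have : ∀ x, ∃ (s : ℕ) (y : A), S.Lm l 1 x → y ∈ S.M ∧ (l : ℚ) ^ s • x = y := by
    intro x
    by_cases hx : S.Lm l 1 x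
    · obtain ⟨s, y, hy, h⟩ := hx
      exact ⟨s, y, fun _ => ⟨hy, by simpa using h⟩⟩
    · exact ⟨0, 0, fun h => absurd h hx⟩
  choose s y hy using this
  refine ⟨(Fin (n^2) → ZMod k) × ZMod k, inferInstance, fun x => (cl (y x), ((l ^ s x : ℕ) : ZMod k)), ?_⟩
  intro a b ha hb h
  simp only [Prod.mk.injEq] at h
  obtain ⟨h1, h2⟩ := h
  obtain ⟨hya, ea⟩ := hy a ha
  obtain ⟨hyb, eb⟩ := hy b hb
  obtain ⟨w, hw, e3⟩ := hcl _ _ hya hyb h1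
  have h4 : ((l ^ s b - l ^ s a : ℤ) : ZMod k) = 0 := by
    push_cast at h2 ⊢; rw [h2, sub_self]
  obtain ⟨t, ht⟩ := (ZMod.intCast_zmod_eq_zero_iff_dvd _ _).1 h4
  have ht' : (l : ℚ) ^ s b = (l : ℚ) ^ s a + k * t := by
    have h5 : (l : ℤ) ^ s b = (l : ℤ) ^ s a + k * t := by linarith
    exact_mod_cast h5
  refine ⟨s a + s b, ((l ^ s a : ℕ) : ℚ) • w + (t : ℚ) • y a, add_mem (S.nsmul_mem_M hw _) (S.smul_mem_M hya _), ?_⟩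
  have h6 : (l : ℚ) ^ (s a + s b) • (a - b) = (l : ℚ) ^ s b • y a - (l : ℚ) ^ s a • y b := by
    rw [smul_sub, ← ea, ← eb, smul_smul, smul_smul, pow_add]
    congr 2; ring
  rw [h6, ht', add_smul, add_sub_right_comm, ← smul_sub, e3, smul_add, smul_smul, smul_smul, smul_smul]
  congr 2
  push_cast; ring

/-- a uniform exponent -/
lemma exists_exp (S : Ctx A n) (k : ℕ) (hk : k ≠ 0) : ∃ E : ℕ, 0 < E ∧ ∀ x ∈ S.M, S.nr x = 1 → x ^ E ∈ S.Gam 1 k := by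
  classical
  obtain ⟨T, hT, cl, hcl⟩ := S.exists_cl 1 k hk
  have := Fintype.ofFinite T
  refine ⟨(Fintype.card T).factorial, Nat.factorial_pos _, fun x hx h => ?_⟩
  have hx1 : x ∈ S.Gam 1 1 := ⟨h, (Lm.of_mem hx).sub Lm.one⟩
  obtain ⟨a, b, hab, he⟩ := Fintype.exists_ne_map_eq_of_card_lt (fun i : Fin (Fintype.card T + 1) => cl (x ^ (i : ℕ)))
    (by simp)
  have hx0 := Gam_ne hx1
  have key : ∀ a b : ℕ, a < b → b ≤ Fintype.card T → cl (x ^ a) = cl (x ^ b) → x ^ (Fintype.card T).factorial ∈ S.Gam 1 k := by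
    intro a b hab hb he
    have h1 := hcl _ _ (Gam_Lm (pow_mem hx1 b)) (Gam_Lm (pow_mem hx1 a)) he.symm
    have h2 : x ^ (b - a) ∈ S.Gam 1 k := by
      refine ⟨by rw [map_pow, h, one_pow], ?_⟩
      have h3 : x ^ (b - a) - 1 = (x ^ a)⁻¹ * (x ^ b - x ^ a) := by
        rw [mul_sub, inv_mul_cancel₀ (pow_ne_zero _ hx0)]
        congr 1
        rw [eq_inv_mul_iff_mul_eq₀ (pow_ne_zero _ hx0), ← pow_add]; congr 1; omega
      rw [h3]
      exact (Gam_Lm (Gam_inv one_ne_zero (pow_mem hx1 a))).mul_left h1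
    obtain ⟨c, hc⟩ : (b - a) ∣ (Fintype.card T).factorial := Nat.dvd_factorial (by omega) (by omega)
    rw [hc, pow_mul]
    exact pow_mem h2 c
  rcases lt_or_gt_of_ne (fun h => hab (Fin.ext h) : (a : ℕ) ≠ b) with h1 | h1
  · exact key a b h1 (by omega) he
  · exact key b a h1 (by omega) he.symm

/-- conjugation: for `x ≠ 0` there is `D` with `D x M x⁻¹ ⊆ M`, hence ... -/
lemma exists_conj (S : Ctx A n) (x : A) (hx : x ≠ 0) (m : ℕ) : ∃ D : ℕ, 0 < D ∧ ∀ γ ∈ S.Gam 1 (m * D), x * γ * x⁻¹ ∈ S.Gam 1 m := by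
  obtain ⟨D1, h1, hx1⟩ := S.exists_den x
  obtain ⟨D2, h2, hx2⟩ := S.exists_den x⁻¹
  refine ⟨D1 * D2, by positivity, fun γ hγ => ⟨?_, ?_⟩⟩
  · have : S.nr (x * x⁻¹) = 1 := by rw [mul_inv_cancel₀ hx, map_one]
    rw [map_mul, map_mul, hγ.1, mul_one, ← map_mul, this]
  · obtain ⟨s, y, hy, h⟩ := hγ.2
    simp only [Nat.cast_one, one_pow, one_smul] at h
    refine ⟨0, ((D1 : ℚ) • x) * y * ((D2 : ℚ) • x⁻¹), mul_mem (mul_mem hx1 hy) hx2, ?_⟩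
    have h3 : x * γ * x⁻¹ - 1 = x * (γ - 1) * x⁻¹ := by
      rw [mul_sub, sub_mul, mul_one, mul_inv_cancel₀ hx]
    rw [h3, h]
    simp only [smul_mul_assoc, mul_smul_comm, smul_smul]
    push_cast
    simp only [pow_zero, one_smul]
    congr 1; ring

end Ctx
end SA

namespace SA
section
variable {p : ℕ} [hp : Fact p.Prime] {n : ℕ}

lemma pow_approx {u : Matrix (Fin n) (Fin n) ℚ_[p]} {a : ℤ} (ha : 0 ≤ a) (h : Sm a u) (E : ℕ) :
    Sm (a + a) ((1 + u) ^ E - 1 - (E : ℚ_[p]) • u) := by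
  induction E with
  | zero => simpa using Sm.zero _
  | succ E ih =>
    have : (1 + u) ^ (E + 1) - 1 - ((E + 1 : ℕ) : ℚ_[p]) • u =
        ((1 + u) ^ E - 1 - (E : ℚ_[p]) • u) * (1 + u) + (E : ℚ_[p]) • (u * u) := by
      rw [pow_succ]; push_cast
      rw [add_smul, one_smul, sub_mul, sub_mul, smul_mul_assoc, mul_add u, mul_add]
      simp only [smul_add, mul_one, one_mul, mul_add]
      abel
    rw [this]
    exact (ih.mul_right0 (Sm.one.add (h.mono ha))).add ((h.mul h).smul_nat E)
end

namespace Ctx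
variable {A : Type} [DivisionRing A] [CharZero A] {n : ℕ} (S : Ctx A n)
variable {p : ℕ} [hp : Fact p.Prime] (j : A →ₐ[ℚ] Matrix (Fin n) (Fin n) ℚ_[p]) (m : ℕ)

/-- tangent directions of the closure of the congruence group -/
def T : Set (Matrix (Fin n) (Fin n) ℚ_[p]) := {z | ∀ c : ℕ, ∃ k0 : ℕ, ∀ k : ℕ, k0 ≤ k →
  ∃ γ ∈ S.Gam 1 m, Sm (k + c) (j γ - 1 - (p : ℚ_[p]) ^ k • z)}

variable {S j m} {z w : Matrix (Fin n) (Fin n) ℚ_[p]}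

lemma T.zero : (0 : Matrix (Fin n) (Fin n) ℚ_[p]) ∈ S.T j m := by
  intro c
  refine ⟨0, fun k _ => ⟨1, one_mem _, ?_⟩⟩
  simpa using Sm.zero _

lemma T.add (hz : z ∈ S.T j m) (hw : w ∈ S.T j m) : z + w ∈ S.T j m := by
  intro c
  obtain ⟨k1, h1⟩ := hz c
  obtain ⟨k2, h2⟩ := hw c
  obtain ⟨s, hs⟩ := Sm.exists_nat z
  obtain ⟨t, ht⟩ := Sm.exists_nat w
  refine ⟨k1 + k2 + c + s + t, fun k hk => ?_⟩
  obtain ⟨a, ha, h1⟩ := h1 k (by omega)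
  obtain ⟨b, hb, h2⟩ := h2 k (by omega)
  refine ⟨a * b, mul_mem ha hb, ?_⟩
  have hb1 : Sm (k - t) (j b - 1) := by
    have h3 : j b - 1 = (j b - 1 - (p : ℚ_[p]) ^ k • w) + (p : ℚ_[p]) ^ k • w := by abel
    rw [h3]
    exact (h2.mono (by omega)).add ((ht.smul_pow k).mono (by omega))
  have hb0 : Sm 0 (j b) := by
    have h3 : j b = (j b - 1) + 1 := by abel
    rw [h3]; exact (hb1.mono (by omega)).add Sm.one
  have h4 : j (a * b) - 1 - (p : ℚ_[p]) ^ k • (z + w) = (j a - 1 - (p : ℚ_[p]) ^ k • z) * j b +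
      ((p : ℚ_[p]) ^ k • z) * (j b - 1) + (j b - 1 - (p : ℚ_[p]) ^ k • w) := by
    rw [map_mul, smul_add]; noncomm_ring
  rw [h4]
  refine ((h1.mul_right0 hb0).add (((hs.smul_pow k).mul hb1).mono ?_)).add h2
  omega

lemma T.closed (h : ∀ c : ℕ, ∃ z' ∈ S.T j m, Sm c (z - z')) : z ∈ S.T j m := by
  intro c
  obtain ⟨z', hz', h1⟩ := h c
  obtain ⟨k0, h2⟩ := hz' c
  refine ⟨k0, fun k hk => ?_⟩
  obtain ⟨γ, hγ, h3⟩ := h2 k hk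
  refine ⟨γ, hγ, ?_⟩
  have h4 : j γ - 1 - (p : ℚ_[p]) ^ k • z = (j γ - 1 - (p : ℚ_[p]) ^ k • z') - (p : ℚ_[p]) ^ k • (z - z') := by
    rw [smul_sub]; abel
  rw [h4]
  exact h3.sub (h1.smul_pow k)

lemma T.nsmul (hz : z ∈ S.T j m) (k : ℕ) : (k : ℚ_[p]) • z ∈ S.T j m := by
  induction k with
  | zero => simpa using T.zero
  | succ k ih => push_cast; rw [add_smul, one_smul]; exact T.add ih hz

lemma T.smul_int (hz : z ∈ S.T j m) (u : ℤ_[p]) : (u : ℚ_[p]) • z ∈ S.T j m := by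
  apply T.closed
  intro c
  obtain ⟨s, hs⟩ := Sm.exists_nat z
  refine ⟨_, T.nsmul hz (u.appr (c + s)), ?_⟩
  rw [← sub_smul]
  have h1 : ‖(u : ℚ_[p]) - (u.appr (c + s) : ℕ)‖ ≤ (p : ℝ) ^ (-((c + s : ℕ) : ℤ)) := by
    have := PadicInt.appr_spec (c + s) u
    rw [← PadicInt.norm_le_pow_iff_mem_span_pow] at this
    have h2 : ((u - (u.appr (c + s) : ℕ) : ℤ_[p]) : ℚ_[p]) = (u : ℚ_[p]) - (u.appr (c + s) : ℕ) := by push_cast; rfl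
    rw [← h2]; exact this
  have := Sm.smul h1 hs
  exact this.mono (by push_cast; omega)

lemma T.inv_p (hz : z ∈ S.T j m) (s : ℕ) : ((p : ℚ_[p]) ^ s)⁻¹ • z ∈ S.T j m := by
  intro c
  obtain ⟨k0, h⟩ := hz (c + s)
  refine ⟨k0 + s, fun k hk => ?_⟩
  obtain ⟨γ, hγ, h1⟩ := h (k - s) (by omega)
  refine ⟨γ, hγ, ?_⟩
  have hp0 : (p : ℚ_[p]) ≠ 0 := by exact_mod_cast hp.out.ne_zero
  have h2 : (p : ℚ_[p]) ^ k • ((p : ℚ_[p]) ^ s)⁻¹ • z = (p : ℚ_[p]) ^ (k - s) • z := by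
    rw [smul_smul]; congr 1
    rw [pow_sub₀ _ hp0 (by omega)]
  rw [h2]
  exact h1.mono (by push_cast; omega)

lemma T.smul (hz : z ∈ S.T j m) (c : ℚ_[p]) : c • z ∈ S.T j m := by
  obtain ⟨s, hs⟩ := exists_scalar c
  have hp0 : (p : ℚ_[p]) ≠ 0 := by exact_mod_cast hp.out.ne_zero
  have h1 : ‖(p : ℚ_[p]) ^ s * c‖ ≤ 1 := by
    rw [norm_mul, norm_p_pow']
    calc _ ≤ (p : ℝ) ^ (-(s : ℤ)) * (p : ℝ) ^ (s : ℤ) := by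
          have := zpow_pos (p_pos (p := p)) (-(s:ℤ)); gcongr
      _ = 1 := by rw [← zpow_add₀ (p_pos (p := p)).ne']; simp
  have := T.inv_p (T.smul_int hz ⟨_, h1⟩) s
  rw [smul_smul] at this
  simp only at this
  rwa [inv_mul_cancel_left₀ (pow_ne_zero _ hp0)] at this

lemma T.neg (hz : z ∈ S.T j m) : -z ∈ S.T j m := by
  have := T.smul hz (-1); simpa using this
lemma T.sub (hz : z ∈ S.T j m) (hw : w ∈ S.T j m) : z - w ∈ S.T j m := by
  rw [sub_eq_add_neg]; exact T.add hz (T.neg hw)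
lemma T.sum {κ : Type*} (s : Finset κ) (f : κ → Matrix (Fin n) (Fin n) ℚ_[p]) (h : ∀ i ∈ s, f i ∈ S.T j m) :
    ∑ i ∈ s, f i ∈ S.T j m := by
  classical
  induction s using Finset.induction_on with
  | empty => simpa using T.zero
  | insert a s ha ih =>
    rw [Finset.sum_insert ha]
    exact T.add (h a (Finset.mem_insert_self _ _)) (ih fun i hi => h i (Finset.mem_insert_of_mem hi))

lemma T.conj (hm : m ≠ 0) (hz : z ∈ S.T j m) (x : A) (hx : x ≠ 0) : j x * z * j x⁻¹ ∈ S.T j m := by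
  obtain ⟨D, hD, h1⟩ := S.exists_conj x hx m
  obtain ⟨E, hE, h2⟩ := S.exists_exp (m * D) (by positivity)
  have hjx : j x * j x⁻¹ = 1 := by rw [← map_mul, mul_inv_cancel₀ hx, map_one]
  have key : (E : ℚ_[p]) • (j x * z * j x⁻¹) ∈ S.T j m := by
    intro c
    obtain ⟨a, ha⟩ := Sm.exists_nat (j x)
    obtain ⟨b, hb⟩ := Sm.exists_nat (j x⁻¹)
    obtain ⟨s, hs⟩ := Sm.exists_nat z
    obtain ⟨k0, h3⟩ := hz (c + a + b)
    refine ⟨k0 + c + a + b + 2 * s, fun k hk => ?_⟩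
    obtain ⟨γ, hγ, h4⟩ := h3 k (by omega)
    refine ⟨x * γ ^ E * x⁻¹, h1 _ (h2 γ (Gam_one_mem hγ) hγ.1), ?_⟩
    set u := j γ - 1 with hu
    have hu1 : Sm (k - s) u := by
      have h5 : u = (u - (p : ℚ_[p]) ^ k • z) + (p : ℚ_[p]) ^ k • z := by abel
      rw [h5]; exact (h4.mono (by push_cast; omega)).add ((hs.smul_pow k).mono (by omega))
    have h6 := pow_approx (by omega) hu1 E
    rw [hu, add_sub_cancel, ← hu] at h6
    have h7 : j (x * γ ^ E * x⁻¹) - 1 - (p : ℚ_[p]) ^ k • (E : ℚ_[p]) • (j x * z * j x⁻¹) =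
        j x * ((j γ ^ E - 1 - (E : ℚ_[p]) • u) + (E : ℚ_[p]) • (u - (p : ℚ_[p]) ^ k • z)) * j x⁻¹ := by
      simp only [map_mul, map_pow, mul_add, add_mul, mul_sub, sub_mul, smul_sub, mul_smul_comm, smul_mul_assoc, mul_one, hjx]
      rw [smul_comm ((p : ℚ_[p]) ^ k)]
      abel
    rw [h7]
    refine ((ha.mul ((h6.mono (k' := k + c + a + b) (by omega)).add ((h4.smul_nat E).mono (by push_cast; omega)))).mul hb).mono ?_
    omega
  have := T.smul key (E : ℚ_[p])⁻¹
  rw [smul_smul, inv_mul_cancel₀ (by exact_mod_cast hE.ne'), one_smul] at this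
  exact this

/-- density of `A` -/
lemma dense (S : Ctx A n) (j : A →ₐ[ℚ] Matrix (Fin n) (Fin n) ℚ_[p]) (g : Matrix (Fin n) (Fin n) ℚ_[p]) (K : ℤ) :
    ∃ x : A, Sm K (j x - g) := by
  have hli := indep S.hc S.n_pos j S.e
  have : Nonempty (Fin (n^2)) := ⟨⟨0, by have := S.n_pos; positivity⟩⟩
  let b := basisOfLinearIndependentOfCardEqFinrank (b := fun i => j (S.e i)) hli
    (by simp [Module.finrank_matrix, pow_two])
  have hb : ∀ i, b i = j (S.e i) := fun i => by simp [b]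
  choose s hs using fun i => Sm.exists_nat (j (S.e i))
  choose r hr using fun i => Padic.rat_dense p (b.repr g i) (ε := (p : ℝ) ^ (-(K + s i))) (zpow_pos (p_pos (p := p)) _)
  refine ⟨∑ i, r i • S.e i, ?_⟩
  have h1 : j (∑ i, r i • S.e i) - g = ∑ i, (-(b.repr g i - r i)) • j (S.e i) := by
    conv_lhs => rw [← b.sum_repr g]
    rw [map_sum, ← Finset.sum_sub_distrib]
    refine Finset.sum_congr rfl fun i _ => ?_
    rw [map_smul, hb, neg_sub, sub_smul, ← Rat.cast_smul_eq_qsmul ℚ_[p]]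
  rw [h1]
  refine Sm.sum _ _ fun i _ => ?_
  exact (Sm.smul (by rw [norm_neg]; exact (hr i).le) (hs i)).mono (by omega)

lemma T.conj' (hm : m ≠ 0) (hz : z ∈ S.T j m) (g g' : Matrix (Fin n) (Fin n) ℚ_[p]) (hg : g * g' = 1) :
    g * z * g' ∈ S.T j m := by
  apply T.closed
  intro c
  obtain ⟨a, ha⟩ := Sm.exists_nat g
  obtain ⟨b, hb⟩ := Sm.exists_nat g'
  obtain ⟨s, hs⟩ := Sm.exists_nat z
  have hg' : g' * g = 1 := mul_eq_one_comm.1 hg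
  obtain ⟨x, hx⟩ := S.dense j g (1 + c + a + 2 * b + s)
  set δ := j x - g with hδ
  have hX : Sm 1 ((g' * j x) - 1) := by
    have : (g' * j x) - 1 = g' * δ := by rw [hδ, mul_sub, hg']
    rw [this]
    exact (hb.mul hx).mono (by omega)
  obtain ⟨hX1, hX2⟩ := hX.inv_of_close
  have hx0 : x ≠ 0 := by
    rintro rfl
    rw [map_zero, mul_zero] at hX2
    have : Nonempty (Fin n) := ⟨⟨0, S.n_pos⟩⟩
    simp at hX2
  have hjx : j x * j x⁻¹ = 1 := by rw [← map_mul, mul_inv_cancel₀ hx0, map_one]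
  have hinv : j x⁻¹ = (g' * j x)⁻¹ * g' := by
    have h1 : (g' * j x) * (j x⁻¹ * g) = 1 := by
      rw [mul_assoc, ← mul_assoc (j x), hjx, one_mul, hg']
    rw [Matrix.inv_eq_right_inv h1, mul_assoc, hg, mul_one]
  have hjb : Sm (-b) (j x⁻¹) := by rw [hinv]; exact hX1.mul_left0 hb
  have hdiff : Sm (1 + c + a + s) (j x⁻¹ - g') := by
    have : j x⁻¹ - g' = j x⁻¹ * (-δ) * g' := by
      rw [hδ, neg_sub, mul_sub, sub_mul, mul_assoc, hg, mul_one, ← map_mul, inv_mul_cancel₀ hx0, map_one, one_mul]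
    rw [this]
    exact ((hjb.mul hx.neg).mul hb).mono (by omega)
  refine ⟨_, T.conj hm hz x hx0, ?_⟩
  have h2 : g * z * g' - j x * z * j x⁻¹ = -(δ * z * j x⁻¹) - g * z * (j x⁻¹ - g') := by
    rw [hδ]; noncomm_ring
  rw [h2]
  refine (((hx.mul hs).mul hjb).neg.mono ?_).sub (((ha.mul hs).mul hdiff).mono ?_) <;> omega

/-- a scalar matrix in `T` vanishes -/
lemma T.scalar (c : ℚ_[p]) (hc : c • (1 : Matrix (Fin n) (Fin n) ℚ_[p]) ∈ S.T j m) : c = 0 := by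
  by_contra h0
  have hn0 : (n : ℚ_[p]) * c ≠ 0 := mul_ne_zero (by exact_mod_cast S.n_pos.ne') h0
  obtain ⟨C, hC⟩ := exists_not_small hn0
  obtain ⟨k0, h⟩ := hc C
  obtain ⟨s, hs⟩ := Sm.exists_nat (c • (1 : Matrix (Fin n) (Fin n) ℚ_[p]))
  obtain ⟨γ, hγ, h1⟩ := h (k0 + 2 * s + C) (by omega)
  set k := k0 + 2 * s + C with hk
  set u := j γ - 1 with hu
  have hu1 : Sm ((k - s : ℕ) : ℤ) u := by
    have h5 : u = (u - (p : ℚ_[p]) ^ k • (c • (1 : Matrix (Fin n) (Fin n) ℚ_[p]))) +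
      (p : ℚ_[p]) ^ k • (c • (1 : Matrix (Fin n) (Fin n) ℚ_[p])) := by abel
    rw [h5]; exact (h1.mono (by omega)).add ((hs.smul_pow k).mono (by omega))
  have h2 := det_trace hu1
  rw [hu, add_sub_cancel, S.det, hγ.1, ← hu] at h2
  simp only [Rat.cast_one, sub_self, zero_sub, norm_neg] at h2
  have h3 := h1.trace
  have h4 : (u - (p : ℚ_[p]) ^ k • (c • (1 : Matrix (Fin n) (Fin n) ℚ_[p]))).trace = u.trace - (p : ℚ_[p]) ^ k * (n * c) := by
    rw [Matrix.trace_sub, Matrix.trace_smul, Matrix.trace_smul, Matrix.trace_one]; simp [mul_comm]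
  rw [h4] at h3
  have h5 : ‖(p : ℚ_[p]) ^ k * (n * c)‖ ≤ (p : ℝ) ^ (-(k + C : ℤ)) := by
    have : (p : ℚ_[p]) ^ k * (n * c) = u.trace + -(u.trace - (p : ℚ_[p]) ^ k * (n * c)) := by ring
    rw [this]
    refine (Padic.nonarchimedean _ _).trans (max_le (h2.trans ?_) (by rw [norm_neg]; exact h3))
    exact zpow_le_zpow_right₀ (p_one_lt (p := p)).le (by omega)
  rw [norm_mul, norm_p_pow', neg_add, zpow_add₀ (p_pos (p := p)).ne'] at h5
  exact hC (le_of_mul_le_mul_left h5 (zpow_pos (p_pos (p := p)) _))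

end Ctx
end SA

namespace SA
section
variable {p : ℕ} [hp : Fact p.Prime] {n : ℕ}

lemma Sm.limit (Y : ℕ → Matrix (Fin n) (Fin n) ℚ_[p]) (a : ℤ) (h : ∀ k : ℕ, Sm (a + k) (Y (k + 1) - Y k)) :
    ∃ Z, ∀ k : ℕ, Sm (a + k) (Z - Y k) := by
  have hcau : ∀ i j, CauchySeq fun k => Y k i j := by
    intro i j
    refine cauchySeq_of_le_geometric ((p : ℝ)⁻¹) ((p : ℝ) ^ (-a)) (inv_lt_one_of_one_lt₀ (p_one_lt (p := p))) ?_
    intro k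
    rw [dist_comm, dist_eq_norm]
    refine (h k i j).trans (le_of_eq ?_)
    rw [neg_add, zpow_add₀ (p_pos (p := p)).ne', _root_.zpow_neg _ (k : ℤ), zpow_natCast, inv_pow]
  choose Z hZ using fun i j => cauchySeq_tendsto_of_complete (hcau i j)
  refine ⟨Matrix.of Z, fun k => ?_⟩
  have hK : ∀ K : ℕ, Sm (a + k) (Y (k + K) - Y k) := by
    intro K
    induction K with
    | zero => simpa using Sm.zero _
    | succ K ih =>
      have : Y (k + (K + 1)) - Y k = (Y (k + K + 1) - Y (k + K)) + (Y (k + K) - Y k) := by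
        rw [← add_assoc]; abel
      rw [this]
      exact ((h (k + K)).mono (by push_cast; omega)).add ih
  intro i j
  have ht : Filter.Tendsto (fun K => ‖Y (k + K) i j - Y k i j‖) Filter.atTop (nhds ‖Z i j - Y k i j‖) := by
    have h1 : Filter.Tendsto (fun K => Y (k + K) i j) Filter.atTop (nhds (Z i j)) := by
      have := (hZ i j).comp (Filter.tendsto_add_atTop_nat k)
      refine this.congr fun K => ?_
      simp [add_comm]
    exact (h1.sub_const _).norm
  exact le_of_tendsto' ht fun K => hK K i j
end

namespace Ctx
variable {A : Type} [DivisionRing A] [CharZero A] {n : ℕ} {S : Ctx A n}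
variable {p : ℕ} [hp : Fact p.Prime] {j : A →ₐ[ℚ] Matrix (Fin n) (Fin n) ℚ_[p]} {m : ℕ}
  {z w : Matrix (Fin n) (Fin n) ℚ_[p]}

lemma j_inj (S : Ctx A n) (j : A →ₐ[ℚ] Matrix (Fin n) (Fin n) ℚ_[p]) : Function.Injective j := by
  have : Nonempty (Fin n) := ⟨⟨0, S.n_pos⟩⟩
  exact j.toRingHom.injective

lemma T.exists_ne {γ : A} (hγ : γ ∈ S.Gam 1 m) (h1 : γ ≠ 1) (h2 : Sm 2 (j γ - 1)) : ∃ z ∈ S.T j m, z ≠ 0 := by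
  have hp0 : (p : ℚ_[p]) ≠ 0 := by exact_mod_cast hp.out.ne_zero
  have hne : j γ - 1 ≠ 0 := by
    intro h
    apply h1
    apply S.j_inj j
    rw [map_one]; exact sub_eq_zero.1 h
  obtain ⟨v, hv2, hv, hv'⟩ : ∃ v : ℕ, 2 ≤ v ∧ Sm v (j γ - 1) ∧ ¬ Sm (v + 1) (j γ - 1) := by
    classical
    have hex := Sm.exists_of_ne hne
    have hspec := Nat.find_spec hex
    have hmin := fun k (hk : k < Nat.find hex) => Nat.find_min hex hk
    set v := Nat.find hex
    have hv : 2 < v := by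
      by_contra h
      exact hspec (h2.mono (by omega))
    refine ⟨v - 1, by omega, not_not.1 (hmin (v - 1) (by omega)), ?_⟩
    intro h
    apply hspec
    refine h.mono (by omega)
  let u : ℕ → Matrix (Fin n) (Fin n) ℚ_[p] := fun k => j γ ^ p ^ k - 1
  have hu0 : u 0 = j γ - 1 := by simp [u]
  have hstep : ∀ k : ℕ, Sm (v + k : ℤ) (u k) → Sm (2 * v + 2 * k : ℤ) (u (k + 1) - (p : ℚ_[p]) • u k) := by
    intro k hk
    have := pow_approx (by omega) hk p
    have h3 : (1 + u k) ^ p = j γ ^ p ^ (k + 1) := by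
      simp only [u, add_sub_cancel]
      rw [← pow_mul, pow_succ]
    rw [h3] at this
    exact this.mono (by omega)
  have hu : ∀ k : ℕ, Sm (v + k : ℤ) (u k) := by
    intro k
    induction k with
    | zero => rw [hu0]; simpa using hv
    | succ k ih =>
      have h3 : u (k + 1) = (u (k + 1) - (p : ℚ_[p]) • u k) + (p : ℚ_[p]) ^ 1 • u k := by rw [pow_one]; abel
      rw [h3]
      exact ((hstep k ih).mono (by push_cast; omega)).add ((ih.smul_pow 1).mono (by push_cast; omega))
  let Y : ℕ → Matrix (Fin n) (Fin n) ℚ_[p] := fun k => (p : ℚ_[p]) ^ (-(k : ℤ)) • u k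
  have hY : ∀ k : ℕ, Sm ((v + 1 : ℤ) + k) (Y (k + 1) - Y k) := by
    intro k
    have h3 : Y (k + 1) - Y k = (p : ℚ_[p]) ^ (-((k + 1 : ℕ) : ℤ)) • (u (k + 1) - (p : ℚ_[p]) • u k) := by
      conv_rhs => rw [smul_sub, smul_smul]
      simp only [Y]
      congr 2
      rw [← zpow_add_one₀ hp0]; congr 1; push_cast; ring
    rw [h3]
    exact ((hstep k (hu k)).smul_zpow _).mono (by push_cast; omega)
  obtain ⟨z, hz⟩ := Sm.limit Y _ hY
  refine ⟨z, ?_, ?_⟩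
  · intro c
    refine ⟨c, fun k hk => ⟨γ ^ p ^ k, pow_mem hγ _, ?_⟩⟩
    have h3 : j (γ ^ p ^ k) - 1 - (p : ℚ_[p]) ^ k • z = -((p : ℚ_[p]) ^ k • (z - Y k)) := by
      have h4 : (p : ℚ_[p]) ^ k • Y k = u k := by
        simp only [Y]
        rw [smul_smul, ← zpow_natCast, ← zpow_add₀ hp0]; simp
      rw [smul_sub, h4, map_pow]; simp only [u]; abel
    rw [h3]
    exact ((hz k).smul_pow k).neg.mono (by omega)
  · rintro rfl
    have h3 := (hz 0).neg
    have h4 : Y 0 = j γ - 1 := by simp [Y, hu0]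
    rw [h4] at h3
    apply hv'
    simpa using h3

lemma T.nil (hm : m ≠ 0) (hz : z ∈ S.T j m) {a b : Fin n} (hab : a ≠ b) :
    (Matrix.single a b 1 * z - z * Matrix.single a b 1) ∈ S.T j m ∧ z b a • Matrix.single a b (1 : ℚ_[p]) ∈ S.T j m := by
  set E : Matrix (Fin n) (Fin n) ℚ_[p] := Matrix.single a b 1 with hE
  have hE2 : E * E = 0 := by
    rw [hE, Matrix.single_mul_single_of_ne]; exact hab.symm
  have h1 : (1 + E) * z * (1 - E) ∈ S.T j m := T.conj' hm hz _ _ (by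
    have : (1 + E) * (1 - E) = 1 - E * E := by noncomm_ring
    rw [this, hE2, sub_zero])
  have h2 : (1 - E) * z * (1 + E) ∈ S.T j m := T.conj' hm hz _ _ (by
    have : (1 - E) * (1 + E) = 1 - E * E := by noncomm_ring
    rw [this, hE2, sub_zero])
  have h3 : E * z * E = z b a • E := by
    rw [hE]; ext i k
    simp [Matrix.single_mul_mul_single, Matrix.single_apply]
  constructor
  · have h4 := T.smul (T.sub h1 h2) (2⁻¹ : ℚ_[p])
    have : (2⁻¹ : ℚ_[p]) • ((1 + E) * z * (1 - E) - (1 - E) * z * (1 + E)) = E * z - z * E := by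
      have h5 : (1 + E) * z * (1 - E) - (1 - E) * z * (1 + E) = (2 : ℚ_[p]) • (E * z - z * E) := by
        rw [two_smul]; noncomm_ring
      rw [h5, smul_smul, inv_mul_cancel₀ two_ne_zero, one_smul]
    rwa [this] at h4
  · have h4 := T.smul (T.sub hz (T.smul (T.add h1 h2) (2⁻¹ : ℚ_[p]))) (1 : ℚ_[p])
    have : (1 : ℚ_[p]) • (z - (2⁻¹ : ℚ_[p]) • ((1 + E) * z * (1 - E) + (1 - E) * z * (1 + E))) = E * z * E := by
      have h5 : (1 + E) * z * (1 - E) + (1 - E) * z * (1 + E) = (2 : ℚ_[p]) • (z - E * z * E) := by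
        rw [two_smul]; noncomm_ring
      rw [h5, smul_smul, inv_mul_cancel₀ two_ne_zero, one_smul, one_smul]; abel
    rw [this, h3] at h4
    exact h4

lemma T.single_all (hm : m ≠ 0) (hz : z ∈ S.T j m) (hz0 : z ≠ 0) (a b : Fin n) (hab : a ≠ b) :
    Matrix.single a b (1 : ℚ_[p]) ∈ S.T j m := by
  have hunit : ∀ (c : ℚ_[p]) (a b : Fin n), c ≠ 0 → c • Matrix.single a b (1 : ℚ_[p]) ∈ S.T j m →
      Matrix.single a b (1 : ℚ_[p]) ∈ S.T j m := by
    intro c a b hc h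
    have := T.smul h c⁻¹
    rwa [smul_smul, inv_mul_cancel₀ hc, one_smul] at this
  -- one elementary matrix
  have h1 : ∃ a b : Fin n, a ≠ b ∧ Matrix.single a b (1 : ℚ_[p]) ∈ S.T j m := by
    by_cases hoff : ∃ a b, a ≠ b ∧ z b a ≠ 0
    · obtain ⟨a, b, hab, h⟩ := hoff
      exact ⟨a, b, hab, hunit _ _ _ h (T.nil hm hz hab).2⟩
    · push Not at hoff
      by_cases hdiag : ∃ a b, z a a ≠ z b b
      · obtain ⟨a, b, h⟩ := hdiag
        have hab : a ≠ b := by rintro rfl; exact h rfl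
        refine ⟨a, b, hab, hunit (z b b - z a a) _ _ (sub_ne_zero.2 h.symm) ?_⟩
        have h2 := (T.nil hm hz hab).1
        have hzd : z = Matrix.diagonal (fun i => z i i) := by
          ext i k
          by_cases hik : i = k
          · subst hik; simp
          · rw [Matrix.diagonal_apply_ne _ hik]; exact hoff k i (Ne.symm hik)
        have h3 : Matrix.single a b 1 * z - z * Matrix.single a b 1 = (z b b - z a a) • Matrix.single a b (1 : ℚ_[p]) := by
          rw [hzd]
          ext i k
          rw [Matrix.sub_apply, Matrix.mul_diagonal, Matrix.diagonal_mul]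
          simp only [Matrix.single_apply, Matrix.smul_apply, Matrix.diagonal_apply_eq, smul_eq_mul]
          by_cases hh : a = i ∧ b = k
          · obtain ⟨rfl, rfl⟩ := hh; simp
          · simp [hh]
        rwa [h3] at h2
      · push Not at hdiag
        exfalso
        have i0 : Fin n := ⟨0, S.n_pos⟩
        have hzs : z = z i0 i0 • (1 : Matrix (Fin n) (Fin n) ℚ_[p]) := by
          ext i k
          by_cases hik : i = k
          · subst hik; simp [hdiag i i0]
          · rw [Matrix.smul_apply, Matrix.one_apply_ne hik, smul_zero]; exact hoff k i (Ne.symm hik)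
        have h2 : z i0 i0 = 0 := by
          apply T.scalar (S := S) (j := j) (m := m)
          rw [← hzs]; exact hz
        rw [h2, zero_smul] at hzs
        exact hz0 hzs
  have flip : ∀ a b : Fin n, a ≠ b → Matrix.single a b (1 : ℚ_[p]) ∈ S.T j m → Matrix.single b a (1 : ℚ_[p]) ∈ S.T j m := by
    intro a b hab h
    have := (T.nil hm h hab.symm).2
    simpa using this
  have left : ∀ a b c : Fin n, a ≠ b → c ≠ b → Matrix.single a b (1 : ℚ_[p]) ∈ S.T j m → Matrix.single c b (1 : ℚ_[p]) ∈ S.T j m := by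
    intro a b c hab hcb h
    by_cases hca : c = a
    · rwa [hca]
    have := (T.nil hm h hca).1
    rw [Matrix.single_mul_single_same, Matrix.single_mul_single_of_ne _ _ _ _ hcb.symm, sub_zero, one_mul] at this
    exact this
  have right : ∀ a b c : Fin n, a ≠ b → a ≠ c → Matrix.single a b (1 : ℚ_[p]) ∈ S.T j m → Matrix.single a c (1 : ℚ_[p]) ∈ S.T j m := by
    intro a b c hab hac h
    exact flip c a hac.symm (left b a c hab.symm hac.symm (flip a b hab h))
  obtain ⟨i, k, hik, h⟩ := h1
  by_cases hak : a = k
  · subst hak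
    exact right a i b hik.symm hab (flip i a hik h)
  · exact right a k b hak hab (left i k a hik hak h)

lemma T.sl (hm : m ≠ 0) (hz : z ∈ S.T j m) (hz0 : z ≠ 0) (w : Matrix (Fin n) (Fin n) ℚ_[p]) (hw : w.trace = 0) :
    w ∈ S.T j m := by
  have hE := T.single_all hm hz hz0
  let i0 : Fin n := ⟨0, S.n_pos⟩
  have hdiag : ∀ a b : Fin n, Matrix.single a a (1 : ℚ_[p]) - Matrix.single b b 1 ∈ S.T j m := by
    intro a b
    by_cases hab : a = b
    · subst hab; rw [sub_self]; exact T.zero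
    have := (T.nil hm (hE b a (Ne.symm hab)) hab).1
    rwa [Matrix.single_mul_single_same, Matrix.single_mul_single_same, one_mul] at this
  have hdec : w = ∑ a, ∑ b, w a b • (Matrix.single a b (1 : ℚ_[p]) - if a = b then Matrix.single i0 i0 1 else 0) := by
    simp only [smul_sub, Finset.sum_sub_distrib]
    have h1 : ∑ a, ∑ b, w a b • (if a = b then Matrix.single i0 i0 (1 : ℚ_[p]) else 0) = 0 := by
      simp only [smul_ite, smul_zero, Finset.sum_ite_eq, Finset.mem_univ, if_true]
      rw [← Finset.sum_smul]
      have : ∑ i, w i i = 0 := hw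
      rw [this, zero_smul]
    rw [h1, sub_zero]
    conv_lhs => rw [Matrix.matrix_eq_sum_single w]
    simp
  rw [hdec]
  refine T.sum _ _ fun a _ => T.sum _ _ fun b _ => T.smul ?_ _
  split_ifs with h
  · subst h; exact hdiag a i0
  · rw [sub_zero]; exact hE a b h

end Ctx
end SA

namespace SA
namespace Ctx
variable {A : Type} [DivisionRing A] [CharZero A] {n : ℕ} {S : Ctx A n}
variable {p : ℕ} [hp : Fact p.Prime] {j : A →ₐ[ℚ] Matrix (Fin n) (Fin n) ℚ_[p]} {m : ℕ}

lemma T.step (hT : ∀ w : Matrix (Fin n) (Fin n) ℚ_[p], w.trace = 0 → w ∈ S.T j m) :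
    ∃ k0 : ℕ, ∀ k : ℕ, k0 ≤ k → ∀ Z : Matrix (Fin n) (Fin n) ℚ_[p], Sm k Z → ‖Z.trace‖ ≤ (p : ℝ) ^ (-(k + 1 : ℤ)) →
      ∃ γ ∈ S.Gam 1 m, Sm (k + 1) (j γ - 1 - Z) := by
  classical
  let i0 : Fin n := ⟨0, S.n_pos⟩
  let D : (Fin n → Fin n → Fin p) → Matrix (Fin n) (Fin n) ℚ_[p] := fun d => Matrix.of fun a b => ((d a b : ℕ) : ℚ_[p])
  let zz : (Fin n → Fin n → Fin p) → Matrix (Fin n) (Fin n) ℚ_[p] := fun d => D d - (D d).trace • Matrix.single i0 i0 1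
  have hzz : ∀ d, zz d ∈ S.T j m := fun d => hT _ (by simp [zz])
  choose f hf using fun d => hzz d 1
  refine ⟨∑ d, f d, fun k hk Z hZ hZt => ?_⟩
  obtain ⟨Y, rfl⟩ := hZ.lift
  have hlt : ∀ a b, (Y a b).appr 1 < p := fun a b => by simpa using PadicInt.appr_lt (Y a b) 1
  let d : Fin n → Fin n → Fin p := fun a b => ⟨(Y a b).appr 1, hlt a b⟩
  obtain ⟨γ, hγ, h1⟩ := hf d k ((Finset.single_le_sum (f := f) (fun _ _ => Nat.zero_le _) (Finset.mem_univ d)).trans hk)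
  refine ⟨γ, hγ, ?_⟩
  have hZ' : ((p : ℤ_[p]) ^ k • Y).map PadicInt.Coe.ringHom = (p : ℚ_[p]) ^ k • Y.map PadicInt.Coe.ringHom := by
    ext a b
    simp only [Matrix.map_apply, Matrix.smul_apply, smul_eq_mul, map_mul, map_pow, map_natCast]
  rw [hZ'] at hZt ⊢
  have hYd : Sm 1 (Y.map PadicInt.Coe.ringHom - D d) := by
    intro a b
    have h2 := PadicInt.appr_spec 1 (Y a b)
    rw [← PadicInt.norm_le_pow_iff_mem_span_pow] at h2
    rw [PadicInt.norm_def] at h2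
    have h3 : (Y.map PadicInt.Coe.ringHom - D d) a b = ((Y a b - ((Y a b).appr 1 : ℕ) : ℤ_[p]) : ℚ_[p]) := by
      rw [PadicInt.coe_sub, PadicInt.coe_natCast]; rfl
    rw [h3]; exact h2
  have hYt : ‖(Y.map PadicInt.Coe.ringHom).trace‖ ≤ (p : ℝ) ^ (-(1 : ℤ)) := by
    rw [Matrix.trace_smul, smul_eq_mul, norm_mul, norm_p_pow', neg_add, zpow_add₀ (p_pos (p := p)).ne'] at hZt
    exact le_of_mul_le_mul_left hZt (zpow_pos (p_pos (p := p)) _)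
  have hdt : ‖(D d).trace‖ ≤ (p : ℝ) ^ (-(1 : ℤ)) := by
    have h3 : (D d).trace = (Y.map PadicInt.Coe.ringHom).trace - (Y.map PadicInt.Coe.ringHom - D d).trace := by
      rw [Matrix.trace_sub]; ring
    rw [h3, sub_eq_add_neg]
    refine (Padic.nonarchimedean _ _).trans (max_le hYt ?_)
    rw [norm_neg]; exact hYd.trace
  have hE : Sm 0 (Matrix.single i0 i0 (1 : ℚ_[p])) := by
    intro a b
    rw [Matrix.single_apply]
    split_ifs <;> simp
  have h4 : j γ - 1 - (p : ℚ_[p]) ^ k • Y.map PadicInt.Coe.ringHom = (j γ - 1 - (p : ℚ_[p]) ^ k • zz d)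
      - (p : ℚ_[p]) ^ k • ((Y.map PadicInt.Coe.ringHom - D d) + (D d).trace • Matrix.single i0 i0 1) := by
    simp only [zz, smul_sub, smul_add]; abel
  rw [h4]
  refine Sm.sub (by simpa using h1) (Sm.smul_pow k (hYd.add ?_))
  simpa using Sm.smul hdt hE

lemma open_lemma (hT : ∀ w : Matrix (Fin n) (Fin n) ℚ_[p], w.trace = 0 → w ∈ S.T j m) :
    ∃ K0 : ℕ, ∀ g : Matrix (Fin n) (Fin n) ℚ_[p], g.det = 1 → Sm K0 (g - 1) → ∀ K : ℕ, ∃ γ ∈ S.Gam 1 m, Sm K (j γ - g) := by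
  obtain ⟨k0, h0⟩ := T.step hT
  refine ⟨k0 + 1, fun g hg hg1 K => ?_⟩
  suffices h : ∀ i : ℕ, ∃ γ ∈ S.Gam 1 m, Sm (k0 + 1 + i : ℕ) (j γ - g) by
    obtain ⟨γ, hγ, h1⟩ := h K
    exact ⟨γ, hγ, h1.mono (by push_cast; omega)⟩
  intro i
  induction i with
  | zero => exact ⟨1, one_mem _, by rw [map_one, ← neg_sub]; exact hg1.neg⟩
  | succ i ih =>
    obtain ⟨γ, hγ, h1⟩ := ih
    set X := j γ
    have hdet : X.det = 1 := by
      have := S.det γ j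
      rw [hγ.1] at this
      simpa using this
    have hXu : X * X⁻¹ = 1 := Matrix.mul_nonsing_inv _ (by simp [hdet])
    have hXu' : X⁻¹ * X = 1 := Matrix.nonsing_inv_mul _ (by simp [hdet])
    have hX0 : Sm 0 X := by
      have : X = (X - g) + (g - 1) + 1 := by abel
      rw [this]
      exact ((h1.mono (by omega)).add (hg1.mono (by omega))).add Sm.one
    have hXi := hX0.inv_det_one hdet
    let Z := X⁻¹ * (g - X)
    have hZ : Sm (k0 + 1 + i : ℕ) Z := hXi.mul_left0 (by rw [← neg_sub]; exact h1.neg)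
    have hZ1 : 1 + Z = X⁻¹ * g := by
      simp only [Z, mul_sub, hXu']; abel
    have hZt : ‖Z.trace‖ ≤ (p : ℝ) ^ (-((k0 + 1 + i : ℕ) + 1 : ℤ)) := by
      have h2 := det_trace hZ
      rw [hZ1, Matrix.det_mul, Matrix.det_nonsing_inv, hdet, hg] at h2
      simp only [Ring.inverse_one, mul_one, sub_self, zero_sub, norm_neg] at h2
      refine h2.trans (zpow_le_zpow_right₀ (p_one_lt (p := p)).le (by push_cast; omega))
    obtain ⟨δ, hδ, h3⟩ := h0 _ (by omega) Z hZ hZt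
    refine ⟨γ * δ, mul_mem hγ hδ, ?_⟩
    have h4 : j (γ * δ) - g = X * (j δ - 1 - Z) := by
      rw [map_mul, mul_sub, mul_sub, mul_one]
      simp only [Z]
      rw [← mul_assoc, hXu, one_mul]; abel
    rw [h4]
    exact hX0.mul_left0 (h3.mono (by push_cast; omega))
end Ctx
end SA

namespace SA

/-- weights -/
noncomputable def wt (n : ℕ) (H : ℕ) (k : Fin (n + 2)) : ℝ := if k = 0 then 1 / H else if k = 1 then H else 1

lemma wt_pos (n : ℕ) {H : ℕ} (hH : 0 < H) (k : Fin (n + 2)) : 0 < wt n H k := by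
  have : (0 : ℝ) < H := by exact_mod_cast hH
  unfold wt; split_ifs <;> positivity

lemma wt_prod (n : ℕ) {H : ℕ} (hH : 0 < H) : ∏ k, wt n H k = 1 := by
  have : (0 : ℝ) < H := by exact_mod_cast hH
  rw [Fin.prod_univ_succ, Fin.prod_univ_succ]
  have h1 : ∀ i : Fin n, wt n H i.succ.succ = 1 := by
    intro i
    unfold wt
    rw [if_neg (Fin.succ_ne_zero _), if_neg]
    intro h
    have := congrArg Fin.val h
    simp at this
  simp only [h1]
  have h2 : (Fin.succ 0 : Fin (n + 2)) = 1 := rfl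
  rw [h2]
  unfold wt
  simp
  field_simp

lemma det_bound {n : ℕ} {H : ℕ} (hH : 0 < H) {C : ℝ} (X : Matrix (Fin (n + 2)) (Fin (n + 2)) ℝ)
    (hX : ∀ k l, |X k l| ≤ C * wt n H k) : |X.det| ≤ (n + 2).factorial * C ^ (n + 2) := by
  rw [Matrix.det_apply]
  refine (Finset.abs_sum_le_sum_abs _ _).trans ?_
  have h1 : ∀ σ : Equiv.Perm (Fin (n + 2)), |Equiv.Perm.sign σ • ∏ i, X (σ i) i| ≤ C ^ (n + 2) := by
    intro σ
    rw [Units.smul_def, zsmul_eq_mul, abs_mul]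
    have : |((Equiv.Perm.sign σ : ℤ) : ℝ)| = 1 := by
      rcases Int.units_eq_one_or (Equiv.Perm.sign σ) with h | h <;> simp [h]
    rw [this, one_mul, Finset.abs_prod]
    calc ∏ i, |X (σ i) i| ≤ ∏ i, C * wt n H (σ i) := Finset.prod_le_prod (fun _ _ => abs_nonneg _) fun i _ => hX _ _
      _ = C ^ (n + 2) * ∏ i, wt n H (σ i) := by rw [Finset.prod_mul_distrib]; simp
      _ = C ^ (n + 2) := by rw [Equiv.prod_comp σ (wt n H), wt_prod n hH, mul_one]
  refine (Finset.sum_le_sum fun σ _ => h1 σ).trans ?_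
  rw [Finset.sum_const, Finset.card_univ, Fintype.card_perm, Fintype.card_fin, nsmul_eq_mul]

lemma pigeon {n d : ℕ} (hd : d = (n + 2) ^ 2) (E : Fin d → Matrix (Fin (n + 2)) (Fin (n + 2)) ℝ) :
    ∃ C : ℝ, 0 < C ∧ ∀ H : ℕ, 0 < H → ∃ b : Fin d → ℤ, b ≠ 0 ∧
      ∀ k l, |(∑ i, (b i : ℝ) • E i) k l| ≤ C * wt n H k := by
  let c : ℝ := 1 + ∑ i, ∑ k, ∑ l, |E i k l|
  have hs0 : ∀ k l, ∑ i, |E i k l| ≤ c := by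
    intro k l
    have : ∑ i, |E i k l| ≤ ∑ i, ∑ k, ∑ l, |E i k l| := by
      refine Finset.sum_le_sum fun i _ => ?_
      refine (Finset.single_le_sum (f := fun l => |E i k l|) (fun _ _ => abs_nonneg _) (Finset.mem_univ l)).trans ?_
      exact (Finset.single_le_sum (f := fun k => ∑ l, |E i k l|) (fun _ _ => Finset.sum_nonneg fun _ _ => abs_nonneg _) (Finset.mem_univ k))
    simp only [c]; linarith
  have hc : 0 < c := by
    have : 0 ≤ ∑ i, ∑ k, ∑ l, |E i k l| := Finset.sum_nonneg fun _ _ => Finset.sum_nonneg fun _ _ => Finset.sum_nonneg fun _ _ => abs_nonneg _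
    simp only [c]; linarith
  refine ⟨3 * c, by positivity, fun H hH => ?_⟩
  have hH' : (0 : ℝ) < H := by exact_mod_cast hH
  let L : Fin (n + 2) → ℝ := fun k => if k = 1 then 3 * c else 2 * c
  have hL0 : ∀ k, 0 < L k := by intro k; simp only [L]; split_ifs <;> positivity
  have hL3 : ∀ k, L k ≤ 3 * c := by intro k; simp only [L]; split_ifs <;> linarith
  let N : Fin (n + 2) → ℕ := fun k => if k = 0 then H ^ 2 + 1 else if k = 1 then 1 else H + 1
  let X : (Fin d → ℕ) → Matrix (Fin (n + 2)) (Fin (n + 2)) ℝ := fun b => ∑ i, (b i : ℝ) • E i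
  let F : (Fin d → ℕ) → Fin (n + 2) → Fin (n + 2) → ℤ := fun b k l => ⌊(X b k l + c * H) / (L k * wt n H k)⌋
  have hXb : ∀ b : Fin d → ℕ, (∀ i, b i ≤ H) → ∀ k l, |X b k l| ≤ c * H := by
    intro b hb k l
    simp only [X, Matrix.sum_apply, Matrix.smul_apply, smul_eq_mul]
    refine (Finset.abs_sum_le_sum_abs _ _).trans ?_
    calc ∑ i, |(b i : ℝ) * E i k l| ≤ ∑ i, H * |E i k l| := by
          refine Finset.sum_le_sum fun i _ => ?_
          rw [abs_mul, Nat.abs_cast]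
          exact mul_le_mul_of_nonneg_right (by exact_mod_cast hb i) (abs_nonneg _)
      _ = H * ∑ i, |E i k l| := by rw [Finset.mul_sum]
      _ ≤ c * H := by rw [mul_comm]; exact mul_le_mul_of_nonneg_right (hs0 k l) hH'.le
  let s : Finset (Fin d → ℕ) := Fintype.piFinset fun _ => Finset.range (H + 1)
  let t : Finset (Fin (n + 2) → Fin (n + 2) → ℤ) := Fintype.piFinset fun k => Fintype.piFinset fun _ => Finset.Ico 0 (N k : ℤ)
  have hst : t.card < s.card := by
    simp only [s, t, Fintype.card_piFinset, Int.card_Ico, sub_zero, Int.toNat_natCast, Finset.prod_const,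
      Finset.card_univ, Fintype.card_fin, Finset.card_range]
    rw [Finset.prod_pow, hd, pow_two, pow_mul]
    refine Nat.pow_lt_pow_left ?_ (by omega)
    rw [Fin.prod_univ_succ, Fin.prod_univ_succ]
    have h1 : ∀ i : Fin n, N i.succ.succ = H + 1 := by
      intro i
      simp only [N]
      rw [if_neg (Fin.succ_ne_zero _), if_neg]
      intro h
      have := congrArg Fin.val h
      simp at this
    have h2 : N 0 = H ^ 2 + 1 := by simp [N]
    have h3 : N (Fin.succ 0) = 1 := by
      have : (Fin.succ 0 : Fin (n + 2)) = 1 := rfl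
      rw [this]; simp [N]
    simp only [h1, h2, h3, one_mul, Finset.prod_const, Finset.card_univ, Fintype.card_fin]
    rw [pow_add, mul_comm]
    exact Nat.mul_lt_mul_of_pos_left (by nlinarith) (by positivity)
  have hmaps : ∀ b ∈ s, F b ∈ t := by
    intro b hb
    have hb' : ∀ i, b i ≤ H := by
      intro i
      have := Fintype.mem_piFinset.1 hb i
      rw [Finset.mem_range] at this; omega
    refine Fintype.mem_piFinset.2 fun k => Fintype.mem_piFinset.2 fun l => ?_
    have h1 := abs_le.1 (hXb b hb' k l)
    have hpos : 0 < L k * wt n H k := mul_pos (hL0 k) (wt_pos n hH k)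
    rw [Finset.mem_Ico]
    constructor
    · exact Int.floor_nonneg.2 (div_nonneg (by linarith) hpos.le)
    · rw [Int.floor_lt, div_lt_iff₀ hpos]
      have h3 : X b k l + c * H ≤ 2 * c * H := by linarith [h1.2]
      refine h3.trans_lt ?_
      simp only [N, L, wt]
      by_cases hk0 : k = 0
      · subst hk0
        simp
        field_simp
        nlinarith
      · by_cases hk1 : k = 1
        · subst hk1
          simp
          nlinarith
        · simp [hk0, hk1]
          nlinarith
  obtain ⟨b, hb, b', hb', hne, heq⟩ := Finset.exists_ne_map_eq_of_card_lt_of_maps_to hst hmaps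
  refine ⟨fun i => (b i : ℤ) - b' i, ?_, ?_⟩
  · intro h
    apply hne
    ext i
    have := congrFun h i
    simp at this
    omega
  · intro k l
    have h1 : (∑ i, (((b i : ℤ) - b' i : ℤ) : ℝ) • E i) = X b - X b' := by
      simp only [X, ← Finset.sum_sub_distrib]
      refine Finset.sum_congr rfl fun i _ => ?_
      push_cast; rw [sub_smul]
    change |(∑ i, (((b i : ℤ) - b' i : ℤ) : ℝ) • E i) k l| ≤ _
    rw [h1, Matrix.sub_apply]
    have h2 : F b k l = F b' k l := by rw [heq]
    have hpos : 0 < L k * wt n H k := mul_pos (hL0 k) (wt_pos n hH k)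
    have h3 := Int.abs_sub_lt_one_of_floor_eq_floor h2
    rw [← sub_div, abs_div, abs_of_pos hpos, div_lt_one hpos] at h3
    have h4 : X b k l + c * H - (X b' k l + c * H) = X b k l - X b' k l := by ring
    rw [h4] at h3
    exact h3.le.trans (mul_le_mul_of_nonneg_right (hL3 k) (wt_pos n hH k).le)

namespace Ctx
variable {A : Type} [DivisionRing A] [CharZero A] {n : ℕ}

lemma sum_mem (S : Ctx A n) (b : Fin (n ^ 2) → ℤ) : ∑ i, (b i : ℚ) • S.e i ∈ S.M := by
  rw [S.he]
  intro i
  exact ⟨b i, by rw [S.e.repr_sum_self]⟩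

lemma alpha (S : Ctx A n) (k : ℕ) (hk : k ≠ 0) : ∃ γ ∈ S.Gam 1 k, γ ≠ 1 := by
  obtain ⟨n', hn'⟩ : ∃ n', n = n' + 2 := ⟨n - 2, by have := S.hn; omega⟩
  subst hn'
  obtain ⟨C, hC, h⟩ := pigeon (n := n') rfl (fun i => S.ι (S.e i))
  choose b hb0 hb using fun H : ℕ => h (H + 1) (Nat.succ_pos _)
  let a : ℕ → A := fun H => ∑ i, (b H i : ℚ) • S.e i
  have haM : ∀ H, a H ∈ S.M := fun H => S.sum_mem _
  have ha0 : ∀ H, a H ≠ 0 := by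
    intro H h0
    apply hb0 H
    ext i
    have := S.e.repr_sum_self (fun i => (b H i : ℚ))
    have h2 := congrFun this i
    have h3 : S.e.repr (a H) i = 0 := by rw [h0]; simp
    rw [h3] at h2
    exact_mod_cast h2.symm
  have hιa : ∀ H k l, |S.ι (a H) k l| ≤ C * wt n' (H + 1) k := by
    intro H k l
    have : S.ι (a H) = ∑ i, (b H i : ℝ) • S.ι (S.e i) := by
      simp only [a, map_sum, map_smul]
      refine Finset.sum_congr rfl fun i _ => ?_
      ext x y
      simp [Rat.smul_def]
    rw [this]; exact hb H k l
  choose ν hν using fun H => S.nr_int (haM H)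
  have hν0 : ∀ H, ν H ≠ 0 := by
    intro H h0
    apply S.nr_ne_zero (ha0 H)
    rw [hν, h0]; simp
  obtain ⟨B, hB⟩ := exists_nat_ge (((n' + 2).factorial : ℝ) * C ^ (n' + 2))
  have hνB : ∀ H, |ν H| ≤ B := by
    intro H
    have h1 := det_bound (Nat.succ_pos H) _ (hιa H)
    rw [S.det, hν] at h1
    have h2 := h1.trans hB
    have h3 : |((ν H : ℤ) : ℝ)| ≤ B := by simpa using h2
    exact_mod_cast h3
  obtain ⟨T, hT, cl, hcl⟩ := S.exists_cl 1 (k * B.factorial) (Nat.mul_ne_zero hk (Nat.factorial_ne_zero _))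
  let F : ℕ → (Finset.Icc (-(B : ℤ)) B) × T := fun H => (⟨ν H, by
    rw [Finset.mem_Icc]; exact abs_le.1 (hνB H)⟩, cl (a H))
  obtain ⟨y, hy⟩ := Finite.exists_infinite_fiber F
  have hyi : (F ⁻¹' {y}).Infinite := Set.infinite_coe_iff.1 hy
  obtain ⟨H0, hH0⟩ := hyi.nonempty
  by_contra! hno
  have hall : ∀ H, F H = y → a H = a H0 := by
    intro H hH
    have hF : F H = F H0 := by rw [hH]; exact hH0.symm
    have h1 : ν H = ν H0 := by
      have := congrArg (fun z => (z.1 : ℤ)) hF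
      exact this
    have h2 : cl (a H) = cl (a H0) := congrArg (fun z => z.2) hF
    have h3 := hcl _ _ (Lm.of_mem (haM H)) (Lm.of_mem (haM H0)) h2
    have h4 : a H * (a H0)⁻¹ ∈ S.Gam 1 k := by
      refine div_mem_Gam one_ne_zero (Lm.of_mem (haM H0)) (ν := ν H0) (by rw [hν, h1]) (hν H0) (hν0 H0) (h3.of_dvd ?_)
      refine Nat.mul_dvd_mul_left _ (Nat.dvd_factorial (Int.natAbs_pos.2 (hν0 H0)) ?_)
      have := hνB H0
      rw [Int.abs_eq_natAbs] at this
      exact_mod_cast this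
    have h5 := hno _ h4
    exact (mul_inv_eq_one₀ (ha0 H0)).1 h5
  have hrow : ∀ l, S.ι (a H0) 0 l = 0 := by
    intro l
    rw [← abs_nonpos_iff]
    refine le_of_forall_pos_le_add fun ε hε => ?_
    rw [zero_add]
    obtain ⟨N, hN⟩ := exists_nat_gt (C / ε)
    obtain ⟨H, hH, hHN⟩ := hyi.exists_gt N
    have h1 := hιa H 0 l
    rw [hall H hH] at h1
    refine h1.trans ?_
    simp only [wt, if_true]
    have h2 : (N : ℝ) < ((H + 1 : ℕ) : ℝ) := by exact_mod_cast (by omega : N < H + 1)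
    rw [mul_one_div, div_le_iff₀ (by positivity)]
    rw [div_lt_iff₀ hε] at hN
    nlinarith
  have hdet := Matrix.det_eq_zero_of_row_eq_zero 0 hrow
  rw [S.det, hν] at hdet
  apply hν0 H0
  exact_mod_cast hdet

variable {S : Ctx A n} {p : ℕ} [hp : Fact p.Prime] {m : ℕ}

lemma exists_s (S : Ctx A n) (j : A →ₐ[ℚ] Matrix (Fin n) (Fin n) ℚ_[p]) : ∃ s : ℕ, ∀ x ∈ S.M, Sm (-(s : ℤ)) (j x) := by
  choose f hf using fun i => Sm.exists_nat (j (S.e i))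
  refine ⟨∑ i, f i, fun x hx => ?_⟩
  obtain ⟨z, hz⟩ := S.exists_int hx
  rw [← S.e.sum_repr x, map_sum]
  refine Sm.sum _ _ fun i _ => ?_
  rw [map_smul, hz]
  have h1 : (z i : ℚ) • j (S.e i) = (z i : ℚ_[p]) • j (S.e i) := by
    ext x y
    simp [Rat.smul_def]
  rw [h1]
  refine Sm.smul_int _ ((hf i).mono ?_)
  have := Finset.single_le_sum (f := f) (fun _ _ => Nat.zero_le _) (Finset.mem_univ i)
  omega

lemma openΓ (S : Ctx A n) (j : A →ₐ[ℚ] Matrix (Fin n) (Fin n) ℚ_[p]) (hm : m ≠ 0) :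
    ∃ K0 : ℕ, ∀ g : Matrix (Fin n) (Fin n) ℚ_[p], g.det = 1 → Sm K0 (g - 1) → ∀ K : ℕ, ∃ γ ∈ S.Gam 1 m, Sm K (j γ - g) := by
  obtain ⟨s, hs⟩ := S.exists_s j
  obtain ⟨γ, hγ, hγ1⟩ := S.alpha (p ^ (s + 2) * m) (Nat.mul_ne_zero (pow_ne_zero _ hp.out.ne_zero) hm)
  have h2 : Sm 2 (j γ - 1) := by
    obtain ⟨t, y, hy, h⟩ := hγ.2
    simp only [Nat.cast_one, one_pow, one_smul] at h
    have h3 : j γ - 1 = (p : ℚ_[p]) ^ (s + 2) • ((m : ℚ_[p]) • j y) := by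
      rw [← map_one j, ← map_sub, h, map_smul]
      ext a b
      simp [Rat.smul_def, mul_assoc]
    rw [h3]
    exact (((hs y hy).smul_nat m).smul_pow (s + 2)).mono (by push_cast; omega)
  obtain ⟨z, hz, hz0⟩ := T.exists_ne (Gam_mono hγ (dvd_mul_left m _)) hγ1 h2
  exact open_lemma (T.sl hm hz hz0)
end Ctx
end SA

namespace SA
section
variable {p : ℕ} [hp : Fact p.Prime]

/-- integral element -/
noncomputable def toInt (x : ℚ_[p]) (h : ‖x‖ ≤ 1) : ℤ_[p] := ⟨x, h⟩

lemma toInt_coe (x : ℚ_[p]) (h : ‖x‖ ≤ 1) : ((toInt x h : ℤ_[p]) : ℚ_[p]) = x := rfl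

/-- residue modulo `p^K` of an integral element -/
noncomputable def red (K : ℕ) (x : ℚ_[p]) : ZMod (p ^ K) := by
  classical exact if h : ‖x‖ ≤ 1 then PadicInt.toZModPow K (toInt x h) else 0

lemma red_pos (K : ℕ) (x : ℚ_[p]) (h : ‖x‖ ≤ 1) : red K x = PadicInt.toZModPow K (toInt x h) := by
  unfold red; rw [dif_pos h]

lemma red_spec {K : ℕ} {x y : ℚ_[p]} (hx : ‖x‖ ≤ 1) (hy : ‖y‖ ≤ 1) (h : red K x = red K y) :
    ‖x - y‖ ≤ (p : ℝ) ^ (-(K : ℤ)) := by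
  rw [red_pos _ _ hx, red_pos _ _ hy] at h
  have h1 : (toInt x hx - toInt y hy : ℤ_[p]) ∈ RingHom.ker (PadicInt.toZModPow (p := p) K) := by
    rw [RingHom.mem_ker, map_sub, h, sub_self]
  rw [PadicInt.ker_toZModPow, ← PadicInt.norm_le_pow_iff_mem_span_pow, PadicInt.norm_def, PadicInt.coe_sub] at h1
  exact h1

lemma red_val {K : ℕ} {x : ℚ_[p]} (hx : ‖x‖ ≤ 1) : ‖x - ((red K x).val : ℚ_[p])‖ ≤ (p : ℝ) ^ (-(K : ℤ)) := by
  refine red_spec hx (norm_nat_le _) ?_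
  generalize red K x = r
  rw [red_pos _ _ (norm_nat_le _)]
  have : toInt (r.val : ℚ_[p]) (norm_nat_le _) = (r.val : ℤ_[p]) := by
    apply Subtype.ext
    change (r.val : ℚ_[p]) = ((r.val : ℤ_[p]) : ℚ_[p])
    rw [PadicInt.coe_natCast]
  rw [this, map_natCast]
  have : NeZero (p ^ K) := ⟨pow_ne_zero _ hp.out.ne_zero⟩
  rw [ZMod.natCast_zmod_val]
end

namespace Ctx
variable {A : Type} [DivisionRing A] [CharZero A] {n : ℕ} 

lemma nr_bound (S : Ctx A n) (c : ℝ) : ∃ B : ℕ, ∀ a : A, (∀ i, |((S.e.repr a i : ℚ) : ℝ)| ≤ c) → |((S.nr a : ℚ) : ℝ)| ≤ B := by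
  let C : ℝ := ∑ i, ∑ k, ∑ l, c * |S.ι (S.e i) k l|
  obtain ⟨B, hB⟩ := exists_nat_ge ((n.factorial : ℝ) * C ^ n)
  refine ⟨B, fun a ha => ?_⟩
  have hc : 0 ≤ c := (abs_nonneg _).trans (ha ⟨0, by have := S.n_pos; positivity⟩)
  have h1 : ∀ k l, |S.ι a k l| ≤ C := by
    intro k l
    have : S.ι a = ∑ i, ((S.e.repr a i : ℚ) : ℝ) • S.ι (S.e i) := by
      conv_lhs => rw [← S.e.sum_repr a]
      simp only [map_sum, map_smul]
      refine Finset.sum_congr rfl fun i _ => ?_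
      ext x y
      simp [Rat.smul_def]
    rw [this, Matrix.sum_apply]
    refine (Finset.abs_sum_le_sum_abs _ _).trans (Finset.sum_le_sum fun i _ => ?_)
    rw [Matrix.smul_apply, smul_eq_mul, abs_mul]
    refine (mul_le_mul_of_nonneg_right (ha i) (abs_nonneg _)).trans ?_
    refine (Finset.single_le_sum (f := fun l => c * |S.ι (S.e i) k l|) (fun _ _ => by positivity) (Finset.mem_univ l)).trans ?_
    exact (Finset.single_le_sum (f := fun k => ∑ l, c * |S.ι (S.e i) k l|) (fun _ _ => Finset.sum_nonneg fun _ _ => by positivity) (Finset.mem_univ k))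
  have h2 := Matrix.det_le (A := S.ι a) (abv := AbsoluteValue.abs) (x := C) h1
  rw [S.det] at h2
  simp only [Fintype.card_fin, nsmul_eq_mul, AbsoluteValue.abs_apply] at h2
  exact h2.trans hB

variable {S : Ctx A n} {p : ℕ} [hp : Fact p.Prime] {m : ℕ}

lemma nr_smul (S : Ctx A n) (c : ℚ) (x : A) : S.nr (c • x) = c ^ n * S.nr x := by
  have h1 := S.det (c • x) S.ι
  have h2 : S.ι (c • x) = (c : ℝ) • S.ι x := by
    rw [map_smul]; ext a b; simp [Rat.smul_def]
  rw [h2, Matrix.det_smul, S.det, Fintype.card_fin] at h1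
  exact_mod_cast h1.symm

lemma nr_int_p (S : Ctx A n) {a : A} (ha : S.Lm p 1 a) (h : ‖((S.nr a : ℚ) : ℚ_[p])‖ ≤ 1) : ∃ ν : ℤ, S.nr a = ν := by
  obtain ⟨s, y, hy, h1⟩ := ha
  obtain ⟨z, hz⟩ := S.nr_int hy
  have h2 := S.nr_smul ((p : ℚ) ^ s) a
  rw [h1, Nat.cast_one, one_smul, hz, ← pow_mul] at h2
  have h3 : (p : ℤ) ^ (s * n) ∣ z := by
    rw [← Padic.norm_int_le_pow_iff_dvd]
    have h4 : ((z : ℤ) : ℚ_[p]) = (p : ℚ_[p]) ^ (s * n) * ((S.nr a : ℚ) : ℚ_[p]) := by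
      have := congrArg (fun q : ℚ => (q : ℚ_[p])) h2
      push_cast at this
      exact this
    rw [h4, norm_mul, norm_p_pow']
    exact mul_le_of_le_one_right (zpow_nonneg (p_pos (p := p)).le _) h
  obtain ⟨ν, rfl⟩ := h3
  refine ⟨ν, ?_⟩
  have hp0 : (p : ℚ) ^ (s * n) ≠ 0 := pow_ne_zero _ (by exact_mod_cast hp.out.ne_zero)
  apply mul_left_cancel₀ hp0
  rw [← h2]; push_cast; ring

lemma pigeon_p (S : Ctx A n) (j : A →ₐ[ℚ] Matrix (Fin n) (Fin n) ℚ_[p]) {i k : Fin n} (hik : i ≠ k) :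
    ∃ C : ℝ, ∀ t : ℚ_[p], ∃ a : A, a ≠ 0 ∧ S.Lm p 1 a ∧ (∀ x, |((S.e.repr a x : ℚ) : ℝ)| ≤ C) ∧
      Sm 0 (Matrix.transvection i k (-t) * j a) := by
  obtain ⟨s0, hs0⟩ := S.exists_s j
  refine ⟨(p : ℝ) ^ s0, fun t => ?_⟩
  obtain ⟨s, hs⟩ := exists_scalar t
  have hp0 : (p : ℚ_[p]) ≠ 0 := by exact_mod_cast hp.out.ne_zero
  have hpos := p_pos (p := p)
  have : NeZero (p ^ s) := ⟨pow_ne_zero _ hp.out.ne_zero⟩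
  let X : (Fin (n ^ 2) → Fin (p ^ s + 1)) → A := fun b => ∑ x, (((b x : ℕ) : ℤ) : ℚ) • S.e x
  let Y : (Fin (n ^ 2) → Fin (p ^ s + 1)) → Matrix (Fin n) (Fin n) ℚ_[p] := fun b => (p : ℚ_[p]) ^ s0 • j (X b)
  have hY : ∀ b, Sm 0 (Y b) := fun b => by
    have := (hs0 (X b) (S.sum_mem _)).smul_pow s0
    simpa using this
  have hY' : ∀ b x y, ‖Y b x y‖ ≤ 1 := fun b x y => by simpa using hY b x y
  let q : ℚ_[p] → ℚ_[p] := fun x => x - ((red s x).val : ℚ_[p])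
  have hq : ∀ b x y, ‖t * q (Y b x y)‖ ≤ 1 := by
    intro b x y
    rw [norm_mul]
    calc ‖t‖ * ‖q (Y b x y)‖ ≤ (p : ℝ) ^ (s : ℤ) * (p : ℝ) ^ (-(s : ℤ)) :=
          mul_le_mul hs (red_val (hY' b x y)) (norm_nonneg _) (zpow_nonneg hpos.le _)
      _ = 1 := by rw [← zpow_add₀ hpos.ne']; simp
  let Z : (Fin (n ^ 2) → Fin (p ^ s + 1)) → Matrix (Fin n) (Fin n) ℚ_[p] := fun b => Matrix.of fun x y =>
    if x = i then Y b x y - t * q (Y b k y) else Y b x y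
  have hZ : ∀ b x y, ‖Z b x y‖ ≤ 1 := by
    intro b x y
    simp only [Z, Matrix.of_apply]
    split_ifs
    · rw [sub_eq_add_neg]
      refine (Padic.nonarchimedean _ _).trans (max_le (hY' b x y) ?_)
      rw [norm_neg]; exact hq b k y
    · exact hY' b x y
  let F : (Fin (n ^ 2) → Fin (p ^ s + 1)) → (Fin n → Fin n → ZMod (p ^ s)) := fun b x y => red s (Z b x y)
  obtain ⟨b, b', hne, hF⟩ := Fintype.exists_ne_map_eq_of_card_lt F (by
    simp only [Fintype.card_fun, Fintype.card_fin, ZMod.card]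
    rw [← pow_mul, pow_two]
    exact Nat.pow_lt_pow_left (by omega) (by have := S.n_pos; positivity))
  have hZd : ∀ x y, ‖Z b x y - Z b' x y‖ ≤ (p : ℝ) ^ (-(s : ℤ)) := fun x y =>
    red_spec (hZ b x y) (hZ b' x y) (congrFun (congrFun hF x) y)
  have hqd : ∀ y, q (Y b k y) - q (Y b' k y) = Y b k y - Y b' k y := by
    intro y
    have h1 : red s (Y b k y) = red s (Y b' k y) := by
      have := congrFun (congrFun hF k) y
      simpa [F, Z, hik.symm] using this
    simp only [q, h1]; ring
  let a : A := ((p : ℚ) ^ s)⁻¹ • ((p : ℚ) ^ s0 • (X b - X b'))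
  have hpq : (p : ℚ) ≠ 0 := by exact_mod_cast hp.out.ne_zero
  have hrep : ∀ x, S.e.repr (X b - X b') x = ((b x : ℕ) : ℚ) - ((b' x : ℕ) : ℚ) := by
    intro x
    simp only [X]
    rw [map_sub, Finsupp.sub_apply, S.e.repr_sum_self, S.e.repr_sum_self]
    push_cast; rfl
  refine ⟨a, ?_, ?_, ?_, ?_⟩
  · intro h
    have h1 : X b - X b' = 0 := by
      rw [smul_eq_zero_iff_right (inv_ne_zero (pow_ne_zero _ hpq)), smul_eq_zero_iff_right (pow_ne_zero _ hpq)] at h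
      exact h
    apply hne
    ext x
    have := hrep x
    rw [h1] at this
    simp only [map_zero, Finsupp.zero_apply] at this
    have h2 : ((b x : ℕ) : ℚ) = ((b' x : ℕ) : ℚ) := by linarith
    exact_mod_cast h2
  · refine ⟨s, (p : ℚ) ^ s0 • (X b - X b'), ?_, ?_⟩
    · have := S.nsmul_mem_M (sub_mem (S.sum_mem fun x => ((b x : ℕ) : ℤ)) (S.sum_mem fun x => ((b' x : ℕ) : ℤ))) (p ^ s0)
      push_cast at this
      simpa [X] using this
    · simp only [a]
      rw [smul_smul, mul_inv_cancel₀ (pow_ne_zero _ hpq)]; simp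
  · intro x
    simp only [a, map_smul, Finsupp.smul_apply, hrep, smul_eq_mul]
    push_cast
    rw [abs_mul, abs_mul, abs_inv, abs_of_pos (pow_pos hpos s), abs_of_pos (pow_pos hpos s0)]
    have h1 : |((b x : ℕ) : ℝ) - ((b' x : ℕ) : ℝ)| ≤ (p : ℝ) ^ s := by
      have h2 : ((b x : ℕ) : ℝ) ≤ (p : ℝ) ^ s := by exact_mod_cast Nat.lt_succ_iff.1 (b x).2
      have h3 : ((b' x : ℕ) : ℝ) ≤ (p : ℝ) ^ s := by exact_mod_cast Nat.lt_succ_iff.1 (b' x).2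
      rw [abs_le]
      have h4 : (0 : ℝ) ≤ ((b x : ℕ) : ℝ) := Nat.cast_nonneg _
      have h5 : (0 : ℝ) ≤ ((b' x : ℕ) : ℝ) := Nat.cast_nonneg _
      constructor <;> linarith
    rw [inv_mul_le_iff₀ (pow_pos hpos s), mul_comm]
    exact mul_le_mul_of_nonneg_right h1 (pow_pos hpos s0).le
  · have hja : j a = (p : ℚ_[p]) ^ (-(s : ℤ)) • (Y b - Y b') := by
      simp only [a, Y]
      rw [map_smul, map_smul, map_sub, ← smul_sub, _root_.zpow_neg, zpow_natCast]
      ext x y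
      simp [Rat.smul_def]
    rw [hja, Matrix.mul_smul]
    have h1 : Matrix.transvection i k (-t) * (Y b - Y b') = Z b - Z b' := by
      ext x y
      by_cases hx : x = i
      · subst hx
        rw [Matrix.transvection_mul_apply_same]
        simp only [Matrix.sub_apply, Z, if_true, Matrix.of_apply]
        have := hqd y
        linear_combination (t) * this
      · rw [Matrix.transvection_mul_apply_of_ne _ _ _ _ hx]
        simp [Z, hx]
    rw [h1]
    have h2 : Sm s (Z b - Z b') := fun x y => by
      rw [Matrix.sub_apply]; exact hZd x y
    simpa using h2.smul_zpow (-(s : ℤ))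
end Ctx
end SA

namespace SA
namespace Ctx
variable {A : Type} [DivisionRing A] [CharZero A] {n : ℕ} {p : ℕ} [hp : Fact p.Prime]

/-- closure of the congruence group -/
def Dl (S : Ctx A n) (j : A →ₐ[ℚ] Matrix (Fin n) (Fin n) ℚ_[p]) (m : ℕ) : Submonoid (Matrix (Fin n) (Fin n) ℚ_[p]) where
  carrier := {X | ∀ K : ℕ, ∃ γ ∈ S.Gam p m, Sm K (j γ - X)}
  one_mem' := fun K => ⟨1, one_mem _, by rw [map_one, sub_self]; exact Sm.zero _⟩
  mul_mem' := by
    intro X Y hX hY K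
    obtain ⟨a, ha⟩ := Sm.exists_nat X
    obtain ⟨b, hb⟩ := Sm.exists_nat Y
    obtain ⟨γ, hγ, h1⟩ := hX (K + b)
    obtain ⟨δ, hδ, h2⟩ := hY (K + a)
    refine ⟨γ * δ, mul_mem hγ hδ, ?_⟩
    have h3 : j (γ * δ) - X * Y = (j γ - X) * j δ + X * (j δ - Y) := by
      rw [map_mul]; noncomm_ring
    rw [h3]
    have h4 : Sm (-(b : ℤ)) (j δ) := by
      have : j δ = (j δ - Y) + Y := by abel
      rw [this]; exact (h2.mono (by push_cast; omega)).add hb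
    exact ((h1.mul h4).mono (by push_cast; omega)).add ((ha.mul h2).mono (by push_cast; omega))

variable {S : Ctx A n} {j : A →ₐ[ℚ] Matrix (Fin n) (Fin n) ℚ_[p]} {m : ℕ}

lemma Dl.of_Gam {γ : A} (hγ : γ ∈ S.Gam p m) : j γ ∈ S.Dl j m := fun K => ⟨γ, hγ, by rw [sub_self]; exact Sm.zero _⟩

lemma det_Gam {γ : A} (hγ : γ ∈ S.Gam p m) : (j γ).det = 1 := by
  rw [S.det, hγ.1]; simp

lemma Dl.transv (hm : m ≠ 0) {i k : Fin n} (hik : i ≠ k) (t : ℚ_[p]) : Matrix.transvection i k t ∈ S.Dl j m := by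
  classical
  obtain ⟨K0, hK0⟩ := S.openΓ j hm
  obtain ⟨C, hC⟩ := S.pigeon_p j hik
  choose a ha0 haL haC haS using hC
  obtain ⟨B, hB⟩ := S.nr_bound C
  let w : ℚ_[p] → Matrix (Fin n) (Fin n) ℚ_[p] := fun t => Matrix.transvection i k (-t) * j (a t)
  have hdetw : ∀ t, (w t).det = (j (a t)).det := by
    intro t
    simp only [w]
    rw [Matrix.det_mul, Matrix.det_transvection_of_ne _ _ hik, one_mul]
  have hw1 : ∀ t x y, ‖w t x y‖ ≤ 1 := fun t x y => by simpa using haS t x y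
  have hw0 : ∀ t, Sm 0 (w t) := haS
  have hnr1 : ∀ t, ‖((S.nr (a t) : ℚ) : ℚ_[p])‖ ≤ 1 := by
    intro t
    rw [← S.det (a t) j, ← hdetw]
    obtain ⟨Y, hY⟩ := Sm.lift (k := 0) (hw0 t)
    rw [pow_zero, one_smul] at hY
    rw [hY]
    have := RingHom.map_det (PadicInt.Coe.ringHom (p := p)) Y
    rw [RingHom.mapMatrix_apply] at this
    rw [← this]
    exact PadicInt.norm_le_one _
  choose ν hν using fun t => S.nr_int_p (haL t) (hnr1 t)
  have hν0 : ∀ t, ν t ≠ 0 := by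
    intro t h0
    apply S.nr_ne_zero (ha0 t)
    rw [hν, h0]; simp
  have hνB : ∀ t, |ν t| ≤ B := by
    intro t
    have h1 := hB (a t) (haC t)
    rw [hν] at h1
    have h3 : |((ν t : ℤ) : ℝ)| ≤ B := by simpa using h1
    exact_mod_cast h3
  have hdetν : ∀ t, (j (a t)).det = ((ν t : ℤ) : ℚ_[p]) := by
    intro t; rw [S.det, hν]; simp
  obtain ⟨T, hT, cl, hcl⟩ := S.exists_cl p (m * B.factorial) (Nat.mul_ne_zero hm (Nat.factorial_ne_zero _))
  let F : ℚ_[p] → (Finset.Icc (-(B : ℤ)) B) × T := fun t => (⟨ν t, by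
    rw [Finset.mem_Icc]; exact abs_le.1 (hνB t)⟩, cl (a t))
  have hF : ∀ t t', F t = F t' → ν t = ν t' ∧ a t * (a t')⁻¹ ∈ S.Gam p m := by
    intro t t' h
    have h1 : ν t = ν t' := congrArg (fun z => (z.1 : ℤ)) h
    have h2 : cl (a t) = cl (a t') := congrArg (fun z => z.2) h
    refine ⟨h1, div_mem_Gam hp.out.ne_zero (haL t') (ν := ν t') (by rw [hν, h1]) (hν t') (hν0 t')
      ((hcl _ _ (haL t) (haL t') h2).of_dvd ?_)⟩
    refine Nat.mul_dvd_mul_left _ (Nat.dvd_factorial (Int.natAbs_pos.2 (hν0 t')) ?_)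
    have := hνB t'
    rw [Int.abs_eq_natAbs] at this
    exact_mod_cast this
  -- representatives
  have hrep : ∀ y, ∃ r : ℚ_[p], ∀ t, F t = y → F r = y := by
    intro y
    by_cases h : ∃ t, F t = y
    · obtain ⟨r, hr⟩ := h; exact ⟨r, fun _ _ => hr⟩
    · push Not at h
      exact ⟨0, fun t ht => absurd ht (h t)⟩
  choose rep hrep using hrep
  have : Fintype T := Fintype.ofFinite T
  choose κ hκ using fun y => Sm.exists_nat (j (a (rep y)))
  choose κ' hκ' using fun y => Sm.exists_nat (j (a (rep y)))⁻¹
  let κs := ∑ y, (κ y + κ' y)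
  have hκs : ∀ y, κ y + κ' y ≤ κs := fun y => Finset.single_le_sum (f := fun y => κ y + κ' y) (fun _ _ => Nat.zero_le _) (Finset.mem_univ y)
  let K1 := K0 + B + κs
  let F2 : ℚ_[p] → ((Finset.Icc (-(B : ℤ)) B) × T) × (Fin n → Fin n → ZMod (p ^ K1)) := fun t => (F t, fun x y => red K1 (w t x y))
  have hau : ∀ t, IsUnit (j (a t)).det := fun t => by
    rw [hdetν, isUnit_iff_ne_zero]; exact_mod_cast hν0 t
  have hwu : ∀ t, IsUnit (w t).det := fun t => by rw [hdetw]; exact hau t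
  have hwi : ∀ t, Sm (-(B : ℤ)) (w t)⁻¹ := by
    intro t
    refine (hw0 t).inv ?_
    rw [hdetw, hdetν]
    by_contra! h
    have h1 := (Padic.norm_int_le_pow_iff_dvd (p := p) (ν t) B).1 h.le
    have h2 := Int.le_of_dvd (abs_pos.2 (hν0 t)) ((dvd_abs _ _).2 h1)
    have h3 : (B : ℤ) < (p : ℤ) ^ B := by exact_mod_cast Nat.lt_pow_self hp.out.one_lt
    have := hνB t
    omega
  have hdecomp : ∀ t, Matrix.transvection i k t = j (a t) * (w t)⁻¹ := by
    intro t
    have h1 : Matrix.transvection i k t * w t = j (a t) := by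
      simp only [w]
      rw [← mul_assoc, Matrix.transvection_mul_transvection_same _ _ hik, add_neg_cancel, Matrix.transvection_zero, one_mul]
    rw [← h1, mul_assoc, Matrix.mul_nonsing_inv _ (hwu t), mul_one]
  have key : ∀ t t', F2 t = F2 t' → Matrix.transvection i k (t - t') ∈ S.Dl j m := by
    intro t t' h
    have h1 : F t = F t' := congrArg (fun z => z.1) h
    have h2 : (fun x y => red K1 (w t x y)) = (fun x y => red K1 (w t' x y)) := congrArg (fun z => z.2) h
    have h3 : Sm K1 (w t' - w t) := by
      intro x y
      rw [Matrix.sub_apply]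
      exact red_spec (hw1 t' x y) (hw1 t x y) (congrFun (congrFun h2 x) y).symm
    set r := rep (F t) with hr
    have hFr : F r = F t := hrep (F t) t rfl
    obtain ⟨hν1, hγ1⟩ := hF t r hFr.symm
    obtain ⟨hν2, hγ2⟩ := hF t' r (h1.symm.trans hFr.symm)
    have hγ2' := Gam_inv hp.out.ne_zero hγ2
    set γ := a t * (a r)⁻¹
    set γ' := a t' * (a r)⁻¹
    set P := j (a r) * (w t)⁻¹ * w t' * (j (a r))⁻¹ with hP
    have hPd : P.det = 1 := by
      rw [hP, Matrix.det_mul, Matrix.det_mul, Matrix.det_mul, Matrix.det_nonsing_inv, Matrix.det_nonsing_inv,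
        hdetw, hdetw, hdetν, hdetν, hdetν, hν1, hν2, Ring.inverse_eq_inv']
      have : ((ν r : ℤ) : ℚ_[p]) ≠ 0 := by exact_mod_cast hν0 r
      field_simp
    have hP1 : P - 1 = j (a r) * (w t)⁻¹ * (w t' - w t) * (j (a r))⁻¹ := by
      rw [hP, mul_sub, sub_mul]
      congr 1
      rw [mul_assoc (j (a r)), Matrix.nonsing_inv_mul _ (hwu t), mul_one, Matrix.mul_nonsing_inv _ (hau r)]
    have hPs : Sm K0 (P - 1) := by
      rw [hP1]
      refine ((((hκ (F t)).mul (hwi t)).mul h3).mul (hκ' (F t))).mono ?_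
      have := hκs (F t)
      simp only [K1]; push_cast; omega
    have hPD : P ∈ S.Dl j m := by
      intro K
      obtain ⟨δ, hδ, h⟩ := hK0 P hPd hPs K
      exact ⟨δ, Gam_of_one hδ, h⟩
    have hfin : Matrix.transvection i k (t - t') = j γ * P * j γ'⁻¹ := by
      have e1 : Matrix.transvection i k (t - t') * Matrix.transvection i k t' = Matrix.transvection i k t := by
        rw [Matrix.transvection_mul_transvection_same _ _ hik, sub_add_cancel]
      have e2 : Matrix.transvection i k (t - t') = Matrix.transvection i k t * Matrix.transvection i k (-t') := by
        rw [Matrix.transvection_mul_transvection_same _ _ hik, sub_eq_add_neg]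
      have e3 : w t' * j (a t')⁻¹ = Matrix.transvection i k (-t') := by
        simp only [w]
        rw [mul_assoc, ← map_mul, mul_inv_cancel₀ (ha0 t'), map_one, mul_one]
      have e4 : j γ * j (a r) = j (a t) := by
        rw [← map_mul, mul_assoc, inv_mul_cancel₀ (ha0 r), mul_one]
      have e5 : (j (a r))⁻¹ * j γ'⁻¹ = j (a t')⁻¹ := by
        have : γ'⁻¹ = a r * (a t')⁻¹ := by simp only [γ', _root_.mul_inv_rev, inv_inv]
        rw [this, map_mul, ← mul_assoc, Matrix.nonsing_inv_mul _ (hau r), one_mul]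
      rw [e2, hdecomp t, ← e3, hP]
      calc j (a t) * (w t)⁻¹ * (w t' * j (a t')⁻¹) = (j γ * j (a r)) * (w t)⁻¹ * (w t' * ((j (a r))⁻¹ * j γ'⁻¹)) := by rw [e4, e5]
        _ = _ := by simp only [mul_assoc]
    rw [hfin]
    exact mul_mem (mul_mem (Dl.of_Gam hγ1) hPD) (Dl.of_Gam hγ2')
  -- divisibility
  have hpow : ∀ (N : ℕ) (u : ℚ_[p]), Matrix.transvection i k u ∈ S.Dl j m → Matrix.transvection i k (N * u) ∈ S.Dl j m := by
    intro N u hu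
    induction N with
    | zero => simp only [Nat.cast_zero, zero_mul, Matrix.transvection_zero]; exact one_mem _
    | succ N ih =>
      have : ((N + 1 : ℕ) : ℚ_[p]) * u = N * u + u := by push_cast; ring
      rw [this, ← Matrix.transvection_mul_transvection_same _ _ hik]
      exact mul_mem ih hu
  have : NeZero (p ^ K1) := ⟨pow_ne_zero _ hp.out.ne_zero⟩
  set r := Fintype.card (((Finset.Icc (-(B : ℤ)) B) × T) × (Fin n → Fin n → ZMod (p ^ K1))) with hr
  obtain ⟨x, y, hxy, hE⟩ := Fintype.exists_ne_map_eq_of_card_lt (fun x : Fin (r + 1) => F2 ((x : ℕ) * (t / r.factorial))) (by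
    rw [Fintype.card_fin]; omega)
  have main : ∀ x y : Fin (r + 1), x < y → F2 ((x : ℕ) * (t / r.factorial)) = F2 ((y : ℕ) * (t / r.factorial)) →
      Matrix.transvection i k t ∈ S.Dl j m := by
    intro x y hlt hE
    have h1 := key _ _ hE.symm
    have hlt' : (x : ℕ) < y := hlt
    obtain ⟨c, hc⟩ : ((y : ℕ) - x) ∣ r.factorial := Nat.dvd_factorial (by omega) (by omega)
    have h2 := hpow c _ h1
    have h3 : (c : ℚ_[p]) * ((y : ℕ) * (t / r.factorial) - (x : ℕ) * (t / r.factorial)) = t := by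
      have h4 : (r.factorial : ℚ_[p]) = (((y : ℕ) : ℚ_[p]) - ((x : ℕ) : ℚ_[p])) * c := by
        rw [hc]; push_cast [Nat.cast_sub hlt'.le]; ring
      have h5 : (r.factorial : ℚ_[p]) ≠ 0 := by exact_mod_cast Nat.factorial_ne_zero r
      rw [← sub_mul, ← mul_assoc, mul_comm (c : ℚ_[p]), ← h4]
      field_simp
    rwa [h3] at h2
  rcases lt_or_gt_of_ne hxy with h | h
  · exact main x y h hE
  · exact main y x h hE.symm
end Ctx
end SA

namespace SA
lemma diag2n_decomp {ι F : Type*} [Fintype ι] [DecidableEq ι] [Field F] {i j : ι} (hij : i ≠ j) (a : F) (ha : a ≠ 0) :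
    (SpecialLinearGroup.diag2n hij a ha : Matrix ι ι F) = Matrix.transvection i j a *
      Matrix.transvection j i (- a⁻¹) * Matrix.transvection i j a * Matrix.transvection i j (-1) *
      Matrix.transvection j i 1 * Matrix.transvection i j (-1) := by
  rw [SpecialLinearGroup.diag2n_coe]
  simp only [Matrix.transvection, mul_add, add_mul, mul_one, one_mul, Matrix.single_mul_single_same,
    Matrix.single_mul_single_of_ne _ _ _ _ hij, Matrix.single_mul_single_of_ne _ _ _ _ hij.symm, ← add_assoc, add_zero]
  simp only [mul_neg, neg_mul, mul_inv_cancel₀ ha, inv_mul_cancel₀ ha, neg_neg, mul_one, one_mul]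
  ext x y
  simp only [Matrix.add_apply, Matrix.diagonal_apply, Matrix.one_apply, Matrix.single_apply]
  by_cases hx : x = i <;> by_cases hy : y = j <;> by_cases hx' : x = j <;> by_cases hy' : y = i <;> by_cases hxy : x = y <;>
    grind

namespace Ctx
variable {A : Type} [DivisionRing A] [CharZero A] {n : ℕ} {p : ℕ} [hp : Fact p.Prime]
variable {S : Ctx A n} {j : A →ₐ[ℚ] Matrix (Fin n) (Fin n) ℚ_[p]} {m : ℕ}

lemma Dl.all (hm : m ≠ 0) (X : Matrix (Fin n) (Fin n) ℚ_[p]) (hX : X.det = 1) : X ∈ S.Dl j m := by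
  have : Nontrivial (Fin n) := Fin.nontrivial_iff_two_le.2 S.hn
  have h := SpecialLinearGroup.diagonal_transvection_induction' (fun g => (g : Matrix (Fin n) (Fin n) ℚ_[p]) ∈ S.Dl j m)
    ⟨X, hX⟩ ?_ ?_ ?_
  · exact h
  · intro i k hik c hc
    rw [diag2n_decomp]
    have h1 := fun t => Dl.transv (S := S) (j := j) hm hik t
    have h2 := fun t => Dl.transv (S := S) (j := j) hm hik.symm t
    exact mul_mem (mul_mem (mul_mem (mul_mem (mul_mem (h1 _) (h2 _)) (h1 _)) (h1 _)) (h2 _)) (h1 _)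
  · intro i k hik a
    exact Dl.transv hm hik a
  · intro a b ha hb
    exact mul_mem ha hb

lemma coord_int (S : Ctx A n) (j : A →ₐ[ℚ] Matrix (Fin n) (Fin n) ℚ_[p]) :
    ∃ K : ℕ, ∀ x : A, Sm K (j x) → ∃ D : ℕ, ¬ p ∣ D ∧ (D : ℚ) • x ∈ S.M := by
  classical
  have hli := indep S.hc S.n_pos j S.e
  have : Nonempty (Fin (n^2)) := ⟨⟨0, by have := S.n_pos; positivity⟩⟩
  have hcard : Fintype.card (Fin (n^2)) = Module.finrank ℚ_[p] (Matrix (Fin n) (Fin n) ℚ_[p]) := by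
    simp [Module.finrank_matrix, sq]
  let B := basisOfLinearIndependentOfCardEqFinrank (b := fun i => j (S.e i)) hli hcard
  have hB : ∀ i, B i = j (S.e i) := fun i => by simp [B]
  choose f hf using fun (t : Fin (n^2) × Fin n × Fin n) => exists_scalar (B.repr (Matrix.single t.2.1 t.2.2 1) t.1)
  refine ⟨∑ t, f t, fun x hx => ?_⟩
  have hrep : ∀ i, B.repr (j x) i = ((S.e.repr x i : ℚ) : ℚ_[p]) := by
    intro i
    have : j x = ∑ i, ((S.e.repr x i : ℚ) : ℚ_[p]) • B i := by
      conv_lhs => rw [← S.e.sum_repr x]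
      rw [map_sum]
      refine Finset.sum_congr rfl fun i _ => ?_
      rw [map_smul, hB]
      ext a b
      simp [Algebra.smul_def]
    rw [this, B.repr_sum_self]
  have hnorm : ∀ i, ‖((S.e.repr x i : ℚ) : ℚ_[p])‖ ≤ 1 := by
    intro i
    rw [← hrep, Matrix.matrix_eq_sum_single (j x)]
    simp only [map_sum, Finsupp.coe_finsetSum, Finset.sum_apply]
    refine norm_sum_le' _ _ zero_le_one fun a _ => norm_sum_le' _ _ zero_le_one fun b _ => ?_
    have : Matrix.single a b (j x a b) = (j x a b) • Matrix.single a b (1 : ℚ_[p]) := by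
      rw [Matrix.smul_single, smul_eq_mul, mul_one]
    rw [this, map_smul, Finsupp.smul_apply, smul_eq_mul, norm_mul]
    have h1 := hx a b
    have h2 := hf (i, a, b)
    have h3 : f (i, a, b) ≤ ∑ t, f t := Finset.single_le_sum (fun _ _ => Nat.zero_le _) (Finset.mem_univ _)
    have hp1 := (p_one_lt (p := p))
    calc _ ≤ (p : ℝ) ^ (-((∑ t, f t : ℕ) : ℤ)) * (p : ℝ) ^ (f (i, a, b) : ℤ) := mul_le_mul h1 h2 (norm_nonneg _) (by positivity)
      _ = (p : ℝ) ^ (-((∑ t, f t : ℕ) : ℤ) + (f (i, a, b) : ℤ)) := by rw [zpow_add₀ (p_pos (p := p)).ne']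
      _ ≤ (p : ℝ) ^ (0 : ℤ) := zpow_le_zpow_right₀ hp1.le (by omega)
      _ = 1 := by simp
  refine ⟨∏ i, (S.e.repr x i).den, ?_, ?_⟩
  · intro hd
    obtain ⟨i, _, hi⟩ := (Prime.dvd_finsetProd_iff hp.out.prime _).1 hd
    have h1 := PadicInt.isUnit_den (p := p) _ (hnorm i)
    have h2 := PadicInt.isUnit_iff.1 h1
    rw [PadicInt.norm_natCast_eq_one_iff] at h2
    exact hp.out.one_lt.ne' (Nat.dvd_one.1 (h2 ▸ Nat.dvd_gcd dvd_rfl hi))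
  · rw [S.he]
    intro i
    rw [map_smul, Finsupp.smul_apply, smul_eq_mul, ← Finset.mul_prod_erase _ _ (Finset.mem_univ i)]
    refine ⟨(∏ k ∈ Finset.univ.erase i, ((S.e.repr x k).den : ℤ)) * (S.e.repr x i).num, ?_⟩
    have h := Rat.mul_den_eq_num (S.e.repr x i)
    push_cast
    rw [← h]; ring

lemma SAl (S : Ctx A n) (j : A →ₐ[ℚ] Matrix (Fin n) (Fin n) ℚ_[p]) (hm : m ≠ 0) (g : A) (hg : S.nr g = 1) :
    ∃ h ∈ S.Gam p m, ∃ D : ℕ, ¬ p ∣ D ∧ (D : ℚ) • (h * g) ∈ S.M := by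
  obtain ⟨K, hK⟩ := S.coord_int j
  obtain ⟨a, ha⟩ := Sm.exists_nat (j g)
  have hdet : (j g).det = 1 := by rw [S.det, hg]; simp
  have hu : IsUnit (j g).det := by rw [hdet]; exact isUnit_one
  have hd : (j g)⁻¹.det = 1 := by rw [Matrix.det_nonsing_inv, hdet]; simp
  obtain ⟨h, hh, hs⟩ := Dl.all (S := S) (j := j) hm _ hd (K + a)
  refine ⟨h, hh, ?_⟩
  have h1 : Sm K (j (h * g - 1)) := by
    rw [map_sub, map_mul, map_one]
    have : j h * j g - 1 = (j h - (j g)⁻¹) * j g := by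
      rw [sub_mul, Matrix.nonsing_inv_mul _ hu]
    rw [this]
    exact (hs.mul ha).mono (by push_cast; omega)
  obtain ⟨D, hD, hDM⟩ := hK _ h1
  refine ⟨D, hD, ?_⟩
  have : (D : ℚ) • (h * g) = (D : ℚ) • (h * g - 1) + (D : ℚ) • 1 := by rw [← smul_add, sub_add_cancel]
  rw [this]
  exact add_mem hDM (S.nsmul_mem_M (one_mem _) _)
end Ctx
end SA

namespace SA

lemma exists_rep0 {A K F : Type} [Ring A] [Field K] [Field F] [Module K A] [CharZero F]  [Algebra ℚ A]
    (hmul : ∀ (a y : A) (k : K), a * (k • y) = k • (a * y)) {n : ℕ} (b : Module.Basis (Fin n) K A)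
    (ψ : K →+* F) : Nonempty (A →ₐ[ℚ] Matrix (Fin n) (Fin n) F) := by
  let L : A →+* Module.End K A :=
    { toFun := fun a => { toFun := fun y => a * y, map_add' := fun x y => mul_add _ _ _, map_smul' := fun k y => hmul a y k }
      map_one' := by ext y; simp
      map_mul' := fun a b => by ext y; simp [mul_assoc]
      map_zero' := by ext y; simp
      map_add' := fun a b => by ext y; simp [add_mul] }
  let Φ : A →+* Matrix (Fin n) (Fin n) F := (ψ.mapMatrix).comp (((LinearMap.toMatrixAlgEquiv b).toRingEquiv.toRingHom).comp L)
  exact ⟨Φ.toRatAlgHom⟩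

lemma exists_rep {A : Type} [DivisionRing A] [CharZero A] {n : ℕ} (hn : 0 < n) (hfin : Module.finrank ℚ A = n ^ 2)
    (x : A) (hdeg : (minpoly ℚ x).natDegree = n) {F : Type} [Field F] [CharZero F] (θ : F)
    (hθ : Polynomial.aeval θ (minpoly ℚ x) = 0) : Nonempty (A →ₐ[ℚ] Matrix (Fin n) (Fin n) F) := by
  have : FiniteDimensional ℚ A := Module.finite_of_finrank_pos (by rw [hfin]; positivity)
  have hintg : IsIntegral ℚ x := Algebra.IsIntegral.isIntegral x
  have hirr : Fact (Irreducible (minpoly ℚ x)) := ⟨minpoly.irreducible hintg⟩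
  let φ : AdjoinRoot (minpoly ℚ x) →+* A := Ideal.Quotient.lift _ (Polynomial.aeval (R := ℚ) x).toRingHom (by
    intro a ha
    obtain ⟨c, rfl⟩ := Ideal.mem_span_singleton.1 ha
    simp)
  let φo : AdjoinRoot (minpoly ℚ x) →+* Aᵐᵒᵖ := φ.toOpposite (fun a b => by
    change _ = _; rw [← map_mul, ← map_mul, mul_comm])
  let mo : Module (AdjoinRoot (minpoly ℚ x)) A := Module.compHom A φo
  have hsm : ∀ (k : AdjoinRoot (minpoly ℚ x)) (y : A), k • y = y * φ k := fun k y => rfl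
  have htow : IsScalarTower ℚ (AdjoinRoot (minpoly ℚ x)) A := by
    refine ⟨fun r k y => ?_⟩
    rw [hsm, hsm]
    have : φ (r • k) = r • φ k := by
      rw [Algebra.smul_def, map_mul, Algebra.smul_def]
      congr 1
      simp
    rw [this, mul_smul_comm]
  have hK : Module.finrank ℚ (AdjoinRoot (minpoly ℚ x)) = n := by
    rw [(AdjoinRoot.powerBasis hirr.out.ne_zero).finrank, AdjoinRoot.powerBasis_dim, hdeg]
  have hKf : FiniteDimensional ℚ (AdjoinRoot (minpoly ℚ x)) := Module.finite_of_finrank_pos (by rw [hK]; exact hn)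
  have hAK : Module.finrank (AdjoinRoot (minpoly ℚ x)) A = n := by
    have := Module.finrank_mul_finrank ℚ (AdjoinRoot (minpoly ℚ x)) A
    rw [hK, hfin, sq] at this
    exact Nat.eq_of_mul_eq_mul_left hn this
  have hfd : Module.Finite (AdjoinRoot (minpoly ℚ x)) A := Module.finite_of_finrank_pos (by rw [hAK]; exact hn)
  refine exists_rep0 (K := AdjoinRoot (minpoly ℚ x)) ?_ (Module.finBasisOfFinrankEq _ _ hAK)
    (AdjoinRoot.lift (algebraMap ℚ F) θ (by rwa [← Polynomial.aeval_def]))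
  intro a y k
  rw [hsm, hsm, mul_assoc]

namespace Ctx
variable {A : Type} [DivisionRing A] [CharZero A] {n : ℕ}

lemma finrank_eq (S : Ctx A n) : Module.finrank ℚ A = n ^ 2 := by
  rw [Module.finrank_eq_card_basis S.e, Fintype.card_fin]

lemma cp_natDegree (S : Ctx A n) (x : A) : (S.cp x).natDegree = n := by
  have h := S.cp_map x S.ι
  have h2 := Matrix.charpoly_natDegree_eq_dim (S.ι x)
  rw [h, Polynomial.natDegree_map] at h2
  simpa using h2

lemma minpoly_eq (S : Ctx A n) (x : A) (hli : LinearIndependent ℚ (fun k : Fin n => x ^ (k : ℕ))) :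
    minpoly ℚ x = S.cp x ∧ Irreducible (S.cp x) := by
  have : FiniteDimensional ℚ A := Module.finite_of_finrank_pos (by rw [S.finrank_eq]; have := S.n_pos; positivity)
  have hintg : IsIntegral ℚ x := Algebra.IsIntegral.isIntegral x
  have hdvd : minpoly ℚ x ∣ S.cp x := minpoly.dvd _ _ S.cp_root
  have hdeg : n ≤ (minpoly ℚ x).natDegree := by
    by_contra hlt
    push Not at hlt
    have h0 := minpoly.aeval ℚ x
    rw [Polynomial.aeval_eq_sum_range' hlt, Finset.sum_range] at h0
    have h1 := Fintype.linearIndependent_iff.1 hli _ h0 ⟨_, hlt⟩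
    simp only at h1
    rw [Polynomial.coeff_natDegree, (minpoly.monic hintg).leadingCoeff] at h1
    exact one_ne_zero h1
  have heq : minpoly ℚ x = S.cp x := by
    have hpos := S.n_pos
    refine (Polynomial.eq_of_monic_of_dvd_of_natDegree_le (minpoly.monic hintg) (S.cp_monic x) hdvd ?_).symm
    rw [S.cp_natDegree]; exact hdeg
  exact ⟨heq, heq ▸ minpoly.irreducible hintg⟩

lemma krylov (S : Ctx A n) (x1 : A) (m : ℕ) (hm : m ≠ 0) :
    ∃ y ∈ S.M, LinearIndependent ℚ (fun k : Fin n => (x1 + (m : ℚ) • y) ^ (k : ℕ)) := by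
  classical
  let i0 : Fin n := ⟨0, S.n_pos⟩
  -- generic matrix
  let X : Matrix (Fin n) (Fin n) (MvPolynomial (Fin (n^2)) ℝ) :=
    (S.ι x1).map MvPolynomial.C + ∑ i, (MvPolynomial.C (m : ℝ) * MvPolynomial.X i) • ((S.ι (S.e i)).map MvPolynomial.C)
  let W : Matrix (Fin n) (Fin n) (MvPolynomial (Fin (n^2)) ℝ) := Matrix.of fun a k => (X ^ (k : ℕ)) a i0
  have hX : ∀ t : Fin (n^2) → ℝ, X.map (MvPolynomial.eval t) = S.ι x1 + (m : ℝ) • ∑ i, t i • S.ι (S.e i) := by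
    intro t
    ext a b
    simp [X, Matrix.sum_apply, Matrix.map_apply, Finset.mul_sum, mul_assoc]
  have hW : ∀ t : Fin (n^2) → ℝ, MvPolynomial.eval t W.det =
      (Matrix.of fun a (k : Fin n) => ((S.ι x1 + (m : ℝ) • ∑ i, t i • S.ι (S.e i)) ^ (k : ℕ)) a i0).det := by
    intro t
    rw [RingHom.map_det]
    congr 1
    ext a k
    simp only [RingHom.mapMatrix_apply, Matrix.map_apply, W, Matrix.of_apply]
    rw [← hX, ← RingHom.mapMatrix_apply, ← map_pow]
    simp
  have hne : W.det ≠ 0 := by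
    intro h0
    -- shift matrix
    let Z : Matrix (Fin n) (Fin n) ℝ := Matrix.of fun a b => if (a : ℕ) = b + 1 then 1 else 0
    have hZ : ∀ k : ℕ, k < n → ∀ a : Fin n, (Z ^ k) a i0 = if (a : ℕ) = k then 1 else 0 := by
      intro k
      induction k with
      | zero => intro _ a; simp [Matrix.one_apply, i0, Fin.ext_iff]
      | succ k ih =>
        intro hk a
        rw [pow_succ', Matrix.mul_apply]
        simp only [ih (by omega)]
        rw [Finset.sum_eq_single (⟨k, by omega⟩ : Fin n)]
        · simp [Z]
        · intro b _ hb
          have : (b : ℕ) ≠ k := fun h => hb (Fin.ext h)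
          simp [this]
        · simp
    have hli := indep S.hc S.n_pos S.ι S.e
    have : Nonempty (Fin (n^2)) := ⟨⟨0, by have := S.n_pos; positivity⟩⟩
    let b := basisOfLinearIndependentOfCardEqFinrank (b := fun i => S.ι (S.e i)) hli
      (by simp [Module.finrank_matrix, pow_two])
    have hb : ∀ i, b i = S.ι (S.e i) := fun i => by simp [b]
    have h1 := hW (fun i => b.repr ((m : ℝ)⁻¹ • (Z - S.ι x1)) i)
    simp only [← hb] at h1
    rw [h0, map_zero, b.sum_repr, smul_smul, mul_inv_cancel₀ (by exact_mod_cast hm), one_smul, add_sub_cancel] at h1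
    have h2 : (Matrix.of fun a (k : Fin n) => (Z ^ (k : ℕ)) a i0) = (1 : Matrix (Fin n) (Fin n) ℝ) := by
      ext a k
      rw [Matrix.of_apply, hZ k k.2, Matrix.one_apply]
      simp [Fin.ext_iff]
    rw [h2, Matrix.det_one] at h1
    exact zero_ne_one h1
  have hex : ∃ t : Fin (n^2) → ℝ, (∀ i, ∃ z : ℤ, t i = z) ∧ MvPolynomial.eval t W.det ≠ 0 := by
    by_contra! hall
    apply hne
    refine MvPolynomial.funext_set (fun _ => Set.range (Int.cast : ℤ → ℝ)) (fun _ => Set.infinite_range_of_injective Int.cast_injective) ?_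
    intro t ht
    rw [map_zero]
    refine hall t fun i => ?_
    obtain ⟨z, hz⟩ := ht i (Set.mem_univ i)
    exact ⟨z, hz.symm⟩
  obtain ⟨t, ht, hdet⟩ := hex
  choose z hz using ht
  refine ⟨∑ i, (z i : ℚ) • S.e i, S.sum_mem z, ?_⟩
  set y := ∑ i, (z i : ℚ) • S.e i with hy
  have hιy : S.ι (x1 + (m : ℚ) • y) = S.ι x1 + (m : ℝ) • ∑ i, t i • S.ι (S.e i) := by
    rw [map_add, map_smul, hy, map_sum]
    congr 1
    ext a b
    simp [hz, Matrix.sum_apply, Algebra.smul_def]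
  rw [hW, ← hιy] at hdet
  rw [Fintype.linearIndependent_iff]
  intro c hc k
  have h3 := congrArg S.ι hc
  rw [map_sum, map_zero] at h3
  have h4 : (Matrix.of fun a (k : Fin n) => ((S.ι (x1 + (m : ℚ) • y)) ^ (k : ℕ)) a i0) *ᵥ (fun k => ((c k : ℚ) : ℝ)) = 0 := by
    ext a
    have h5 := congrFun (congrFun h3 a) i0
    rw [Matrix.sum_apply] at h5
    simp only [map_smul, map_pow, Matrix.smul_apply] at h5
    simp only [Matrix.mulVec, dotProduct, Matrix.of_apply, Pi.zero_apply]
    rw [← show _ = (0 : ℝ) from h5]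
    refine Finset.sum_congr rfl fun k _ => ?_
    rw [mul_comm]; exact (Rat.smul_def (c k) (_ : ℝ)).symm
  have h6 := Matrix.eq_zero_of_mulVec_eq_zero hdet h4
  have := congrFun h6 k
  simpa using this
end Ctx
end SA

namespace SA

lemma pick_t (f : Polynomial ℤ) (hf : f.Monic) {n : ℕ} (hdeg : f.natDegree = n) (m : ℕ)
    (hcop : IsCoprime (f.coeff 0) (m : ℤ)) (hsmall : ∀ l : ℕ, l.Prime → l ≤ n → l ∣ m)
    (hirr : Irreducible (f.map (Int.castRingHom ℚ))) :
    ∃ t : ℕ, ∀ l : ℕ, l.Prime → (l : ℤ) ∣ f.eval (-((m : ℤ) * t)) → ¬ l ∣ m ∧ ¬ (l : ℤ) ∣ f.derivative.eval (-((m : ℤ) * t)) := by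
  classical
  obtain ⟨u, v, huv⟩ := hirr.separable
  obtain ⟨b1, h1⟩ := IsLocalization.integerNormalization_map_to_map (nonZeroDivisors ℤ) u
  obtain ⟨b2, h2⟩ := IsLocalization.integerNormalization_map_to_map (nonZeroDivisors ℤ) v
  set U := IsLocalization.integerNormalization (nonZeroDivisors ℤ) u
  set V := IsLocalization.integerNormalization (nonZeroDivisors ℤ) v
  have hb1 : (b1 : ℤ) ≠ 0 := nonZeroDivisors.ne_zero b1.2
  have hb2 : (b2 : ℤ) ≠ 0 := nonZeroDivisors.ne_zero b2.2
  have hbez : ∀ a : ℤ, b2 * (U.eval a * f.eval a) + b1 * (V.eval a * f.derivative.eval a) = b1 * b2 := by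
    intro a
    have e0 := congrArg (Polynomial.eval (a : ℚ)) huv
    have e1 := congrArg (Polynomial.eval (a : ℚ)) h1
    have e2 := congrArg (Polynomial.eval (a : ℚ)) h2
    rw [algebraMap_int_eq] at e1 e2
    have key : ∀ g : Polynomial ℤ, Polynomial.eval (a : ℚ) (g.map (Int.castRingHom ℚ)) = ((g.eval a : ℤ) : ℚ) := by
      intro g
      rw [Polynomial.eval_intCast_map]; simp
    rw [key, ← Int.cast_smul_eq_zsmul ℚ, Polynomial.eval_smul, smul_eq_mul] at e1 e2
    rw [Polynomial.derivative_map, Polynomial.eval_add, Polynomial.eval_mul, Polynomial.eval_mul, key, key, Polynomial.eval_one] at e0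
    have : ((b2 * (U.eval a * f.eval a) + b1 * (V.eval a * f.derivative.eval a) : ℤ) : ℚ) = ((b1 * b2 : ℤ) : ℚ) := by
      push_cast
      rw [e1, e2]
      linear_combination ((b1 : ℤ) : ℚ) * ((b2 : ℤ) : ℚ) * e0
    exact_mod_cast this
  have hcong : ∀ (l : ℕ) (x y : ℤ), (l : ℤ) ∣ x - y → (l : ℤ) ∣ f.eval x → (l : ℤ) ∣ f.eval y := by
    intro l x y hxy hx
    have := hxy.trans (Polynomial.sub_dvd_eval_sub x y f)
    exact (dvd_sub_right hx).1 this
  have hloc : ∀ l : ℕ, ∃ a : ℕ, l.Prime → ¬ l ∣ m → ¬ (l : ℤ) ∣ f.eval (-((m : ℤ) * a)) := by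
    intro l
    by_cases hl : l.Prime
    · by_cases hlm : l ∣ m
      · exact ⟨0, fun _ h => absurd hlm h⟩
      by_contra! hall
      have hF : Fact l.Prime := ⟨hl⟩
      have hln : n < l := by
        by_contra h; exact hlm (hsmall l hl (by omega))
      have hm0 : (m : ZMod l) ≠ 0 := by rwa [Ne, ZMod.natCast_eq_zero_iff]
      have hz : f.map (Int.castRingHom (ZMod l)) = 0 := by
        refine Polynomial.eq_zero_of_natDegree_lt_card_of_eval_eq_zero' _ (Finset.univ) ?_ ?_
        · intro b _
          obtain ⟨_, _, h⟩ := hall (-(b / (m : ZMod l))).val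
          rw [← ZMod.intCast_zmod_eq_zero_iff_dvd] at h
          have hb : b = ((-((m : ℤ) * ((-(b / (m : ZMod l))).val : ℕ)) : ℤ) : ZMod l) := by
            push_cast
            rw [ZMod.natCast_zmod_val]
            field_simp
          rw [hb, Polynomial.eval_intCast_map]
          simpa using h
        · rw [hf.natDegree_map, hdeg, Finset.card_univ, ZMod.card]; exact hln
      exact (hf.map _).ne_zero hz
    · exact ⟨0, fun h => absurd h hl⟩
  choose a ha using hloc
  obtain ⟨t, ht⟩ := Nat.chineseRemainderOfFinset a id ((b1 * b2 : ℤ).natAbs.primeFactors)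
    (fun i hi => (Nat.prime_of_mem_primeFactors hi).ne_zero)
    (fun i hi k hk hik => (Nat.coprime_primes (Nat.prime_of_mem_primeFactors hi) (Nat.prime_of_mem_primeFactors hk)).2 hik)
  refine ⟨t, fun l hl hd => ?_⟩
  have hlm : ¬ l ∣ m := by
    intro hlm
    have h3 : (l : ℤ) ∣ f.eval 0 := by
      refine hcong l _ _ ?_ hd
      rw [sub_zero, dvd_neg]
      exact (Int.natCast_dvd_natCast.2 hlm).mul_right _
    rw [← Polynomial.coeff_zero_eq_eval_zero] at h3
    have h4 := hcop.isUnit_of_dvd' h3 (Int.natCast_dvd_natCast.2 hlm)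
    have := (Nat.prime_iff_prime_int.1 hl).not_isUnit
    exact this h4
  refine ⟨hlm, fun hd' => ?_⟩
  have h5 : (l : ℤ) ∣ b1 * b2 := by
    rw [← hbez (-((m : ℤ) * t))]
    exact dvd_add ((hd.mul_left _).mul_left _) ((hd'.mul_left _).mul_left _)
  have h6 : l ∈ (b1 * b2 : ℤ).natAbs.primeFactors := by
    rw [Nat.mem_primeFactors]
    exact ⟨hl, Int.natCast_dvd.1 h5, by simpa using ⟨hb1, hb2⟩⟩
  have h7 := ht l h6
  apply ha l hl hlm
  refine hcong l _ _ ?_ hd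
  have h8 : (l : ℤ) ∣ (a l : ℤ) - t := (Nat.modEq_iff_dvd.1 h7)
  have : -((m : ℤ) * t) - (-((m : ℤ) * a l)) = m * ((a l : ℤ) - t) := by ring
  rw [this]
  exact h8.mul_left _

namespace Ctx
variable {A : Type} [DivisionRing A] [CharZero A] {n : ℕ}

lemma nr_sub (S : Ctx A n) (c : ℚ) (x : A) : S.nr (c • 1 - x) = (S.cp x).eval c := by
  have h1 := S.det (c • 1 - x) S.ι
  have h2 : S.ι (c • 1 - x) = Matrix.scalar _ (c : ℝ) - S.ι x := by
    rw [map_sub, map_smul, map_one]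
    congr 1
    ext a b
    simp [Matrix.smul_apply, Matrix.one_apply, Matrix.diagonal_apply]
  rw [h2, ← Matrix.eval_charpoly, S.cp_map x S.ι] at h1
  have h3 : Polynomial.eval (c : ℝ) ((S.cp x).map (algebraMap ℚ ℝ)) = (((S.cp x).eval c : ℚ) : ℝ) := by
    have := Polynomial.eval_map_apply (p := S.cp x) (algebraMap ℚ ℝ) c
    simpa using this
  rw [h3] at h1
  exact_mod_cast h1.symm

lemma nr_one_add (S : Ctx A n) {m : ℕ} (hm : m ≠ 0) {z : A} (hz : z ∈ S.M) : ∃ k : ℤ, S.nr (1 + (m : ℚ) • z) = 1 + m * k := by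
  have hm' : (m : ℚ) ≠ 0 := by exact_mod_cast hm
  obtain ⟨f, hf, hd, hcp⟩ := S.cp_int (neg_mem hz)
  have h1 : (1 : A) + (m : ℚ) • z = (m : ℚ) • ((1 / m : ℚ) • 1 - (-z)) := by
    rw [smul_sub, smul_smul, smul_neg, sub_neg_eq_add]
    congr 1
    rw [mul_one_div_cancel hm', one_smul]
  rw [h1, S.nr_smul, S.nr_sub, hcp]
  have hdm : (f.map (Int.castRingHom ℚ)).natDegree = n := by rw [hf.natDegree_map, hd]
  rw [Polynomial.eval_eq_sum_range, hdm, Finset.sum_range_succ]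
  have hl : f.coeff n = 1 := by rw [← hd]; exact hf
  refine ⟨∑ i ∈ Finset.range n, f.coeff i * (m : ℤ) ^ (n - 1 - i), ?_⟩
  rw [mul_add, Polynomial.coeff_map, hl, add_comm, Finset.mul_sum]
  push_cast
  rw [Finset.mul_sum]
  congr 1
  · rw [map_one, one_mul, ← mul_pow, mul_one_div_cancel hm', one_pow]
  · refine Finset.sum_congr rfl fun i hi => ?_
    have hi := Finset.mem_range.1 hi
    rw [Polynomial.coeff_map]
    have : (m : ℚ) ^ n = m ^ i * (m * m ^ (n - 1 - i)) := by
      rw [← pow_succ', ← pow_add]; congr 1; omega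
    rw [this]
    simp only [eq_intCast, one_div, inv_pow]
    field_simp

lemma nr_cop (S : Ctx A n) {m : ℕ} (hm : m ≠ 0) {x y z : A} (hy : y ∈ S.M) (hz : z ∈ S.M)
    (h : x * y = 1 + (m : ℚ) • z) {a : ℤ} (ha : S.nr x = a) : IsCoprime a (m : ℤ) := by
  obtain ⟨b, hb⟩ := S.nr_int hy
  obtain ⟨k, hk⟩ := S.nr_one_add hm hz
  rw [← h, map_mul, ha, hb] at hk
  have hk' : a * b = 1 + m * k := by exact_mod_cast hk
  exact ⟨b, -k, by linear_combination hk'⟩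

lemma mem_of_bezout (S : Ctx A n) {x : A} {a b c : ℤ} (ha : (a : ℚ) • x ∈ S.M) (hb : (b : ℚ) • x ∈ S.M)
    {u v : ℤ} (h : u * a + v * b = c) : (c : ℚ) • x ∈ S.M := by
  have : (c : ℚ) • x = (u : ℚ) • ((a : ℚ) • x) + (v : ℚ) • ((b : ℚ) • x) := by
    rw [smul_smul, smul_smul, ← add_smul]; congr 1; exact_mod_cast h.symm
  rw [this]
  exact add_mem (S.smul_mem_M ha _) (S.smul_mem_M hb _)

lemma fix (S : Ctx A n) {m : ℕ} (hm : m ≠ 0) (E : ℕ) : E ≠ 0 → ∀ g : A, S.nr g = 1 → (E : ℚ) • g ∈ S.M →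
    (∀ l : ℕ, (hl : l.Prime) → l ∣ E → ¬ l ∣ m ∧ (have : Fact l.Prime := ⟨hl⟩; Nonempty (A →ₐ[ℚ] Matrix (Fin n) (Fin n) ℚ_[l]))) →
    ∃ γ ∈ S.M, S.nr γ = 1 ∧ ∃ E' : ℕ, E'.Coprime m ∧ ∃ w ∈ S.M, (E' : ℚ) • (γ - g) = (m : ℚ) • w := by
  induction E using Nat.strong_induction_on with
  | _ E ih =>
  intro hE g hg hEg hpr
  by_cases hE1 : E = 1
  · subst hE1
    exact ⟨g, by simpa using hEg, hg, 1, by simp, 0, zero_mem _, by simp⟩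
  obtain ⟨l, hl, hlE⟩ := Nat.exists_prime_and_dvd hE1
  have hF : Fact l.Prime := ⟨hl⟩
  obtain ⟨hlm, ⟨j⟩⟩ := hpr l hl hlE
  obtain ⟨a, E1, hndvd, hEE⟩ := Nat.exists_eq_pow_mul_and_not_dvd hE l hl.ne_one
  have hE10 : E1 ≠ 0 := by rintro rfl; simp at hndvd
  have ha0 : a ≠ 0 := by
    rintro rfl
    apply hndvd; rw [hEE, pow_zero, one_mul] at hlE; exact hlE
  have hlt : E1 < E := by
    rw [hEE]
    have : 1 < l ^ a := Nat.one_lt_pow ha0 hl.one_lt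
    nlinarith [Nat.pos_of_ne_zero hE10]
  obtain ⟨h, ⟨hh1, s, y, hy, hs⟩, D, hD, hDM⟩ := S.SAl (p := l) (m := m * E1) j (mul_ne_zero hm hE10) g hg
  have hnr : S.nr (h * g) = 1 := by rw [map_mul, hh1, hg, one_mul]
  -- difference
  have hdiff : ((l : ℚ) ^ (s + a)) • (h * g - g) = (m : ℚ) • (y * ((E : ℚ) • g)) := by
    have e1 : h * g - g = (h - 1) * g := by noncomm_ring
    have e2 : ((l : ℚ) ^ (s + a)) • ((h - 1) * g) = ((l : ℚ) ^ a) • ((((l : ℚ) ^ s) • (h - 1)) * g) := by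
      rw [smul_mul_assoc, smul_smul, ← pow_add, add_comm a s]
    rw [e1, e2, hs, hEE]
    push_cast
    rw [smul_mul_assoc, mul_smul_comm, smul_smul, smul_smul]
    congr 1; ring
  have hyg : y * ((E : ℚ) • g) ∈ S.M := mul_mem hy hEg
  have hE1M : ((E1 : ℤ) : ℚ) • (h * g) ∈ S.M := by
    have hA : ((E1 * l ^ (s + a) : ℤ) : ℚ) • (h * g) ∈ S.M := by
      have : ((E1 * l ^ (s + a) : ℤ) : ℚ) • (h * g) = (E1 : ℚ) • ((m : ℚ) • (y * ((E : ℚ) • g))) + ((l ^ s : ℕ) : ℚ) • ((E : ℚ) • g) := by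
        rw [← hdiff, hEE, smul_smul, smul_smul, smul_sub]
        push_cast
        rw [pow_add]
        have : (E1 : ℚ) * ((l : ℚ) ^ s * (l : ℚ) ^ a) = (l : ℚ) ^ s * ((l : ℚ) ^ a * E1) := by ring
        rw [this]; abel
      rw [this]
      exact add_mem (S.nsmul_mem_M (S.nsmul_mem_M hyg _) _) (S.nsmul_mem_M hEg _)
    have hB : ((E1 * D : ℤ) : ℚ) • (h * g) ∈ S.M := by
      have := S.nsmul_mem_M hDM E1
      rw [smul_smul] at this; exact_mod_cast this
    have hc : IsCoprime ((l : ℤ) ^ (s + a)) (D : ℤ) :=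
      (Nat.isCoprime_iff_coprime.2 ((Nat.Prime.coprime_iff_not_dvd hl).2 hD)).pow_left
    obtain ⟨u, v, huv⟩ := hc
    exact S.mem_of_bezout hA hB (u := u) (v := v) (by linear_combination (E1 : ℤ) * huv)
  obtain ⟨γ, hγ, hnγ, E', hE'm, w, hw, hEw⟩ := ih E1 hlt hE10 (h * g) hnr (by exact_mod_cast hE1M)
    (fun q hq hqE => hpr q hq (hqE.trans (hEE ▸ dvd_mul_left _ _)))
  refine ⟨γ, hγ, hnγ, E' * l ^ (s + a), ?_, ((l ^ (s + a) : ℕ) : ℚ) • w + (E' : ℚ) • (y * ((E : ℚ) • g)), ?_, ?_⟩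
  · exact hE'm.mul_left (((Nat.Prime.coprime_iff_not_dvd hl).2 hlm).pow_left _)
  · exact add_mem (S.nsmul_mem_M hw _) (S.nsmul_mem_M hyg _)
  · rw [smul_add, smul_comm, ← hEw, smul_comm (m : ℚ), ← hdiff]
    push_cast
    rw [smul_smul, smul_smul, mul_comm ((l : ℚ) ^ (s + a)), ← smul_add]
    congr 1; abel
end Ctx
end SA

namespace SA
namespace Ctx
variable {A : Type} [DivisionRing A] [CharZero A] {n : ℕ}

lemma pow_congr (S : Ctx A n) {m : ℕ} {x w : A} (hx : x ∈ S.M) (hw : w ∈ S.M) (k : ℕ) :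
    ∃ w' ∈ S.M, (x + (m : ℚ) • w) ^ k = x ^ k + (m : ℚ) • w' := by
  induction k with
  | zero => exact ⟨0, zero_mem _, by simp⟩
  | succ k ih =>
    obtain ⟨w', hw', h⟩ := ih
    refine ⟨x ^ k * w + w' * (x + (m : ℚ) • w), add_mem (mul_mem (pow_mem hx _) hw) (mul_mem hw' (add_mem hx (S.nsmul_mem_M hw _))), ?_⟩
    rw [pow_succ, h, pow_succ, add_mul, mul_add, smul_add, mul_smul_comm, smul_mul_assoc, add_assoc]

lemma exists_jl (S : Ctx A n) {x : A} (hli : LinearIndependent ℚ (fun k : Fin n => x ^ (k : ℕ)))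
    {f : Polynomial ℤ} (hf : S.cp x = f.map (Int.castRingHom ℚ)) (a : ℤ) (l : ℕ) (hl : l.Prime)
    (h1 : (l : ℤ) ∣ f.eval a) (h2 : ¬ (l : ℤ) ∣ f.derivative.eval a) :
    have : Fact l.Prime := ⟨hl⟩
    Nonempty (A →ₐ[ℚ] Matrix (Fin n) (Fin n) ℚ_[l]) := by
  intro hF
  have key : ∀ g : Polynomial ℤ, Polynomial.aeval (a : ℤ_[l]) g = ((g.eval a : ℤ) : ℤ_[l]) := by
    intro g
    rw [Polynomial.aeval_def, algebraMap_int_eq, Polynomial.eval₂_at_intCast]; simp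
  have hn2 : ‖Polynomial.aeval (a : ℤ_[l]) f.derivative‖ = 1 := by
    rw [key]
    refine le_antisymm (PadicInt.norm_le_one _) ?_
    by_contra hlt
    push Not at hlt
    exact h2 ((PadicInt.norm_int_lt_one_iff_dvd _).1 hlt)
  have hn1 : ‖Polynomial.aeval (a : ℤ_[l]) f‖ < 1 := by
    rw [key]; exact (PadicInt.norm_int_lt_one_iff_dvd _).2 h1
  obtain ⟨z, hz, -⟩ := hensels_lemma (p := l) (F := f) (a := (a : ℤ_[l])) (by rw [hn2]; simpa using hn1)
  obtain ⟨hmin, -⟩ := S.minpoly_eq x hli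
  refine exists_rep S.n_pos S.finrank_eq x (by rw [hmin, S.cp_natDegree]) (z : ℚ_[l]) ?_
  rw [hmin, hf]
  have h3 := congrArg (PadicInt.Coe.ringHom (p := l)) hz
  rw [map_zero, Polynomial.aeval_def, Polynomial.hom_eval₂] at h3
  rw [Polynomial.aeval_def, Polynomial.eval₂_map]
  rw [← h3]
  congr 1
theorem main (S : Ctx A n) {m : ℕ} (hm : m ≠ 0) {x0 y0 z0 : A} (hx0 : x0 ∈ S.M) (hy0 : y0 ∈ S.M) (hz0 : z0 ∈ S.M)
    (h0 : x0 * y0 = 1 + (m : ℚ) • z0) :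
    ∃ γ ∈ S.M, S.nr γ = 1 ∧ ∃ D : ℤ, IsCoprime D (m : ℤ) ∧ ∃ w ∈ S.M, (D : ℚ) • γ - x0 ^ n = (m : ℚ) • w := by
  classical
  obtain ⟨q, hq0, hqm, hq⟩ : ∃ q : ℕ, q ≠ 0 ∧ m.Coprime q ∧ ∀ l : ℕ, l.Prime → l ≤ n → l ∣ m * q := by
    refine ⟨∏ l ∈ (Finset.range (n+1)).filter (fun l => l.Prime ∧ ¬ l ∣ m), l, ?_, ?_, ?_⟩
    · rw [Finset.prod_ne_zero_iff]
      intro l hl; exact (Finset.mem_filter.1 hl).2.1.ne_zero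
    · refine Nat.Coprime.prod_right fun l hl => ?_
      have := (Finset.mem_filter.1 hl).2
      exact ((Nat.Prime.coprime_iff_not_dvd this.1).2 this.2).symm
    · intro l hl hln
      by_cases hlm : l ∣ m
      · exact hlm.mul_right _
      · exact (Finset.dvd_prod_of_mem _ (Finset.mem_filter.2 ⟨Finset.mem_range.2 (by omega), hl, hlm⟩)).mul_left _
  obtain ⟨u, v, huv⟩ := Nat.isCoprime_iff_coprime.2 hqm
  have hM1 : m * q ≠ 0 := mul_ne_zero hm hq0
  let x1 : A := x0 + (m : ℚ) • ((u : ℚ) • (1 - x0))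
  have h1M : (1 : A) ∈ S.M := one_mem _
  have hx1 : x1 ∈ S.M := add_mem hx0 (S.nsmul_mem_M (S.smul_mem_M (sub_mem h1M hx0) _) _)
  have hx1q : x1 = 1 + (q : ℚ) • ((v : ℚ) • (x0 - 1)) := by
    have e : (v : ℚ) * q = 1 - u * m := by
      have : (u : ℚ) * m + v * q = 1 := by exact_mod_cast huv
      linarith
    simp only [x1]
    rw [smul_smul, smul_smul, mul_comm (q : ℚ), e, mul_comm (m : ℚ), sub_smul, one_smul, smul_sub, smul_sub]
    abel
  have hgen : ∀ w ∈ S.M, ∀ a : ℤ, S.nr (x1 + ((m * q : ℕ) : ℚ) • w) = a → IsCoprime a ((m * q : ℕ) : ℤ) := by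
    intro w hw a ha
    have c1 : IsCoprime a (m : ℤ) := by
      refine S.nr_cop hm hy0 (z := z0 + ((u : ℚ) • (1 - x0) + (q : ℚ) • w) * y0) ?_ ?_ ha
      · exact add_mem hz0 (mul_mem (add_mem (S.smul_mem_M (sub_mem h1M hx0) _) (S.nsmul_mem_M hw _)) hy0)
      · simp only [x1]
        push_cast
        rw [add_mul, add_mul, h0, smul_add, add_mul, smul_add, mul_smul, smul_mul_assoc, smul_mul_assoc, smul_mul_assoc]
        abel
    have c2 : IsCoprime a (q : ℤ) := by
      refine S.nr_cop hq0 h1M (z := (v : ℚ) • (x0 - 1) + (m : ℚ) • w) ?_ ?_ ha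
      · exact add_mem (S.smul_mem_M (sub_mem hx0 h1M) _) (S.nsmul_mem_M hw _)
      · rw [hx1q, mul_one]
        push_cast
        rw [mul_comm (m : ℚ), mul_smul, smul_add, add_assoc]
    push_cast
    exact c1.mul_right c2
  obtain ⟨y, hy, hli⟩ := S.krylov x1 (m * q) hM1
  let x2 : A := x1 + ((m * q : ℕ) : ℚ) • y
  have hx2 : x2 ∈ S.M := add_mem hx1 (S.nsmul_mem_M hy _)
  obtain ⟨f, hfm, hfd, hf⟩ := S.cp_int hx2
  have heval : ∀ c : ℤ, S.nr (x2 - (c : ℚ) • 1) = (((-1) ^ n * f.eval c : ℤ) : ℚ) := by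
    intro c
    have : x2 - (c : ℚ) • 1 = (-1 : ℚ) • ((c : ℚ) • 1 - x2) := by simp
    rw [this, S.nr_smul, S.nr_sub, hf, Polynomial.eval_intCast_map]
    push_cast; simp
  have hirr := (S.minpoly_eq x2 hli).2
  rw [hf] at hirr
  have hcop : IsCoprime (f.coeff 0) ((m * q : ℕ) : ℤ) := by
    have e := heval 0
    rw [Int.cast_zero, zero_smul, sub_zero, ← Polynomial.coeff_zero_eq_eval_zero] at e
    have := hgen y hy _ e
    exact this.of_mul_left_right
  obtain ⟨t, ht⟩ := pick_t f hfm hfd (m * q) hcop hq hirr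
  let c : ℤ := -(((m * q : ℕ) : ℤ) * t)
  let d : ℤ := (-1) ^ n * f.eval c
  let x3 : A := x2 - (c : ℚ) • 1
  have hx3 : x3 ∈ S.M := sub_mem hx2 (S.smul_mem_M h1M _)
  have hd : S.nr x3 = d := heval c
  have hx31 : x3 = x1 + ((m * q : ℕ) : ℚ) • (y + (t : ℚ) • 1) := by
    simp only [x3, x2, c]
    push_cast
    rw [smul_add, neg_smul, sub_neg_eq_add, mul_smul _ (t : ℚ), add_assoc]
  have hdc : IsCoprime d ((m * q : ℕ) : ℤ) :=
    hgen (y + (t : ℚ) • 1) (add_mem hy (S.nsmul_mem_M h1M _)) d (hx31 ▸ hd)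
  have hd0 : d ≠ 0 := by
    intro h
    rw [h, isCoprime_zero_left, Int.isUnit_iff_natAbs_eq, Int.natAbs_natCast] at hdc
    have := hq 2 Nat.prime_two S.hn
    rw [hdc] at this
    omega
  have hd0' : (d : ℚ) ≠ 0 := by exact_mod_cast hd0
  let g : A := (d : ℚ)⁻¹ • x3 ^ n
  have hg : S.nr g = 1 := by
    simp only [g]
    rw [S.nr_smul, map_pow, hd, ← mul_pow, inv_mul_cancel₀ hd0', one_pow]
  have hdg : (d : ℚ) • g = x3 ^ n := by
    simp only [g]; rw [smul_smul, mul_inv_cancel₀ hd0', one_smul]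
  have hEg : ((d.natAbs : ℕ) : ℚ) • g ∈ S.M := by
    have : ((d.natAbs : ℕ) : ℚ) = ((d.sign : ℤ) : ℚ) * d := by
      rw [← Int.cast_mul, ← Int.cast_natCast (R := ℚ), Int.sign_mul_self_eq_natAbs]
    rw [this, mul_smul, hdg]
    exact S.smul_mem_M (pow_mem hx3 _) _
  obtain ⟨γ, hγ, hnγ, E', hE', w, hw, hEw⟩ := S.fix hM1 d.natAbs (by simpa using hd0) g hg hEg (by
    intro l hl hld
    have h1 : (l : ℤ) ∣ f.eval c := by
      have h2 : (l : ℤ) ∣ (-1) ^ n * f.eval c := Int.natCast_dvd.2 hld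
      rcases neg_one_pow_eq_or ℤ n with h | h <;> rw [h] at h2
      · simpa using h2
      · simpa using h2
    obtain ⟨h3, h4⟩ := ht l hl h1
    exact ⟨h3, S.exists_jl hli hf c l hl h1 h4⟩)
  refine ⟨γ, hγ, hnγ, d, ?_, ?_⟩
  · push_cast at hdc; exact hdc.of_mul_right_left
  obtain ⟨w4, hw4, e4⟩ := S.pow_congr (m := m) hx0 (w := (u : ℚ) • (1 - x0) + (q : ℚ) • (y + (t : ℚ) • 1))
    (add_mem (S.smul_mem_M (sub_mem h1M hx0) _) (S.nsmul_mem_M (add_mem hy (S.nsmul_mem_M h1M _)) _)) n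
  have e5 : x3 = x0 + (m : ℚ) • ((u : ℚ) • (1 - x0) + (q : ℚ) • (y + (t : ℚ) • 1)) := by
    rw [hx31]; simp only [x1]; push_cast
    rw [mul_smul, smul_add (m : ℚ), add_assoc]
  rw [← e5] at e4
  have hr : (d : ℚ) • γ - x3 ^ n ∈ S.M := sub_mem (S.smul_mem_M hγ _) (pow_mem hx3 _)
  have hEr : (E' : ℚ) • ((d : ℚ) • γ - x3 ^ n) = ((m * q : ℕ) : ℚ) • ((d : ℚ) • w) := by
    rw [← hdg, ← smul_sub, smul_comm, hEw, smul_comm]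
  obtain ⟨a, b, hab⟩ := Nat.isCoprime_iff_coprime.2 hE'
  have hab' : (a : ℚ) * E' + b * ((m * q : ℕ) : ℚ) = 1 := by exact_mod_cast hab
  have e6 : (d : ℚ) • γ - x3 ^ n = (m : ℚ) • ((q : ℚ) • ((a : ℚ) • ((d : ℚ) • w) + (b : ℚ) • ((d : ℚ) • γ - x3 ^ n))) := by
    calc (d : ℚ) • γ - x3 ^ n = ((a : ℚ) * E' + b * ((m * q : ℕ) : ℚ)) • ((d : ℚ) • γ - x3 ^ n) := by rw [hab', one_smul]
      _ = (a : ℚ) • ((E' : ℚ) • ((d : ℚ) • γ - x3 ^ n)) + (b : ℚ) • (((m * q : ℕ) : ℚ) • ((d : ℚ) • γ - x3 ^ n)) := by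
        rw [add_smul, mul_smul, mul_smul]
      _ = _ := by
        rw [hEr, smul_comm (a : ℚ), smul_comm (b : ℚ), ← smul_add, ← mul_smul (m : ℚ) (q : ℚ)]; push_cast; rfl
  refine ⟨(q : ℚ) • ((a : ℚ) • ((d : ℚ) • w) + (b : ℚ) • ((d : ℚ) • γ - x3 ^ n)) + w4, ?_, ?_⟩
  · exact add_mem (S.nsmul_mem_M (add_mem (S.smul_mem_M (S.smul_mem_M hw _) _) (S.smul_mem_M hr _)) _) hw4
  · rw [smul_add, ← e6, e4]; abel
end Ctx
end SA

namespace SA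

/-- the additive group is generated by `d` elements -/
def Gen (d : ℕ) (R : Type) [AddCommGroup R] : Prop := ∃ g : Fin d → R, ∀ x, ∃ z : Fin d → ℤ, x = ∑ i, z i • g i

lemma Gen.map {d : ℕ} {R R' : Type} [AddCommGroup R] [AddCommGroup R'] (h : Gen d R) (f : R →+ R') (hf : Function.Surjective f) :
    Gen d R' := by
  obtain ⟨g, hg⟩ := h
  refine ⟨fun i => f (g i), fun x => ?_⟩
  obtain ⟨y, rfl⟩ := hf x
  obtain ⟨z, hz⟩ := hg y
  exact ⟨z, by rw [hz]; simp⟩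

lemma Gen.card {d : ℕ} {R : Type} [AddCommGroup R] (h : Gen d R) {k : ℕ} (hk : 0 < k) (h0 : ∀ x : R, (k : ℤ) • x = 0) :
    Nat.card R ≤ k ^ d := by
  obtain ⟨g, hg⟩ := h
  have : NeZero k := ⟨hk.ne'⟩
  let F : (Fin d → ZMod k) → R := fun z => ∑ i, ((z i).val : ℤ) • g i
  have hF : Function.Surjective F := by
    intro x
    obtain ⟨z, hz⟩ := hg x
    refine ⟨fun i => (z i : ZMod k), ?_⟩
    rw [hz]
    refine Finset.sum_congr rfl fun i _ => ?_
    rw [ZMod.val_intCast]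
    conv_rhs => rw [← Int.emod_add_mul_ediv (z i) k, add_smul, mul_smul, h0, add_zero]
  have := Nat.card_le_card_of_surjective F hF
  simpa using this

lemma twoSided {R : Type} [Ring R] (a : ℕ) : (Ideal.span {(a : R)}).IsTwoSided := by
  refine ⟨fun {x} y hx => ?_⟩
  obtain ⟨c, rfl⟩ := Ideal.mem_span_singleton'.1 hx
  rw [mul_assoc, (Nat.cast_commute a y).eq, ← mul_assoc]
  exact Ideal.mul_mem_left _ _ (Ideal.mem_span_singleton_self _)

lemma split {R : Type} [Ring R] [Finite R] {d a b : ℕ} (hg : Gen d R) (hab : a.Coprime b) (h0 : ((a * b : ℕ) : R) = 0) :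
    ∃ (R1 R2 : Type) (_ : Ring R1) (_ : Ring R2) (_ : Finite R1) (_ : Finite R2), Gen d R1 ∧ Gen d R2 ∧ (a : R1) = 0 ∧ (b : R2) = 0 ∧
      Nonempty (R ≃+* R1 × R2) := by
  have i1 := twoSided (R := R) a
  have i2 := twoSided (R := R) b
  let f1 := Ideal.Quotient.mk (Ideal.span {(a : R)})
  let f2 := Ideal.Quotient.mk (Ideal.span {(b : R)})
  have s1 : Function.Surjective f1 := Ideal.Quotient.mk_surjective
  have s2 : Function.Surjective f2 := Ideal.Quotient.mk_surjective
  have ha : f1 (a : R) = 0 := Ideal.Quotient.eq_zero_iff_mem.2 (Ideal.mem_span_singleton_self _)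
  have hb : f2 (b : R) = 0 := Ideal.Quotient.eq_zero_iff_mem.2 (Ideal.mem_span_singleton_self _)
  obtain ⟨u, v, huv⟩ := Nat.isCoprime_iff_coprime.2 hab
  have huv' : (u : R) * a + v * b = 1 := by exact_mod_cast congrArg (Int.cast : ℤ → R) huv
  refine ⟨R ⧸ Ideal.span {(a : R)}, R ⧸ Ideal.span {(b : R)}, inferInstance, inferInstance, Finite.of_surjective _ s1, Finite.of_surjective _ s2,
    hg.map f1.toAddMonoidHom s1, hg.map f2.toAddMonoidHom s2, ?_, ?_, ⟨RingEquiv.ofBijective (f1.prod f2) ⟨?_, ?_⟩⟩⟩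
  · rw [← ha, map_natCast]
  · rw [← hb, map_natCast]
  · rw [injective_iff_map_eq_zero]
    intro x hx
    rw [RingHom.prod_apply, Prod.mk_eq_zero] at hx
    obtain ⟨c1, h1⟩ := Ideal.mem_span_singleton'.1 (Ideal.Quotient.eq_zero_iff_mem.1 hx.1)
    obtain ⟨c2, h2⟩ := Ideal.mem_span_singleton'.1 (Ideal.Quotient.eq_zero_iff_mem.1 hx.2)
    have h0' : (a : R) * b = 0 := by exact_mod_cast h0
    have h0'' : (b : R) * a = 0 := by rw [(Nat.cast_commute b (a : R)).eq, h0']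
    calc x = ((u : R) * a + v * b) * x := by rw [huv', one_mul]
      _ = u * (a * x) + v * (b * x) := by rw [add_mul, mul_assoc, mul_assoc]
      _ = u * (a * (c2 * b)) + v * (b * (c1 * a)) := by rw [h1, h2]
      _ = 0 := by
        rw [← (Nat.cast_commute b c2).eq, ← mul_assoc (a : R), h0', ← (Nat.cast_commute a c1).eq, ← mul_assoc (b : R), h0'']
        simp
  · rintro ⟨y1, y2⟩
    obtain ⟨x1, rfl⟩ := s1 y1
    obtain ⟨x2, rfl⟩ := s2 y2
    refine ⟨v * b * x1 + u * a * x2, ?_⟩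
    rw [RingHom.prod_apply]
    have e1 : f1 (u : R) * f1 a + f1 v * f1 b = 1 := by rw [← map_mul, ← map_mul, ← map_add, huv', map_one]
    have e2 : f2 (u : R) * f2 a + f2 v * f2 b = 1 := by rw [← map_mul, ← map_mul, ← map_add, huv', map_one]
    rw [ha, mul_zero, zero_add] at e1
    rw [hb, mul_zero, add_zero] at e2
    refine Prod.ext ?_ ?_
    · simp only [map_add, map_mul]
      rw [e1, ha]; simp
    · simp only [map_add, map_mul]
      rw [e2, hb]; simp

/-- master statement for a ring -/
def Big (n c : ℕ) (R : Type) [Ring R] : Prop := ∀ P : Subgroup Rˣ, (∀ u, u ^ n ∈ P) → Nat.card R ≤ c * Nat.card P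

lemma Big.mono {n c c' : ℕ} {R : Type} [Ring R] (h : Big n c R) (hc : c ≤ c') : Big n c' R :=
  fun P hP => (h P hP).trans (Nat.mul_le_mul_right _ hc)

lemma Big.prod {n c1 c2 : ℕ} {R R1 R2 : Type} [Ring R] [Ring R1] [Ring R2] [Finite R] (e : R ≃+* R1 × R2) (h1 : Big n c1 R1)
    (h2 : Big n c2 R2) : Big n (c1 * c2) R := by
  intro P hP
  let E : R1ˣ × R2ˣ →* Rˣ := (Units.map e.symm.toRingHom.toMonoidHom).comp MulEquiv.prodUnits.symm.toMonoidHom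
  have hE : Function.Injective E := by
    refine (Units.map_injective e.symm.injective).comp MulEquiv.prodUnits.symm.injective
  let P1 : Subgroup R1ˣ := P.comap (E.comp (MonoidHom.inl _ _))
  let P2 : Subgroup R2ˣ := P.comap (E.comp (MonoidHom.inr _ _))
  have k1 := h1 P1 (fun u => by simp only [P1, Subgroup.mem_comap]; rw [map_pow]; exact hP _)
  have k2 := h2 P2 (fun u => by simp only [P2, Subgroup.mem_comap]; rw [map_pow]; exact hP _)
  have hcard : Nat.card P1 * Nat.card P2 ≤ Nat.card P := by
    rw [← Nat.card_prod]
    refine Nat.card_le_card_of_injective (fun q : P1 × P2 => (⟨E (q.1, q.2), ?_⟩ : P)) ?_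
    · have : ((q.1 : R1ˣ), (q.2 : R2ˣ)) = MonoidHom.inl _ _ (q.1 : R1ˣ) * MonoidHom.inr _ _ (q.2 : R2ˣ) := by simp
      rw [this, map_mul]
      exact mul_mem q.1.2 q.2.2
    · intro q q' hq
      have := hE (congrArg Subtype.val hq)
      rw [Prod.mk.injEq] at this
      exact Prod.ext (Subtype.ext this.1) (Subtype.ext this.2)
  rw [Nat.card_congr e.toEquiv, Nat.card_prod]
  calc _ ≤ (c1 * Nat.card P1) * (c2 * Nat.card P2) := Nat.mul_le_mul k1 k2
    _ = c1 * c2 * (Nat.card P1 * Nat.card P2) := by ring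
    _ ≤ _ := Nat.mul_le_mul_left _ hcard

theorem big_of_pp {n c d : ℕ} 
    (hpp : ∀ p k : ℕ, p.Prime → 0 < k → ∀ (R : Type) [Ring R] [Finite R], Gen d R → ((p ^ k : ℕ) : R) = 0 → Big n c R)
    (N : ℕ) (hN : 0 < N) : ∀ (R : Type) [Ring R] [Finite R], Gen d R → (N : R) = 0 → Big n (c ^ N.primeFactors.card) R := by
  induction N using Nat.recOnPosPrimePosCoprime with
  | prime_pow p k hp hk =>
    intro R _ _ hg h0
    rw [Nat.primeFactors_prime_pow hk.ne' hp]
    simpa using hpp p k hp hk R hg h0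
  | zero => omega
  | one =>
    intro R _ _ hg h0 P hP
    have : Subsingleton R := subsingleton_of_zero_eq_one (by simpa using h0.symm)
    have h1 : Nat.card R = 1 := Nat.card_of_subsingleton 0
    have h2 : 0 < Nat.card P := Nat.card_pos
    rw [h1]; simp only [Nat.primeFactors_one, Finset.card_empty, pow_zero, one_mul]; omega
  | coprime a b ha hb hab iha ihb =>
    intro R _ _ hg h0
    obtain ⟨R1, R2, _, _, _, _, g1, g2, h1, h2, ⟨e⟩⟩ := split hg hab h0
    have := Big.prod e (iha (by omega) R1 g1 h1) (ihb (by omega) R2 g2 h2)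
    rw [← pow_add] at this
    rw [hab.primeFactors_mul, Finset.card_union_of_disjoint hab.disjoint_primeFactors]
    exact this
end SA

namespace SA

lemma one_add_pow_exp {R : Type} [Ring R] (a : R) (n : ℕ) : ∃ b, (1 + a) ^ n = 1 + n * a + a ^ 2 * b := by
  induction n with
  | zero => exact ⟨0, by simp⟩
  | succ n ih =>
    obtain ⟨b, hb⟩ := ih
    refine ⟨n + b + b * a, ?_⟩
    rw [pow_succ, hb]
    have : (a ^ 2 * (n : R)) = n * a * a := by rw [← (Nat.cast_commute n (a ^ 2)).eq, mul_assoc, pow_two]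
    rw [mul_add (a ^ 2), mul_add (a ^ 2), this]
    push_cast
    noncomm_ring

lemma unit_one_add {R : Type} [Ring R] {p k : ℕ} (h0 : ((p ^ k : ℕ) : R) = 0) {i : ℕ} (hi : 0 < i) (y : R) :
    ∃ U : Rˣ, (U : R) = 1 + (p : R) ^ i * y := by
  have hnil : IsNilpotent ((p : R) ^ i * y) := by
    refine ⟨k, ?_⟩
    have hc : Commute ((p : R) ^ i) y := (Nat.cast_commute p y).pow_left i
    rw [hc.mul_pow, ← pow_mul, mul_comm i k, pow_mul, ← Nat.cast_pow, h0, zero_pow hi.ne', zero_mul]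
  obtain ⟨U, hU⟩ := hnil.isUnit_one_add
  exact ⟨U, hU⟩

lemma one_add_mem {R : Type} [Ring R] {p k v n' n : ℕ} (hp : p.Prime) (h0 : ((p ^ k : ℕ) : R) = 0) (hn : n = p ^ v * n')
    (hn' : ¬ p ∣ n') (P : Subgroup Rˣ) (hP : ∀ u, u ^ n ∈ P) :
    ∀ j i : ℕ, k ≤ i + j → 2 * v + 1 ≤ i → ∀ (y : R) (U : Rˣ), (U : R) = 1 + (p : R) ^ i * y → U ∈ P := by
  intro j
  induction j with
  | zero =>
    intro i hi _ y U hU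
    have : (p : R) ^ i = 0 := by
      obtain ⟨m, rfl⟩ := Nat.exists_eq_add_of_le (show k ≤ i by omega)
      rw [pow_add, ← Nat.cast_pow, h0, zero_mul]
    rw [this, zero_mul, add_zero] at hU
    have : U = 1 := Units.ext hU
    rw [this]; exact one_mem _
  | succ j ih =>
    intro i hi hv y U hU
    have hcop : IsCoprime (n' : ℤ) (p : ℤ) := Nat.isCoprime_iff_coprime.2 ((Nat.Prime.coprime_iff_not_dvd hp).2 hn').symm
    obtain ⟨u, m, hum⟩ := hcop
    have hum' : (n' : R) * u = 1 - p * m := by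
      have : (n' : ℤ) * u = 1 - p * m := by linarith
      exact_mod_cast congrArg (Int.cast : ℤ → R) this
    obtain ⟨e, rfl⟩ := Nat.exists_eq_add_of_le hv
    have cp : ∀ (j : ℕ) (x : R), x * (p : R) ^ j = (p : R) ^ j * x := fun j x => ((Nat.cast_commute p x).pow_left j).eq.symm
    obtain ⟨W, hW⟩ := unit_one_add h0 (show 0 < v + 1 + e by omega) ((u : R) * y)
    obtain ⟨b, hb⟩ := one_add_pow_exp ((p : R) ^ (v + 1 + e) * ((u : R) * y)) n
    have hX : ((W ^ n : Rˣ) : R) = 1 + (p : R) ^ (2 * v + 1 + e) * y + (p : R) ^ (2 * v + 1 + e + 1) * (-(m * y) + (p : R) ^ e * (u * y * (u * y)) * b) := by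
      rw [Units.val_pow_eq_pow_val, hW, hb]
      have e1 : (n : R) * ((p : R) ^ (v + 1 + e) * ((u : R) * y)) = (p : R) ^ (2 * v + 1 + e) * y + (p : R) ^ (2 * v + 1 + e + 1) * (-(m * y)) := by
        rw [hn]; push_cast
        calc (p : R) ^ v * (n' : R) * ((p : R) ^ (v + 1 + e) * ((u : R) * y)) = (p : R) ^ v * ((n' : R) * (p : R) ^ (v + 1 + e)) * ((u : R) * y) := by noncomm_ring
          _ = (p : R) ^ v * (p : R) ^ (v + 1 + e) * ((n' : R) * (u : R) * y) := by rw [cp]; noncomm_ring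
          _ = (p : R) ^ (2 * v + 1 + e) * ((1 - p * m) * y) := by rw [hum', ← pow_add]; congr 2; omega
          _ = _ := by rw [pow_succ (p : R) (2 * v + 1 + e)]; noncomm_ring
      have e2 : ((p : R) ^ (v + 1 + e) * ((u : R) * y)) ^ 2 = (p : R) ^ (2 * v + 1 + e + 1) * ((p : R) ^ e * (u * y * (u * y))) := by
        generalize (u : R) * y = q
        calc ((p : R) ^ (v + 1 + e) * q) ^ 2 = (p : R) ^ (v + 1 + e) * (q * (p : R) ^ (v + 1 + e)) * q := by noncomm_ring
          _ = ((p : R) ^ (v + 1 + e) * (p : R) ^ (v + 1 + e)) * (q * q) := by rw [cp]; noncomm_ring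
          _ = ((p : R) ^ (2 * v + 1 + e + 1) * (p : R) ^ e) * (q * q) := by rw [← pow_add, ← pow_add]; congr 2; omega
          _ = _ := by rw [mul_assoc]
      rw [e1, e2]
      noncomm_ring
    generalize hz : (-(m * y) + (p : R) ^ e * (u * y * (u * y)) * b) = z at hX
    have hXm := hP W
    have hU' : U * (W ^ n)⁻¹ ∈ P := by
      refine ih (2 * v + 1 + e + 1) (by omega) (by omega) (-(z * ((W ^ n)⁻¹ : Rˣ))) _ ?_
      have : (U : R) = ((W ^ n : Rˣ) : R) - (p : R) ^ (2 * v + 1 + e + 1) * z := by rw [hX, hU]; abel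
      rw [Units.val_mul, this, sub_mul, Units.mul_inv, mul_neg, sub_eq_add_neg, mul_assoc]
    have := mul_mem hU' hXm
    rwa [inv_mul_cancel_right] at this

lemma small_p {R : Type} [Ring R] [Finite R] {p k d n T : ℕ} (hp : p.Prime) (h0 : ((p ^ k : ℕ) : R) = 0) (hn : n ≠ 0)
    (hg : Gen d R) (hpT : p ≤ T) (hnT : n ≤ T) : Big n (T ^ (3 * d)) R := by
  intro P hP
  obtain ⟨v, n', hn', hnn⟩ := Nat.exists_eq_pow_mul_and_not_dvd hn p hp.ne_one
  have key := one_add_mem hp h0 hnn hn' P hP k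
  let w := 2 * v + 1
  let H : AddSubgroup R := (AddMonoidHom.mulLeft ((p : R) ^ w)).range
  have hH : Nat.card H ≤ Nat.card P := by
    have hu : ∀ x : H, ∃ U : P, ((U : Rˣ) : R) = 1 + x := by
      rintro ⟨x, y, rfl⟩
      obtain ⟨U, hU⟩ := unit_one_add h0 (show 0 < w by omega) y
      exact ⟨⟨U, key w (by omega) le_rfl y U hU⟩, hU⟩
    choose f hf using hu
    refine Nat.card_le_card_of_injective f fun x y hxy => ?_
    have h1 := hf x
    rw [hxy, hf y] at h1
    exact Subtype.ext (add_left_cancel h1).symm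
  have hq : Nat.card (R ⧸ H) ≤ (p ^ w) ^ d := by
    refine (hg.map (QuotientAddGroup.mk' H) (QuotientAddGroup.mk'_surjective H)).card (by have := hp.pos; positivity) ?_
    intro x
    obtain ⟨x, rfl⟩ := QuotientAddGroup.mk'_surjective H x
    rw [← map_zsmul]
    refine (QuotientAddGroup.eq_zero_iff _).2 ⟨x, ?_⟩
    simp
  have hw : p ^ w ≤ T ^ 3 := by
    have : p ^ v ≤ n := Nat.le_of_dvd (Nat.pos_of_ne_zero hn) ⟨n', hnn⟩
    calc p ^ w = p ^ v * p ^ v * p := by simp only [w]; ring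
      _ ≤ T * T * T := by gcongr <;> omega
      _ = T ^ 3 := by ring
  rw [AddSubgroup.card_eq_card_quotient_mul_card_addSubgroup H]
  refine Nat.mul_le_mul ?_ hH
  rw [pow_mul]
  exact hq.trans (Nat.pow_le_pow_left hw d)
end SA

namespace SA

lemma card_max {B : Type} [CommRing B] [Finite B] {p d : ℕ} (hp : p.Prime) (h0 : (p : B) = 0) (hB : Nat.card B ≤ p ^ d) :
    Nat.card (MaximalSpectrum B) ≤ d := by
  classical
  have hfin : Finite (MaximalSpectrum B) := inferInstance
  have := Fintype.ofFinite (MaximalSpectrum B)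
  let e := Ideal.quotientInfRingEquivPiQuotient (fun I : MaximalSpectrum B => I.asIdeal) fun I J h => I.isCoprime_of_ne h
  have h1 : Nat.card (∀ I : MaximalSpectrum B, B ⧸ I.asIdeal) ≤ p ^ d := by
    rw [← Nat.card_congr e.toEquiv]
    exact (Nat.card_le_card_of_surjective _ Ideal.Quotient.mk_surjective).trans hB
  rw [Nat.card_pi] at h1
  have h2 : ∀ I : MaximalSpectrum B, p ≤ Nat.card (B ⧸ I.asIdeal) := by
    intro I
    have := I.isMaximal
    have : Nontrivial (B ⧸ I.asIdeal) := Ideal.Quotient.nontrivial_iff.2 this.ne_top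
    have hz : ((p : ℕ) : B ⧸ I.asIdeal) = 0 := by
      rw [← map_natCast (Ideal.Quotient.mk I.asIdeal), h0, map_zero]
    have : CharP (B ⧸ I.asIdeal) p := (CharP.charP_iff_prime_eq_zero hp).2 hz
    have : Fact p.Prime := ⟨hp⟩
    have : Finite (B ⧸ I.asIdeal) := Finite.of_surjective _ (Ideal.Quotient.mk_surjective (I := I.asIdeal))
    have := Nat.card_le_card_of_injective _ (ZMod.castHom_injective (n := p) (B ⧸ I.asIdeal))
    simpa using this
  have h3 : p ^ Nat.card (MaximalSpectrum B) ≤ p ^ d := by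
    refine le_trans ?_ h1
    rw [Nat.card_eq_fintype_card]
    simpa using Finset.prod_le_prod' (s := Finset.univ) fun I _ => h2 I
  exact (Nat.pow_le_pow_iff_right hp.one_lt).1 h3

lemma card_tors {B : Type} [CommRing B] [Finite B] {n d : ℕ} (hn : IsUnit (n : B)) (hn0 : 0 < n) (hB : Nat.card (MaximalSpectrum B) ≤ d) :
    Nat.card (powMonoidHom n : Bˣ →* Bˣ).ker ≤ n ^ d := by
  classical
  have hfin : Finite (MaximalSpectrum B) := inferInstance
  have := Fintype.ofFinite (MaximalSpectrum B)
  have hnz : NeZero n := ⟨hn0.ne'⟩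
  let f : (powMonoidHom n : Bˣ →* Bˣ).ker → ∀ I : MaximalSpectrum B, rootsOfUnity n (B ⧸ I.asIdeal) := fun w I =>
    ⟨Units.map (Ideal.Quotient.mk I.asIdeal).toMonoidHom w, by
      rw [mem_rootsOfUnity, ← map_pow]
      have := w.2
      rw [MonoidHom.mem_ker, powMonoidHom_apply] at this
      rw [this, map_one]⟩
  have hf : Function.Injective f := by
    intro w w' h
    obtain ⟨w, hw⟩ := w
    obtain ⟨w', hw'⟩ := w'
    rw [MonoidHom.mem_ker, powMonoidHom_apply] at hw hw'
    have hr : (w'⁻¹ * w) ^ n = 1 := by rw [mul_pow, inv_pow, hw, hw']; simp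
    have hnil : IsNilpotent (((w'⁻¹ * w : Bˣ) : B) - 1) := by
      rw [← mem_nilradical, IsArtinianRing.nilradical_eq_iInf, Ideal.mem_iInf]
      intro I
      have h1 : Ideal.Quotient.mk I.asIdeal (w : B) = Ideal.Quotient.mk I.asIdeal (w' : B) :=
        congrArg (fun q => ((q : (B ⧸ I.asIdeal)ˣ) : B ⧸ I.asIdeal)) (congrArg Subtype.val (congrFun h I))
      have h2 := Ideal.Quotient.eq.1 h1
      have : ((w'⁻¹ * w : Bˣ) : B) - 1 = ((w'⁻¹ : Bˣ) : B) * ((w : B) - w') := by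
        rw [mul_sub, Units.inv_mul, Units.val_mul]
      rw [this]
      exact Ideal.mul_mem_left _ _ h2
    obtain ⟨b, hb⟩ := one_add_pow_exp (((w'⁻¹ * w : Bˣ) : B) - 1) n
    rw [add_sub_cancel, ← Units.val_pow_eq_pow_val, hr, Units.val_one] at hb
    generalize hα : ((w'⁻¹ * w : Bˣ) : B) - 1 = a at *
    have hu : IsUnit ((n : B) + a * b) := by
      exact IsNilpotent.isUnit_add_left_of_commute ((Commute.all a b).isNilpotent_mul_right hnil) hn (Commute.all _ _)
    have ha : a = 0 := by
      have : a * ((n : B) + a * b) = 0 := by linear_combination -hb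
      exact (hu.mul_left_eq_zero).1 this
    rw [ha, sub_eq_zero] at hα
    have : w'⁻¹ * w = 1 := Units.ext hα
    exact Subtype.ext (inv_mul_eq_one.1 this).symm
  have h1 := Nat.card_le_card_of_injective f hf
  rw [Nat.card_pi] at h1
  have h2 : ∀ I : MaximalSpectrum B, Nat.card (rootsOfUnity n (B ⧸ I.asIdeal)) ≤ n := by
    intro I
    have := I.isMaximal
    have : IsDomain (B ⧸ I.asIdeal) := inferInstance
    exact card_rootsOfUnity _ _
  refine h1.trans ((Finset.prod_le_prod' (s := Finset.univ) fun I _ => h2 I).trans ?_)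
  rw [Finset.prod_const, Finset.card_univ, ← Nat.card_eq_fintype_card]
  exact Nat.pow_le_pow_right hn0 hB

lemma line_comm {B : Type} [CommRing B] [Finite B] {p d n T : ℕ} (hp : p.Prime) (h0 : (p : B) = 0) (hB : Nat.card B ≤ p ^ d)
    (hn0 : 0 < n) (hnp : n < p) (hT : T = n ^ d + d + 1) (hTp : T ≤ p) (z : B) :
    ∃ s t : ℕ, s < T ∧ t < T ∧ s ≠ t ∧ ∃ U V W : Bˣ, (U : B) = z + s ∧ (V : B) = z + t ∧ V = U * W ^ n := by
  classical
  have hun : ∀ m : ℕ, 0 < m → m < p → IsUnit (m : B) := by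
    intro m hm hmp
    have hcop : IsCoprime (m : ℤ) (p : ℤ) := Nat.isCoprime_iff_coprime.2 (Nat.Coprime.symm (Nat.coprime_of_lt_prime hm.ne' hmp hp))
    obtain ⟨u, w, h⟩ := hcop
    have h' : (u : B) * m + w * p = 1 := by exact_mod_cast congrArg (Int.cast : ℤ → B) h
    rw [h0, mul_zero, add_zero] at h'
    exact IsUnit.of_mul_eq_one_right _ h'
  have hmax := card_max hp h0 hB
  have htor := card_tors (hun n hn0 hnp) hn0 hmax
  have hfin : Finite (MaximalSpectrum B) := inferInstance
  have := Fintype.ofFinite (MaximalSpectrum B)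
  let G := (Finset.range T).filter fun t : ℕ => IsUnit (z + (t : B))
  let Bd := (Finset.range T).filter fun t : ℕ => ¬ IsUnit (z + (t : B))
  have hBd : Bd.card ≤ d := by
    refine le_trans ?_ hmax
    rw [Nat.card_eq_fintype_card, ← Finset.card_univ]
    have hex : ∀ t : ℕ, ¬ IsUnit (z + (t : B)) → ∃ I : MaximalSpectrum B, z + (t : B) ∈ I.asIdeal := by
      intro t ht
      obtain ⟨I, hI, hm⟩ := exists_max_ideal_of_mem_nonunits ht
      exact ⟨⟨I, hI⟩, hm⟩
    by_cases hne : Nonempty (MaximalSpectrum B)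
    swap
    · have : Bd = ∅ := by
        refine Finset.filter_eq_empty_iff.2 fun t _ ht => ?_
        obtain ⟨I, -⟩ := hex t ht
        exact hne ⟨I⟩
      simp [this]
    choose! f hf using hex
    have hlt : ∀ s t : ℕ, s < t → t < T → ∀ I : MaximalSpectrum B, z + (s : B) ∈ I.asIdeal → z + (t : B) ∈ I.asIdeal → False := by
      intro s t hst ht I hs' ht'
      have h1 : ((t - s : ℕ) : B) ∈ I.asIdeal := by
        have := I.asIdeal.sub_mem ht' hs'
        rw [add_sub_add_left_eq_sub] at this
        rwa [Nat.cast_sub hst.le]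
      exact I.isMaximal.ne_top (Ideal.eq_top_of_isUnit_mem _ h1 (hun _ (by omega) (by omega)))
    refine Finset.card_le_card_of_injOn f (fun _ _ => Finset.mem_coe.2 (Finset.mem_univ _)) ?_
    intro s hs t ht hst
    simp only [Bd, Finset.coe_filter, Set.mem_ofPred_eq, Finset.mem_range] at hs ht
    by_contra hne
    rcases lt_or_gt_of_ne hne with h | h
    · exact hlt s t h ht.1 (f s) (hf s hs.2) (hst ▸ hf t ht.2)
    · exact hlt t s h hs.1 (f s) (hst ▸ hf t ht.2) (hf s hs.2)
  have hG : n ^ d < G.card := by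
    have : G.card + Bd.card = (Finset.range T).card := Finset.card_filter_add_card_filter_not _
    rw [Finset.card_range] at this
    omega
  let Q := Bˣ ⧸ (powMonoidHom n : Bˣ →* Bˣ).range
  have := Fintype.ofFinite Q
  have hQ : Fintype.card Q ≤ n ^ d := by
    refine le_trans (le_of_eq ?_) htor
    rw [← Nat.card_eq_fintype_card]
    change (powMonoidHom n : Bˣ →* Bˣ).range.index = _
    have h1 := Subgroup.card_mul_index (powMonoidHom n : Bˣ →* Bˣ).range
    have h2 := Subgroup.card_mul_index (powMonoidHom n : Bˣ →* Bˣ).ker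
    rw [Subgroup.index_ker] at h2
    rw [← h2, mul_comm] at h1
    exact Nat.eq_of_mul_eq_mul_right Nat.card_pos h1
  have hq : ∀ t : ℕ, ∃ U : Bˣ, IsUnit (z + (t : B)) → (U : B) = z + t := by
    intro t
    by_cases h : IsUnit (z + (t : B))
    · obtain ⟨U, hU⟩ := h
      exact ⟨U, fun _ => hU⟩
    · exact ⟨1, fun h' => absurd h' h⟩
  choose q hq using hq
  obtain ⟨s, hs, t, ht, hst, he⟩ := Finset.exists_ne_map_eq_of_card_lt_of_maps_to (s := G) (t := (Finset.univ : Finset Q))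
    (f := fun t => (QuotientGroup.mk (q t) : Q)) (by rw [Finset.card_univ]; omega) (fun _ _ => Finset.mem_coe.2 (Finset.mem_univ _))
  simp only [G, Finset.mem_filter, Finset.mem_range] at hs ht
  obtain ⟨W, hW⟩ := QuotientGroup.eq.1 he
  refine ⟨s, t, hs.1, ht.1, hst, q s, q t, W, hq s hs.2, hq t ht.2, ?_⟩
  rw [powMonoidHom_apply] at hW
  rw [hW, mul_inv_cancel_left]
end SA

namespace SA

lemma line_nc {R : Type} [Ring R] [Finite R] {p k d n T : ℕ} (hp : p.Prime) (h0 : ((p ^ k : ℕ) : R) = 0) (hg : Gen d R)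
    (hn0 : 0 < n) (hnp : n < p) (hT : T = n ^ d + d + 1) (hTp : T ≤ p) (P : Subgroup Rˣ) (hP : ∀ u, u ^ n ∈ P) (z : R) :
    ∃ s t : ℕ, s < T ∧ t < T ∧ s ≠ t ∧ ∃ U V : Rˣ, (U : R) = z + s ∧ (V : R) = z + t ∧ U⁻¹ * V ∈ P := by
  have i1 := twoSided (R := R) p
  let f := Ideal.Quotient.mk (Ideal.span {(p : R)})
  have hf : Function.Surjective f := Ideal.Quotient.mk_surjective
  have hker : ∀ x, f x = 1 → ∃ y, x = 1 + (p : R) ^ 1 * y := by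
    intro x hx
    have : f (x - 1) = 0 := by rw [map_sub, hx, map_one, sub_self]
    obtain ⟨c, hc⟩ := Ideal.mem_span_singleton'.1 (Ideal.Quotient.eq_zero_iff_mem.1 this)
    refine ⟨c, ?_⟩
    rw [pow_one, (Nat.cast_commute p c).eq, hc]; abel
  have hu1 : ∀ x, f x = 1 → IsUnit x := by
    intro x hx
    obtain ⟨y, hy⟩ := hker x hx
    obtain ⟨U, hU⟩ := unit_one_add h0 one_pos y
    exact ⟨U, by rw [hU, hy]⟩
  have hu : ∀ x, IsUnit (f x) → IsUnit x := by
    rintro x ⟨V, hV⟩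
    obtain ⟨y, hy⟩ := hf ((V⁻¹ : (R ⧸ Ideal.span {(p : R)})ˣ) : R ⧸ Ideal.span {(p : R)})
    have a1 := hu1 (x * y) (by rw [map_mul, hy, ← hV, Units.mul_inv])
    have a2 := hu1 (y * x) (by rw [map_mul, hy, ← hV, Units.inv_mul])
    exact isUnit_iff_exists_and_exists.2 ⟨by
      obtain ⟨c, hc⟩ := a1.exists_right_inv
      exact ⟨y * c, by rw [← mul_assoc, hc]⟩, by
      obtain ⟨c, hc⟩ := a2.exists_left_inv
      exact ⟨c * y, by rw [mul_assoc, hc]⟩⟩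
  have hfin : Finite (R ⧸ Ideal.span {(p : R)}) := Finite.of_surjective _ hf
  have hp0 : ((p : ℕ) : R ⧸ Ideal.span {(p : R)}) = 0 := by
    rw [← map_natCast f]
    exact Ideal.Quotient.eq_zero_iff_mem.2 (Ideal.mem_span_singleton_self _)
  have hcard : Nat.card (R ⧸ Ideal.span {(p : R)}) ≤ p ^ d := by
    refine (hg.map f.toAddMonoidHom hf).card hp.pos fun x => ?_
    rw [natCast_zsmul, nsmul_eq_mul, hp0, zero_mul]
  let B := Subring.closure {f z}
  let _ : CommRing B := Subring.closureCommRingOfComm (by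
    intro a ha b hb
    rw [Set.mem_singleton_iff] at ha hb
    rw [ha, hb])
  have hB : Nat.card B ≤ p ^ d := (Nat.card_le_card_of_injective (Subtype.val : B → _) Subtype.val_injective).trans hcard
  obtain ⟨s, t, hs, ht, hst, U, V, W, hU, hV, hW⟩ := line_comm (B := B) (n := n) (d := d) (T := T) hp (Subtype.ext (by simpa using hp0)) hB hn0 hnp hT hTp
    ⟨f z, Subring.subset_closure rfl⟩
  have vU : f (z + s) = ((U : B) : R ⧸ Ideal.span {(p : R)}) := by rw [hU]; simp
  have vV : f (z + t) = ((V : B) : R ⧸ Ideal.span {(p : R)}) := by rw [hV]; simp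
  obtain ⟨U', hU'⟩ := hu (z + s) (by rw [vU]; exact U.isUnit.map B.subtype)
  obtain ⟨V', hV'⟩ := hu (z + t) (by rw [vV]; exact V.isUnit.map B.subtype)
  obtain ⟨w, hw⟩ := hf ((W : B) : R ⧸ Ideal.span {(p : R)})
  obtain ⟨W', hW'⟩ := hu w (by rw [hw]; exact W.isUnit.map B.subtype)
  refine ⟨s, t, hs, ht, hst, U', V', hU', hV', ?_⟩
  have h1 : Units.map f.toMonoidHom V' = Units.map f.toMonoidHom (U' * W' ^ n) := by
    refine Units.ext ?_
    rw [map_mul, map_pow]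
    simp only [Units.coe_map, Units.val_mul, Units.val_pow_eq_pow_val]
    change f V' = f U' * f W' ^ n
    rw [hV', hU', hW', hw, vU, vV, hW]
    push_cast
    rfl
  have h2 : f (((U' * W' ^ n)⁻¹ * V' : Rˣ) : R) = 1 := by
    have : Units.map f.toMonoidHom ((U' * W' ^ n)⁻¹ * V') = 1 := by
      rw [map_mul, map_inv, h1, inv_mul_cancel]
    exact congrArg Units.val this
  obtain ⟨y, hy⟩ := hker _ h2
  have hn' : ¬ p ∣ n := fun h => absurd (Nat.le_of_dvd hn0 h) (by omega)
  have := one_add_mem (v := 0) (n' := n) hp h0 (by simp) hn' P hP k 1 (by omega) (by omega) y _ hy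
  have h3 := mul_mem (hP W') this
  have h4 : W' ^ n * ((U' * W' ^ n)⁻¹ * V') = U'⁻¹ * V' := by group
  rwa [h4] at h3

lemma large_p {R : Type} [Ring R] [Finite R] {p k d n T : ℕ} (hp : p.Prime) (h0 : ((p ^ k : ℕ) : R) = 0) (hg : Gen d R)
    (hn0 : 0 < n) (hnp : n < p) (hT : T = n ^ d + d + 1) (hTp : T ≤ p) : Big n (T * T) R := by
  intro P hP
  have hunit : ∀ s t : ℕ, s < t → t < T → IsUnit ((t : R) - s) := by
    intro s t hst ht
    have hcop : IsCoprime ((t - s : ℤ)) ((p ^ k : ℕ) : ℤ) := by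
      rw [← Nat.cast_sub hst.le]
      refine Nat.isCoprime_iff_coprime.2 (Nat.Coprime.pow_right _ (Nat.Coprime.symm (Nat.coprime_of_lt_prime (by omega) (by omega) hp)))
    obtain ⟨u, w, h⟩ := hcop
    have h' : (u : R) * (t - s) + w * ((p ^ k : ℕ) : R) = 1 := by exact_mod_cast congrArg (Int.cast : ℤ → R) h
    rw [h0, mul_zero, add_zero] at h'
    have hc : Commute (u : R) ((t : R) - s) := Int.cast_commute u _
    exact isUnit_iff_exists.2 ⟨u, by rw [← hc.eq, h'], h'⟩
  have hunit' : ∀ s t : ℕ, s ≠ t → s < T → t < T → IsUnit ((t : R) - s) := by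
    intro s t hst hs ht
    rcases lt_or_gt_of_ne hst with h | h
    · exact hunit s t h ht
    · rw [← neg_sub]; exact (hunit t s h hs).neg
  have key : ∀ q : R × Rˣ, ∃ r : (Fin T × Fin T) × (Rˣ × P), (r.1.1 ≠ r.1.2) ∧ (r.2.1 : R) = q.1 + (r.1.1 : ℕ) * q.2 ∧
      ((r.2.1 * r.2.2 : Rˣ) : R) = q.1 + (r.1.2 : ℕ) * q.2 := by
    rintro ⟨x, y⟩
    obtain ⟨s, t, hs, ht, hst, U, V, hU, hV, hm⟩ := line_nc hp h0 hg hn0 hnp hT hTp P hP (((y⁻¹ : Rˣ) : R) * x)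
    refine ⟨((⟨s, hs⟩, ⟨t, ht⟩), (y * U, ⟨U⁻¹ * V, hm⟩)), ?_, ?_, ?_⟩
    · simpa using hst
    · simp only [Units.val_mul, hU, mul_add, Units.mul_inv_cancel_left]
      rw [(Nat.cast_commute s (y : R)).eq]
    · simp only [mul_assoc, mul_inv_cancel_left]
      simp only [Units.val_mul, hV, mul_add, Units.mul_inv_cancel_left]
      rw [(Nat.cast_commute t (y : R)).eq]
  choose F hF using key
  have hinj : Function.Injective F := by
    intro q q' h
    obtain ⟨a1, a2, a3⟩ := hF q
    obtain ⟨b1, b2, b3⟩ := hF q'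
    rw [← h] at b1 b2 b3
    have e1 := a2.symm.trans b2
    have e2 := a3.symm.trans b3
    have e3 : (((F q).1.2 : ℕ) - ((F q).1.1 : ℕ) : R) * q.2 = (((F q).1.2 : ℕ) - ((F q).1.1 : ℕ) : R) * q'.2 := by
      rw [sub_mul, sub_mul]
      have := congrArg₂ (· - ·) e2 e1
      simp only [add_sub_add_left_eq_sub] at this
      exact this
    have hu := hunit' (F q).1.1 (F q).1.2 (fun h => a1 (Fin.ext h)) (F q).1.1.2 (F q).1.2.2
    have e4 := hu.mul_left_cancel e3
    rw [e4] at e1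
    exact Prod.ext (add_right_cancel e1) (Units.ext e4)
  have := Nat.card_le_card_of_injective F hinj
  simp only [Nat.card_prod, Nat.card_fin] at this
  have hpos : 0 < Nat.card Rˣ := Nat.card_pos
  have h2 : Nat.card R * Nat.card Rˣ ≤ (T * T * Nat.card P) * Nat.card Rˣ := this.trans (le_of_eq (by ring))
  exact Nat.le_of_mul_le_mul_right h2 hpos

theorem big_all {n d : ℕ} (hn : 0 < n) (hd : 0 < d) : ∃ c : ℕ, 0 < c ∧ ∀ N : ℕ, 0 < N → ∀ (R : Type) [Ring R] [Finite R], Gen d R → (N : R) = 0 →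
    Big n (c ^ N.primeFactors.card) R := by
  obtain ⟨T, hT⟩ : ∃ T, T = n ^ d + d + 1 := ⟨_, rfl⟩
  have hnT : n < T := by
    have : n ^ 1 ≤ n ^ d := Nat.pow_le_pow_right hn hd
    rw [pow_one] at this
    omega
  refine ⟨T ^ (3 * d), Nat.pow_pos (by omega), fun N hN => big_of_pp ?_ N hN⟩
  intro p k hp hk R _ _ hg h0
  by_cases hpT : p ≤ T
  · exact small_p hp h0 hn.ne' hg hpT hnT.le
  · refine (large_p hp h0 hg hn (by omega) hT (by omega)).mono ?_
    rw [← pow_two]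
    exact Nat.pow_le_pow_right (by omega) (by omega)
end SA

namespace SA

lemma growth (c : ℕ) (hc : 0 < c) (ε : ℝ) (hε : 0 < ε) : ∃ C : ℝ, 0 < C ∧ ∀ N : ℕ, 0 < N → ((c : ℝ) ^ N.primeFactors.card) ≤ C * (N : ℝ) ^ ε := by
  obtain ⟨K, hK⟩ := exists_nat_ge ((c : ℝ) ^ (1 / ε))
  have hc1 : (1 : ℝ) ≤ c := by exact_mod_cast hc
  refine ⟨(c : ℝ) ^ K, by positivity, fun N hN => ?_⟩
  have h1 : ∀ p ∈ N.primeFactors, (c : ℝ) ≤ (if p < K then (c : ℝ) else 1) * (p : ℝ) ^ ε := by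
    intro p hp
    have hp1 : (1 : ℝ) ≤ p := by exact_mod_cast (Nat.prime_of_mem_primeFactors hp).one_le
    split_ifs with h
    · exact le_mul_of_one_le_right (by positivity) (Real.one_le_rpow hp1 hε.le)
    · rw [one_mul]
      have : (c : ℝ) ^ (1 / ε) ≤ p := hK.trans (by exact_mod_cast not_lt.1 h)
      calc (c : ℝ) = ((c : ℝ) ^ (1 / ε)) ^ ε := by
            rw [← Real.rpow_mul (by positivity), one_div_mul_cancel hε.ne', Real.rpow_one]
        _ ≤ (p : ℝ) ^ ε := Real.rpow_le_rpow (by positivity) this hε.le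
  calc (c : ℝ) ^ N.primeFactors.card = ∏ p ∈ N.primeFactors, (c : ℝ) := by rw [Finset.prod_const]
    _ ≤ ∏ p ∈ N.primeFactors, ((if p < K then (c : ℝ) else 1) * (p : ℝ) ^ ε) :=
        Finset.prod_le_prod (fun _ _ => by positivity) h1
    _ = (∏ p ∈ N.primeFactors, (if p < K then (c : ℝ) else 1)) * ∏ p ∈ N.primeFactors, (p : ℝ) ^ ε := Finset.prod_mul_distrib
    _ ≤ (c : ℝ) ^ K * (N : ℝ) ^ ε := by
      refine mul_le_mul ?_ ?_ (Finset.prod_nonneg fun _ _ => by positivity) (by positivity)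
      · rw [← Finset.prod_filter, Finset.prod_const]
        refine pow_le_pow_right₀ hc1 ?_
        calc _ ≤ (Finset.range K).card := Finset.card_le_card fun p hp => by
              simp only [Finset.mem_filter] at hp
              exact Finset.mem_range.2 hp.2
          _ = K := Finset.card_range K
      · rw [Real.finsetProd_rpow _ _ (fun _ _ => by positivity)]
        refine Real.rpow_le_rpow (Finset.prod_nonneg fun _ _ => by positivity) ?_ hε.le
        rw [← Nat.cast_prod]
        exact_mod_cast Nat.le_of_dvd hN (Nat.prod_primeFactors_dvd N)

lemma Gen.finite {d : ℕ} {R : Type} [AddCommGroup R] (h : Gen d R) {k : ℕ} (hk : 0 < k) (h0 : ∀ x : R, (k : ℤ) • x = 0) :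
    Finite R := by
  obtain ⟨g, hg⟩ := h
  have : NeZero k := ⟨hk.ne'⟩
  let F : (Fin d → ZMod k) → R := fun z => ∑ i, ((z i).val : ℤ) • g i
  have hF : Function.Surjective F := by
    intro x
    obtain ⟨z, hz⟩ := hg x
    refine ⟨fun i => (z i : ZMod k), ?_⟩
    rw [hz]
    refine Finset.sum_congr rfl fun i _ => ?_
    rw [ZMod.val_intCast]
    conv_rhs => rw [← Int.emod_add_mul_ediv (z i) k, add_smul, mul_smul, h0, add_zero]
  exact Finite.of_surjective F hF

lemma card_quot {X Y : Type} (r : X → X → Prop) (F : X → Y) (h : ∀ x y, r x y ↔ F x = F y) :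
    Nat.card (Quot r) = Nat.card (Set.range F) := by
  refine Nat.card_congr (Equiv.ofBijective (Quot.lift (fun x => (⟨F x, x, rfl⟩ : Set.range F)) fun x y hxy => Subtype.ext ((h x y).1 hxy)) ⟨?_, ?_⟩)
  · rintro ⟨x⟩ ⟨y⟩ hxy
    exact Quot.sound ((h x y).2 (congrArg Subtype.val hxy))
  · rintro ⟨_, x, rfl⟩
    exact ⟨Quot.mk _ x, rfl⟩

/-- group-theoretic counting step -/
lemma count {R : Type} [Ring R] [Finite R] (R' : Subring R) {X : Type} (φ : X → Rˣ) (r : X → X → Prop) {N c n : ℕ}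
    (hr : ∀ x y, r x y ↔ (φ x)⁻¹ * φ y ∈ R'.toSubmonoid.units)
    (hN : N = R'.toAddSubgroup.index) (P : Subgroup Rˣ) (hP : ∀ u, u ^ n ∈ P)
    (hPX : ∀ u ∈ P, ∃ x, (φ x)⁻¹ * u ∈ R'.toSubmonoid.units)
    (hb : Big n c R) (hb' : Big n c R') : N ≤ c * Nat.card (Quot r) ∧ Nat.card (Quot r) ≤ N * c := by
  let H := R'.toSubmonoid.units
  let F : X → Rˣ ⧸ H := fun x => QuotientGroup.mk (φ x)
  rw [card_quot r F (fun x y => (hr x y).trans QuotientGroup.eq.symm)]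
  have hR : Nat.card R = Nat.card R' * N := by
    rw [hN]; exact (AddSubgroup.card_mul_index R'.toAddSubgroup).symm
  have hH : Nat.card H = Nat.card R'ˣ := Nat.card_congr R'.toSubmonoid.unitsEquivUnitsType.toEquiv
  have hH1 : Nat.card R' ≤ c * Nat.card H := by
    have := hb' ⊤ (fun _ => trivial)
    rwa [Nat.card_congr (Subgroup.topEquiv (G := R'ˣ)).toEquiv, ← hH] at this
  have hH2 : Nat.card H ≤ Nat.card R' := by
    rw [hH]
    exact Nat.card_le_card_of_injective (fun u : R'ˣ => (u : R')) Units.val_injective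
  have hHpos : 0 < Nat.card H := Nat.card_pos
  constructor
  · have h1 := hb P hP
    have h2 : Nat.card P ≤ Nat.card H * Nat.card (Set.range F) := by
      rw [← Nat.card_prod, ← Nat.card_congr (QuotientGroup.preimageMkEquivSubgroupProdSet H (Set.range F))]
      refine Nat.card_le_card_of_injective (fun u : P => (⟨(u : Rˣ), ?_⟩ : (QuotientGroup.mk : Rˣ → Rˣ ⧸ H) ⁻¹' Set.range F)) ?_
      · obtain ⟨x, hx⟩ := hPX u u.2
        exact ⟨x, QuotientGroup.eq.2 hx⟩
      · intro u v h
        exact Subtype.ext (by simpa using h)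
    have hpos : 0 < Nat.card R' := Nat.card_pos
    refine Nat.le_of_mul_le_mul_left ?_ hpos
    calc Nat.card R' * N ≤ c * Nat.card P := hR ▸ h1
      _ ≤ c * (Nat.card H * Nat.card (Set.range F)) := Nat.mul_le_mul_left _ h2
      _ ≤ c * (Nat.card R' * Nat.card (Set.range F)) := by gcongr
      _ = _ := by ring
  · have h1 : Nat.card (Set.range F) ≤ H.index := Nat.card_le_card_of_injective Subtype.val Subtype.val_injective
    refine h1.trans (Nat.le_of_mul_le_mul_left ?_ hHpos)
    rw [Subgroup.card_mul_index]
    calc Nat.card Rˣ ≤ Nat.card R := Nat.card_le_card_of_injective _ Units.val_injective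
      _ = Nat.card R' * N := hR
      _ ≤ c * Nat.card H * N := Nat.mul_le_mul_right _ hH1
      _ = _ := by ring
end SA

namespace SA

lemma gen_of_basis {A : Type} [DivisionRing A] [CharZero A] {d : ℕ} (O : Subring A) (e : Module.Basis (Fin d) ℚ A)
    (he : ∀ x, x ∈ O ↔ ∀ i, ∃ z : ℤ, e.repr x i = z) : Gen d O := by
  have hmem : ∀ i, e i ∈ O := by
    intro i
    rw [he]
    intro j
    rw [e.repr_self, Finsupp.single_apply]
    split_ifs
    · exact ⟨1, by simp⟩
    · exact ⟨0, by simp⟩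
  refine ⟨fun i => ⟨e i, hmem i⟩, fun x => ?_⟩
  choose z hz using (he x).1 x.2
  refine ⟨z, Subtype.ext ?_⟩
  rw [← e.sum_repr (x : A)]
  push_cast
  refine Finset.sum_congr rfl fun i _ => ?_
  rw [hz, Int.cast_smul_eq_zsmul]

lemma exists_common {A : Type} [DivisionRing A] [CharZero A] {d : ℕ} (O M : Subring A) (hg : Gen d M) (e : Module.Basis (Fin d) ℚ A)
    (he : ∀ x, x ∈ O ↔ ∀ i, ∃ z : ℤ, e.repr x i = z) : ∃ k : ℕ, 0 < k ∧ ∀ x ∈ M, k • x ∈ O := by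
  obtain ⟨g, hg⟩ := hg
  let k := ∏ q : Fin d × Fin d, (e.repr (g q.1 : A) q.2).den
  have hk : ∀ i, k • (g i : A) ∈ O := by
    intro i
    rw [he]
    intro j
    obtain ⟨m, hm⟩ : (e.repr (g i : A) j).den ∣ k := Finset.dvd_prod_of_mem (fun q : Fin d × Fin d => (e.repr (g q.1 : A) q.2).den) (Finset.mem_univ (i, j))
    refine ⟨m * (e.repr (g i : A) j).num, ?_⟩
    rw [map_nsmul, Finsupp.smul_apply, hm, nsmul_eq_mul]
    push_cast
    rw [mul_comm, ← mul_assoc, Rat.mul_den_eq_num, mul_comm]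
  refine ⟨k, Finset.prod_pos fun q _ => Rat.den_pos _, fun x hx => ?_⟩
  obtain ⟨z, hz⟩ := hg ⟨x, hx⟩
  have : x = ∑ i, z i • (g i : A) := by
    have := congrArg Subtype.val hz
    push_cast at this
    exact this
  rw [this, Finset.smul_sum]
  refine sum_mem fun i _ => ?_
  rw [smul_comm]
  exact zsmul_mem (hk i) _

lemma inv_mod {R : Type} [Ring R] {a b c : ℤ} {N : ℕ} (h : a * b + c * N = 1) (h0 : (N : R) = 0) : (a : R) * b = 1 := by
  have := congrArg (Int.cast : ℤ → R) h
  push_cast at this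
  rwa [h0, mul_zero, add_zero] at this

lemma final (n : ℕ) (hn : 2 ≤ n) : ∃ c : ℕ, 0 < c ∧ 
      ∀ (A : Type) [DivisionRing A] [CharZero A]
        (ι : A →ₐ[ℚ] Matrix (Fin n) (Fin n) ℝ),
        Subalgebra.center ℚ A = ⊥ →
        Module.finrank ℚ A = n ^ 2 →
        ∀ O Om : Subring A, IsOrder A O → IsOrder A Om → O ≤ Om →
        0 < O.toAddSubgroup.relIndex Om.toAddSubgroup ∧
        O.toAddSubgroup.relIndex Om.toAddSubgroup ≤ c ^ (O.toAddSubgroup.relIndex Om.toAddSubgroup).primeFactors.card * normOneUnitIndex ι O Om ∧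
        normOneUnitIndex ι O Om ≤ O.toAddSubgroup.relIndex Om.toAddSubgroup * c ^ (O.toAddSubgroup.relIndex Om.toAddSubgroup).primeFactors.card := by
  have hd : 0 < n ^ 2 := by positivity
  obtain ⟨c, hc, hbig⟩ := big_all (n := n) (d := n ^ 2) (by omega) hd
  refine ⟨c, hc, ?_⟩
  intro A _ _ ι hcen hfr O Om hO hOm hle
  obtain ⟨e, he⟩ := exists_int_basis hfr hd Om hOm.1 hOm.2
  obtain ⟨e', he'⟩ := exists_int_basis hfr hd O hO.1 hO.2
  let S : Ctx A n := ⟨hn, hcen, ι, Om, e, he⟩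
  have gM : Gen (n ^ 2) Om := gen_of_basis Om e he
  have gO : Gen (n ^ 2) O := gen_of_basis O e' he'
  let O' : Subring Om := O.comap Om.subtype
  have memO' : ∀ x : Om, x ∈ O' ↔ (x : A) ∈ O := fun x => Iff.rfl
  obtain ⟨N, hN⟩ : ∃ N, N = O.toAddSubgroup.relIndex Om.toAddSubgroup := ⟨_, rfl⟩
  have hNi : N = O'.toAddSubgroup.index := hN
  rw [← hN]
  have hNpos : 0 < N := by
    obtain ⟨k, hk, hk'⟩ := exists_common O Om gM e' he'
    have : Finite (Om ⧸ O'.toAddSubgroup) := by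
      refine (gM.map (QuotientAddGroup.mk' O'.toAddSubgroup) (QuotientAddGroup.mk'_surjective _)).finite hk fun x => ?_
      obtain ⟨x, rfl⟩ := QuotientAddGroup.mk'_surjective _ x
      rw [← map_zsmul]
      refine (QuotientAddGroup.eq_zero_iff _).2 ?_
      have := hk' x x.2
      rw [natCast_zsmul]
      exact this
    rw [hNi]
    exact Nat.card_pos
  refine ⟨hNpos, ?_⟩
  have hNO : ∀ x : Om, (N : Om) * x ∈ O' := by
    intro x
    rw [← nsmul_eq_mul, hNi]
    exact AddSubgroup.nsmul_index_mem O'.toAddSubgroup x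
  have its := twoSided (R := Om) N
  let R := Om ⧸ Ideal.span {(N : Om)}
  let π : Om →+* R := Ideal.Quotient.mk _
  have hπ : Function.Surjective π := Ideal.Quotient.mk_surjective
  have hker : ∀ x y, π x = π y ↔ ∃ w, x = y + N * w := by
    intro x y
    rw [Ideal.Quotient.eq, Ideal.mem_span_singleton']
    constructor
    · rintro ⟨w, hw⟩
      exact ⟨w, by rw [(Nat.cast_commute N w).eq, hw]; abel⟩
    · rintro ⟨w, rfl⟩
      exact ⟨w, by rw [← (Nat.cast_commute N w).eq]; abel⟩
  have hR0 : (N : R) = 0 := by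
    rw [← map_natCast π]
    exact Ideal.Quotient.eq_zero_iff_mem.2 (Ideal.mem_span_singleton_self _)
  have gR : Gen (n ^ 2) R := gM.map π.toAddMonoidHom hπ
  have finR : Finite R := gR.finite hNpos fun x => by rw [natCast_zsmul, nsmul_eq_mul, hR0, zero_mul]
  let R' : Subring R := O'.map π
  have memR' : ∀ x, π x ∈ R' ↔ x ∈ O' := by
    intro x
    constructor
    · rintro ⟨y, hy, hxy⟩
      obtain ⟨w, rfl⟩ := (hker _ _).1 hxy.symm
      exact add_mem hy (hNO w)
    · exact fun h => ⟨x, h, rfl⟩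
  have hidx : N = R'.toAddSubgroup.index := by
    refine hNi.trans ?_
    rw [← AddSubgroup.index_comap_of_surjective (f := π.toAddMonoidHom) R'.toAddSubgroup hπ]
    congr 1
    ext x
    exact (memR' x).symm
  have gR' : Gen (n ^ 2) R' := by
    refine gO.map (AddMonoidHom.mk' (fun x : O => (⟨π ⟨x, hle x.2⟩, ⟨⟨x, hle x.2⟩, x.2, rfl⟩⟩ : R')) ?_) ?_
    · intro a b
      refine Subtype.ext ?_
      change π _ = π _ + π _
      rw [← map_add]
      rfl
    · rintro ⟨_, y, hy, rfl⟩
      exact ⟨⟨y, hy⟩, rfl⟩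
  have hR0' : (N : R') = 0 := Subtype.ext (by simpa using hR0)
  have hdet : ∀ x, (ι x).det = 1 ↔ S.nr x = 1 := by
    intro x
    rw [S.det x ι]
    norm_cast
  let X := {x : A // x ∈ Om ∧ (ι x).det = 1}
  have hinv : ∀ x : X, (x : A)⁻¹ ∈ Om := fun x => S.inv_mem x.2.1 ((hdet _).1 x.2.2)
  have hx0 : ∀ x : X, (x : A) ≠ 0 := fun x h => by
    have := (hdet _).1 x.2.2
    rw [h, S.nr_zero] at this
    exact zero_ne_one this
  let ψ : X → Omˣ := fun x => ⟨⟨x, x.2.1⟩, ⟨(x : A)⁻¹, hinv x⟩, Subtype.ext (mul_inv_cancel₀ (hx0 x)), Subtype.ext (inv_mul_cancel₀ (hx0 x))⟩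
  let φ : X → Rˣ := fun x => Units.map π.toMonoidHom (ψ x)
  have hψ : ∀ (x : X) (y : A) (hy : y ∈ Om), ((ψ x : Omˣ) : Om) * ⟨y, hy⟩ = ⟨x * y, mul_mem x.2.1 hy⟩ := fun x y hy => rfl
  have hO1 : ∀ γ : Omˣ, ((γ : Om) : A) ∈ O → S.nr ((γ : Om) : A) = 1 → ((γ⁻¹ : Omˣ) : Om) ∈ O' := by
    intro γ h1 h2
    let S' : Ctx A n := ⟨hn, hcen, ι, O, e', he'⟩
    have h3 : S'.nr ((γ : Om) : A) = 1 := by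
      have := S'.det ((γ : Om) : A) ι
      rw [(hdet _).2 h2] at this
      exact_mod_cast this.symm
    have h4 := S'.inv_mem h1 h3
    have h5 : (((γ⁻¹ : Omˣ) : Om) : A) = ((γ : Om) : A)⁻¹ := by
      refine eq_inv_of_mul_eq_one_left ?_
      have := congrArg Subtype.val γ.inv_mul
      exact this
    rw [memO', h5]
    exact h4
  have hnrψ : ∀ x : X, S.nr (((ψ x : Omˣ) : Om) : A) = 1 := fun x => (hdet _).1 x.2.2
  have hnrinv : ∀ x : X, S.nr ((((ψ x)⁻¹ : Omˣ) : Om) : A) = 1 := by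
    intro x
    change S.nr ((x : A)⁻¹) = 1
    have h1 : S.nr ((x : A)⁻¹ * x) = 1 := by rw [inv_mul_cancel₀ (hx0 x), map_one]
    rwa [map_mul, (hdet _).1 x.2.2, mul_one] at h1
  let nrU : Omˣ →* ℚ := S.nr.comp (Om.subtype.toMonoidHom.comp (Units.coeHom Om))
  have hnrU : ∀ u : Omˣ, nrU u = S.nr ((u : Om) : A) := fun _ => rfl
  have hsur : ∀ u : Omˣ, nrU u = 1 → ∃ x, ψ x = u := by
    intro u hu
    exact ⟨⟨((u : Om) : A), (u : Om).2, (hdet _).2 hu⟩, Units.ext (Subtype.ext rfl)⟩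
  let Z : Subgroup Rˣ := Subgroup.center Rˣ ⊓ R'.toSubmonoid.units
  have hZn : Z.Normal := by
    refine ⟨fun z hz g => ?_⟩
    have : g * z * g⁻¹ = z := by
      rw [Subgroup.mem_center_iff.1 hz.1 g, mul_inv_cancel_right]
    rwa [this]
  refine count R' φ _ ?_ hidx ((nrU.ker).map (Units.map π.toMonoidHom) ⊔ Z) ?_ ?_ (hbig N hNpos R gR hR0) (hbig N hNpos R' gR' hR0')
  · intro x y
    let δ : Omˣ := (ψ y)⁻¹ * ψ x
    have hδv : ((δ : Om) : A) = (y : A)⁻¹ * x := rfl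
    have hδn : S.nr ((δ : Om) : A) = 1 := by
      rw [← hnrU]
      simp only [δ, map_mul, map_inv]
      rw [hnrU, hnrU, hnrψ, hnrψ]
      simp
    have hφ : (φ x)⁻¹ * φ y = (Units.map π.toMonoidHom δ)⁻¹ := by
      simp only [δ, map_mul, map_inv, φ]
      rw [_root_.mul_inv_rev, inv_inv]
    rw [hφ, inv_mem_iff, Submonoid.mem_units_iff, ← map_inv]
    have m1 : ((Units.map π.toMonoidHom δ : Rˣ) : R) ∈ R'.toSubmonoid ↔ (δ : Om) ∈ O' := memR' _
    have m2 : ((Units.map π.toMonoidHom δ⁻¹ : Rˣ) : R) ∈ R'.toSubmonoid ↔ ((δ⁻¹ : Omˣ) : Om) ∈ O' := memR' _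
    rw [m1, m2]
    constructor
    · rintro ⟨γ, hγ, hγ1, hxy⟩
      have : ((δ : Om) : A) = γ := by rw [hδv, hxy, inv_mul_cancel_left₀ (hx0 y)]
      have hm : ((δ : Om) : A) ∈ O := this ▸ hγ
      exact ⟨hm, hO1 δ hm hδn⟩
    · rintro ⟨h1, h2⟩
      refine ⟨((δ : Om) : A), h1, (hdet _).2 hδn, ?_⟩
      rw [hδv, mul_inv_cancel_left₀ (hx0 y)]
  · intro u
    obtain ⟨x0, hx0'⟩ := hπ (u : R)
    obtain ⟨y0, hy0'⟩ := hπ ((u⁻¹ : Rˣ) : R)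
    obtain ⟨z0, hz0⟩ := (hker (x0 * y0) 1).1 (by rw [map_mul, hx0', hy0', Units.mul_inv, map_one])
    have hz0' : (x0 : A) * y0 = 1 + (N : ℚ) • (z0 : A) := by
      have := congrArg Subtype.val hz0
      push_cast at this
      rw [this, Nat.cast_smul_eq_nsmul, nsmul_eq_mul]
    obtain ⟨γ, hγ, hγ1, D, hD, w, hw, hDw⟩ := S.main hNpos.ne' x0.2 y0.2 z0.2 hz0'
    have hγX := (hdet γ).2 hγ1
    obtain ⟨D', E, hDE⟩ := hD
    have hDE' : (D' : R) * D = 1 := inv_mod hDE hR0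
    let Du : Rˣ := ⟨(D : R), (D' : R), by rw [(Int.cast_commute D (D' : R)).eq, hDE'], hDE'⟩
    have hDZ : Du ∈ Z := by
      refine ⟨Subgroup.mem_center_iff.2 fun g => Units.ext ?_, Submonoid.mem_units_iff _ _ |>.2 ⟨intCast_mem R' D, intCast_mem R' D'⟩⟩
      exact (Int.cast_commute D (g : R)).eq.symm
    have hun : u ^ n = φ ⟨γ, hγ, hγX⟩ * Du := by
      refine Units.ext ?_
      rw [Units.val_pow_eq_pow_val, ← hx0', ← map_pow, Units.val_mul]
      change π (x0 ^ n) = π ⟨γ, hγ⟩ * (D : R)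
      rw [← map_intCast π, ← map_mul, hker]
      refine ⟨⟨-w, neg_mem hw⟩, Subtype.ext ?_⟩
      push_cast
      rw [← (Int.cast_commute D γ).eq]
      have h1 : (D : ℚ) • γ = (D : A) * γ := by rw [Int.cast_smul_eq_zsmul, zsmul_eq_mul]
      have h2 : (N : ℚ) • w = (N : A) * w := by rw [Nat.cast_smul_eq_nsmul, nsmul_eq_mul]
      rw [h1, h2] at hDw
      rw [mul_neg, ← hDw]
      abel
    rw [hun]
    refine mul_mem (Subgroup.mem_sup_left ⟨ψ ⟨γ, hγ, hγX⟩, hγ1, rfl⟩) (Subgroup.mem_sup_right hDZ)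
  · intro u hu
    obtain ⟨a, ⟨g, hg, rfl⟩, b, hb, rfl⟩ := Subgroup.mem_sup_of_normal_right.1 hu
    obtain ⟨x, rfl⟩ := hsur g hg
    refine ⟨x, ?_⟩
    have : (φ x)⁻¹ * (Units.map π.toMonoidHom (ψ x) * b) = b := inv_mul_cancel_left _ _
    rw [this]
    exact hb.2
end SA

/-- For every `n ≥ 2` and `ε > 0` there is `C > 0`, depending only on `n`
and `ε`, such that for every real-split central division `ℚ`-algebra `A` of degree `n` and
all orders `𝒪 ⊆ 𝒪ₘ` with additive index `N = [𝒪ₘ : 𝒪]`, one has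
`C⁻¹ · N^(1-ε) ≤ [𝒪ₘ¹ : 𝒪¹] ≤ C · N^(1+ε)`. -/
theorem stmt0 (n : ℕ) (hn : 2 ≤ n) (ε : ℝ) (hε : 0 < ε) :
    ∃ C : ℝ, 0 < C ∧
      ∀ (A : Type) [DivisionRing A] [CharZero A]
        (ι : A →ₐ[ℚ] Matrix (Fin n) (Fin n) ℝ),
        Function.Injective ι →
        Subalgebra.center ℚ A = ⊥ →
        Module.finrank ℚ A = n ^ 2 →
        ∀ O Om : Subring A, IsOrder A O → IsOrder A Om → O ≤ Om →
        C⁻¹ * ((O.toAddSubgroup.relIndex Om.toAddSubgroup : ℝ)) ^ ((1 : ℝ) - ε) ≤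
            (normOneUnitIndex ι O Om : ℝ) ∧
          (normOneUnitIndex ι O Om : ℝ) ≤
            C * ((O.toAddSubgroup.relIndex Om.toAddSubgroup : ℝ)) ^ ((1 : ℝ) + ε) := by
  obtain ⟨c, hc, hfin⟩ := SA.final n hn
  obtain ⟨C, hC, hgr⟩ := SA.growth c hc ε hε
  refine ⟨C, hC, ?_⟩
  intro A _ _ ι _ hcen hfr O Om hO hOm hle
  obtain ⟨hpos, h1, h2⟩ := hfin A ι hcen hfr O Om hO hOm hle
  generalize O.toAddSubgroup.relIndex Om.toAddSubgroup = N at *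
  generalize normOneUnitIndex ι O Om = m at *
  have hg := hgr N hpos
  have hN : (0 : ℝ) < N := by exact_mod_cast hpos
  have h1' : (N : ℝ) ≤ (c : ℝ) ^ N.primeFactors.card * m := by exact_mod_cast h1
  have h2' : (m : ℝ) ≤ N * (c : ℝ) ^ N.primeFactors.card := by exact_mod_cast h2
  have hNε : (0 : ℝ) < (N : ℝ) ^ ε := Real.rpow_pos_of_pos hN ε
  constructor
  · rw [Real.rpow_sub hN, Real.rpow_one, inv_mul_le_iff₀ hC, div_le_iff₀ hNε]
    calc (N : ℝ) ≤ (c : ℝ) ^ N.primeFactors.card * m := h1'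
      _ ≤ (C * (N : ℝ) ^ ε) * m := by gcongr
      _ = C * m * (N : ℝ) ^ ε := by ring
  · rw [Real.rpow_add hN, Real.rpow_one]
    calc (m : ℝ) ≤ N * (c : ℝ) ^ N.primeFactors.card := h2'
      _ ≤ N * (C * (N : ℝ) ^ ε) := by gcongr
      _ = C * (N * (N : ℝ) ^ ε) := by ring
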